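/- arXiv:math/9907177 — 8 statements merged into one kernel-verified Lean document; each statement's English description precedes it below -/
import Mathlib

section
/- Let R be a commutative ring and h : ℤ → R a function satisfying h(0) = 1 and h(k) = 0 for all k < 0, and define Schur functions by the Jacobi–Trudi determinant. Let λ be a partition whose Young diagram has n outside corners, with corner coordinates (x_1,y_1),…,(x_n,y_n). Fix an integer k with 1 ≤ k ≤ n and set ℓ := y_k (the k-th shortest column height of λ). Then s_λ · s_λ = s_{λ+ω_ℓ} · s_{λ−ω_ℓ} + Σ_{r=1}^{min(k, n−k+1)} Σ_{1 ≤ i_1 < ⋯ < i_r ≤ k ≤ j_r < ⋯ < j_1 ≤ n} (−1)^{r−1} · s_{π^{i_1⋯i_r}_{j_1⋯j_r}(λ)} · s_{μ^{i_1⋯i_r}_{j_1⋯j_r}(λ)}, where the inner sum is over all chains of nested intervals [i_1,j_1] ⊃ ⋯ ⊃ [i_r,j_r] with i_1 < ⋯ < i_r ≤ k ≤ j_r < ⋯ < j_1. -/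
/-!  Corner-coordinate machinery.  A partition with `n` outside corners is
recorded by its corner coordinates `X, Y : Fin n → ℕ` (`X` strictly decreasing,
`Y` strictly increasing in the intended applications, both 1-indexed values).
Its `a`-th part (for `a ≥ 1`) is `X i` for the least `i` with `a ≤ Y i`, i.e.
`max {X i : a ≤ Y i}` since `X` is decreasing; for `a` beyond `Y` last it is `0`. -/

/-- The `a`-th part (1-indexed) of the partition with corner coordinates `X, Y`. -/
def cornerPart {n : ℕ} (X Y : Fin n → ℕ) (a : ℕ) : ℕ :=
  (Finset.univ.filter fun i => a ≤ Y i).sup X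

/-- `x`-coordinates after applying `π^{i_1⋯i_r}_{j_1⋯j_r}`: add `1` to each of
`x_{i_s+1}, …, x_{j_s}` for every `s`.  Indices in `Fin n` are 0-indexed, so the
condition `i_s + 1 ≤ a ≤ j_s` (1-indexed) reads `I s < a ∧ a ≤ J s`. -/
def piX {n r : ℕ} (x : Fin n → ℕ) (I J : Fin r → Fin n) : Fin n → ℕ :=
  fun a => x a + (Finset.univ.filter fun s => I s < a ∧ a ≤ J s).card

/-- `y`-coordinates after applying `π`: add `1` to each of `y_{i_s}, …, y_{j_s}`. -/
def piY {n r : ℕ} (y : Fin n → ℕ) (I J : Fin r → Fin n) : Fin n → ℕ :=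
  fun a => y a + (Finset.univ.filter fun s => I s ≤ a ∧ a ≤ J s).card

/-- `x`-coordinates after applying `μ^{i_1⋯i_r}_{j_1⋯j_r}` (subtract instead of add;
the subtraction does not truncate under the hypotheses of the theorem). -/
def muX {n r : ℕ} (x : Fin n → ℕ) (I J : Fin r → Fin n) : Fin n → ℕ :=
  fun a => x a - (Finset.univ.filter fun s => I s < a ∧ a ≤ J s).card

/-- `y`-coordinates after applying `μ`. -/
def muY {n r : ℕ} (y : Fin n → ℕ) (I J : Fin r → Fin n) : Fin n → ℕ :=
  fun a => y a - (Finset.univ.filter fun s => I s ≤ a ∧ a ≤ J s).card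

/-- The Schur function attached to a part function `p : ℕ → ℕ` (1-indexed parts,
eventually `0`), computed as the Jacobi–Trudi determinant of size `N`:
`det (h (p i − i + j))_{i,j=1}^N`.  Under `h 0 = 1`, `h k = 0` for `k < 0`, this
is independent of the padding size `N` as long as `N` is at least the number of
nonzero parts. -/
noncomputable def schurPad {R : Type*} [CommRing R] (h : ℤ → R) (N : ℕ)
    (p : ℕ → ℕ) : R :=
  Matrix.det (Matrix.of fun i j : Fin N =>
    h ((p ((i : ℕ) + 1) : ℤ) - (i : ℕ) + (j : ℕ)))

/-- Add a column of height `ℓ` to the partition with parts `p`: `λ + ω_ℓ`. -/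
def plusCol (p : ℕ → ℕ) (ℓ : ℕ) : ℕ → ℕ :=
  fun a => p a + (if a ≤ ℓ then 1 else 0)

/-- Remove a column of height `ℓ` from the partition with parts `p`: `λ − ω_ℓ`. -/
def minusCol (p : ℕ → ℕ) (ℓ : ℕ) : ℕ → ℕ :=
  fun a => p a - (if a ≤ ℓ then 1 else 0)

theorem cornerPart_eq_of_isLeast {n : ℕ} {X Y : Fin n → ℕ} (hX : Antitone X) {a : ℕ} {m : Fin n}
    (hm : a ≤ Y m) (hlt : ∀ b < m, Y b < a) : cornerPart X Y a = X m := by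
  apply le_antisymm
  · refine Finset.sup_le fun b hb => hX ?_
    by_contra! hbm
    have := hlt b hbm
    simp at hb
    omega
  · exact Finset.le_sup (f := X) (by simpa using hm)

theorem cornerPart_eq_zero {n : ℕ} {X Y : Fin n → ℕ} {a : ℕ} (h : ∀ m, Y m < a) :
    cornerPart X Y a = 0 := by
  simp [cornerPart, Finset.filter_false_of_mem fun m _ => (h m).not_ge]

theorem forall_lt_or_exists_least {n : ℕ} (Y : Fin n → ℕ) (a : ℕ) :
    (∀ m, Y m < a) ∨ ∃ m, a ≤ Y m ∧ ∀ b < m, Y b < a := by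
  by_cases h : ∃ m, a ≤ Y m
  · right
    obtain ⟨m, hm, hmin⟩ := WellFounded.has_min (wellFounded_lt (α := Fin n)) {m | a ≤ Y m} h
    exact ⟨m, hm, fun b hb => by_contra fun hc => hmin b (not_lt.mp hc) hb⟩
  · push Not at h
    exact Or.inl h

/-- The corner coordinates `X', Y'` arise from `X, Y` by adding a border strip reaching from the
`i`-th outside corner to the `j`-th inside corner. -/
structure IsAddStrip {n : ℕ} (i j : Fin n) (X Y X' Y' : Fin n → ℕ) : Prop where
  antitone : Antitone X
  antitone' : Antitone X'
  monotone : Monotone Y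
  le : i ≤ j
  X_eq : ∀ a, X' a = X a + if i < a ∧ a ≤ j then 1 else 0
  Y_eq : ∀ a, Y' a = Y a + if i ≤ a ∧ a ≤ j then 1 else 0

namespace IsAddStrip

variable {n : ℕ} {X Y X' Y' : Fin n → ℕ} {i j : Fin n} (H : IsAddStrip i j X Y X' Y')

include H

theorem cornerPart_of_lt {p : ℕ} (hp : p < Y i) :
    cornerPart X' Y' (p + 1) = cornerPart X Y (p + 1) := by
  obtain h | ⟨m, hm, hlt⟩ := forall_lt_or_exists_least Y (p + 1)
  · exact absurd (h i) (by omega)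
  · have hmi : m ≤ i := by
      by_contra! hc
      have := hlt i hc
      omega
    rw [cornerPart_eq_of_isLeast H.antitone hm hlt, cornerPart_eq_of_isLeast H.antitone' (m := m), H.X_eq]
    · simp [hmi.not_gt]
    · rw [H.Y_eq]; omega
    · intro b hb
      rw [H.Y_eq, if_neg fun hc => absurd hc.1 (hb.trans_le hmi).not_ge]
      exact hlt b hb

theorem cornerPart_self : cornerPart X' Y' (Y i + 1) = X i := by
  rw [cornerPart_eq_of_isLeast H.antitone' (m := i), H.X_eq]
  · simp
  · simp [H.Y_eq, H.le]
  · intro b hb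
    have := H.monotone hb.le
    rw [H.Y_eq, if_neg fun hc => absurd hc.1 hb.not_ge]
    omega

theorem cornerPart_of_mem {p : ℕ} (hp : Y i < p) (hp' : p ≤ Y j) :
    cornerPart X' Y' (p + 1) = cornerPart X Y p + 1 := by
  obtain h | ⟨m, hm, hlt⟩ := forall_lt_or_exists_least Y p
  · exact absurd (h j) (by omega)
  · have hmi : i < m := by
      by_contra! hc
      have := H.monotone hc
      omega
    have hmj : m ≤ j := by
      by_contra! hc
      have := hlt j hc
      omega
    rw [cornerPart_eq_of_isLeast H.antitone hm hlt, cornerPart_eq_of_isLeast H.antitone' (m := m), H.X_eq]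
    · simp [hmi, hmj]
    · rw [H.Y_eq, if_pos ⟨hmi.le, hmj⟩]; omega
    · intro b hb
      have := hlt b hb
      rw [H.Y_eq]
      split_ifs <;> omega

theorem cornerPart_of_gt {p : ℕ} (hp : Y j < p) :
    cornerPart X' Y' (p + 1) = cornerPart X Y (p + 1) := by
  have hle : ∀ b, Y b < p + 1 → Y' b < p + 1 := by
    intro b hb
    rw [H.Y_eq]
    split_ifs with hc
    · have := H.monotone hc.2
      omega
    · exact hb
  obtain h | ⟨m, hm, hlt⟩ := forall_lt_or_exists_least Y (p + 1)
  · rw [cornerPart_eq_zero h, cornerPart_eq_zero fun b => hle b (h b)]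
  · have hmj : ¬ m ≤ j := by
      intro hc
      have := H.monotone hc
      omega
    rw [cornerPart_eq_of_isLeast H.antitone hm hlt, cornerPart_eq_of_isLeast H.antitone' (m := m), H.X_eq]
    · simp [hmj]
    · rw [H.Y_eq]; omega
    · exact fun b hb => hle b (hlt b hb)

end IsAddStrip

theorem card_filter_Ico_le {n r : ℕ} {K : Fin r → Fin n} (hK : Function.Injective K) (a b : Fin n) :
    (Finset.univ.filter fun s => a ≤ K s ∧ K s < b).card ≤ b - a := by
  rw [← Fin.card_Ico]
  exact Finset.card_le_card_of_injOn K (fun s hs => by simpa using hs) hK.injOn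

theorem card_filter_le_add {n r : ℕ} {K : Fin r → Fin n} (hK : Function.Injective K) (a b : Fin n)
    (p q : Fin r → Prop) [DecidablePred p] [DecidablePred q]
    (h : ∀ s, p s → q s ∨ (a ≤ K s ∧ K s < b)) :
    (Finset.univ.filter p).card ≤ (Finset.univ.filter q).card + (b - a) := by
  refine le_trans ?_ (Nat.add_le_add_left (card_filter_Ico_le hK a b) _)
  refine le_trans (Finset.card_le_card ?_) (Finset.card_union_le _ _)
  intro s hs
  simp at hs ⊢
  exact h s hs

theorem card_filter_le_of_le {n r : ℕ} {K : Fin r → Fin n} (hK : Function.Injective K) (a : Fin n)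
    (p : Fin r → Prop) [DecidablePred p] (h : ∀ s, p s → a ≤ K s) :
    (Finset.univ.filter p).card ≤ n - a := by
  rw [← Fin.card_Ici]
  exact Finset.card_le_card_of_injOn K (fun s hs => by simpa using h s (by simpa using hs)) hK.injOn

theorem card_filter_le_of_ge {n r : ℕ} {K : Fin r → Fin n} (hK : Function.Injective K) (a : Fin n)
    (p : Fin r → Prop) [DecidablePred p] (h : ∀ s, p s → K s ≤ a) :
    (Finset.univ.filter p).card ≤ a + 1 := by
  rw [← Fin.card_Iic]
  exact Finset.card_le_card_of_injOn K (fun s hs => by simpa using h s (by simpa using hs)) hK.injOn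

theorem StrictMono.add_sub_le_fin {n : ℕ} {y : Fin n → ℕ} (hy : StrictMono y) {a b : Fin n}
    (hab : a ≤ b) : y a + (b - a) ≤ y b := by
  have := Finset.card_le_card_of_injOn (s := Finset.Ico a b) (t := Finset.Ico (y a) (y b)) y
    (fun c hc => by
      simp at hc ⊢
      exact ⟨hy.monotone hc.1, hy hc.2⟩) hy.injective.injOn
  have := hy.monotone hab
  simp at *
  omega

theorem StrictAnti.add_sub_le_fin {n : ℕ} {x : Fin n → ℕ} (hx : StrictAnti x) {a b : Fin n}
    (hab : a ≤ b) : x b + (b - a) ≤ x a := by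
  have := Finset.card_le_card_of_injOn (s := Finset.Ioc a b) (t := Finset.Ico (x b) (x a)) x
    (fun c hc => by
      simp at hc ⊢
      exact ⟨hx.antitone hc.2, hx hc.1⟩) hx.injective.injOn
  have := hx.antitone hab
  simp at *
  omega

section Chain

variable {n r : ℕ} {x y : Fin n → ℕ} {I J : Fin r → Fin n}

theorem antitone_piX (hx : StrictAnti x) (hI : Function.Injective I) : Antitone (piX x I J) := by
  intro a b hab
  have := hx.add_sub_le_fin hab
  have := card_filter_le_add hI a b (fun s => I s < b ∧ b ≤ J s) (fun s => I s < a ∧ a ≤ J s)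
    (by intro s; omega)
  simp only [piX]
  omega

theorem monotone_piY (hy : StrictMono y) (hJ : Function.Injective J) : Monotone (piY y I J) := by
  intro a b hab
  have := hy.add_sub_le_fin hab
  have := card_filter_le_add hJ a b (fun s => I s ≤ a ∧ a ≤ J s) (fun s => I s ≤ b ∧ b ≤ J s)
    (by intro s; omega)
  simp only [piY]
  omega

theorem antitone_muX (hx : StrictAnti x) (hJ : Function.Injective J) : Antitone (muX x I J) := by
  intro a b hab
  have := hx.add_sub_le_fin hab
  have := card_filter_le_add hJ a b (fun s => I s < a ∧ a ≤ J s) (fun s => I s < b ∧ b ≤ J s)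
    (by intro s; omega)
  simp only [muX]
  omega

theorem card_le_x (hx : StrictAnti x) (hx1 : ∀ a, 1 ≤ x a) (hJ : Function.Injective J) (a : Fin n) :
    (Finset.univ.filter fun s => I s < a ∧ a ≤ J s).card ≤ x a := by
  have := card_filter_le_of_le hJ a (fun s => I s < a ∧ a ≤ J s) (fun s hs => hs.2)
  have := hx.add_sub_le_fin (a := a) (b := ⟨n - 1, by omega⟩) (by rw [Fin.le_def]; dsimp; omega)
  have := hx1 ⟨n - 1, by omega⟩
  simp only at *
  omega

theorem card_le_y (hy : StrictMono y) (hy1 : ∀ a, 1 ≤ y a) (hI : Function.Injective I) (a : Fin n) :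
    (Finset.univ.filter fun s => I s ≤ a ∧ a ≤ J s).card ≤ y a := by
  have := card_filter_le_of_ge hI a (fun s => I s ≤ a ∧ a ≤ J s) (fun s hs => hs.1)
  have := hy.add_sub_le_fin (a := ⟨0, by omega⟩) (b := a) (by rw [Fin.le_def]; dsimp; omega)
  have := hy1 ⟨0, by omega⟩
  simp only at *
  omega

theorem monotone_muY (hy : StrictMono y) (hy1 : ∀ a, 1 ≤ y a) (hI : Function.Injective I) :
    Monotone (muY y I J) := by
  intro a b hab
  have := hy.add_sub_le_fin hab
  have := card_le_y (J := J) hy hy1 hI a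
  have := card_le_y (J := J) hy hy1 hI b
  have := Finset.card_le_card_of_injOn (s := Finset.univ.filter fun s => a < I s ∧ I s ≤ b)
    (t := Finset.Ioc a b) I (fun s hs => by simpa using hs) hI.injOn
  have hu : (Finset.univ.filter fun s => I s ≤ b ∧ b ≤ J s).card ≤
      (Finset.univ.filter fun s => I s ≤ a ∧ a ≤ J s).card +
        (Finset.univ.filter fun s => a < I s ∧ I s ≤ b).card := by
    refine le_trans (Finset.card_le_card ?_) (Finset.card_union_le _ _)
    intro s hs
    simp at hs ⊢
    omega
  simp only [muY]
  simp at *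
  omega

theorem piY_le (hy : StrictMono y) (hJ : Function.Injective J) (a : Fin n) :
    piY y I J a ≤ Finset.univ.sup y + 1 := by
  have := card_filter_le_of_le hJ a (fun s => I s ≤ a ∧ a ≤ J s) (fun s hs => hs.2)
  have := hy.add_sub_le_fin (a := a) (b := ⟨n - 1, by omega⟩) (by rw [Fin.le_def]; dsimp; omega)
  have := Finset.le_sup (f := y) (Finset.mem_univ (⟨n - 1, by omega⟩ : Fin n))
  simp only [piY] at *
  omega

end Chain

section CoveringChain

variable {n r : ℕ} {x y : Fin n → ℕ} {I J : Fin (r + 1) → Fin n}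

theorem isAddStrip_pi (hx : StrictAnti x) (hy : StrictMono y) (hI : StrictMono I)
    (hJ : StrictAnti J) (hIJ : I 0 ≤ J 0) :
    IsAddStrip (I 0) (J 0) (piX x (I ∘ Fin.succ) (J ∘ Fin.succ)) (piY y (I ∘ Fin.succ) (J ∘ Fin.succ))
      (piX x I J) (piY y I J) where
  antitone := antitone_piX hx (hI.injective.comp (Fin.succ_injective r))
  antitone' := antitone_piX hx hI.injective
  monotone := monotone_piY hy (hJ.injective.comp (Fin.succ_injective r))
  le := hIJ
  X_eq a := by
    simp only [piX, Fin.card_filter_univ_succ, Function.comp_apply]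
    split_ifs <;> omega
  Y_eq a := by
    simp only [piY, Fin.card_filter_univ_succ, Function.comp_apply]
    split_ifs <;> omega

theorem isAddStrip_mu (hx : StrictAnti x) (hx1 : ∀ a, 1 ≤ x a) (hy : StrictMono y)
    (hy1 : ∀ a, 1 ≤ y a) (hI : StrictMono I) (hJ : StrictAnti J) (hIJ : I 0 ≤ J 0) :
    IsAddStrip (I 0) (J 0) (muX x I J) (muY y I J)
      (muX x (I ∘ Fin.succ) (J ∘ Fin.succ)) (muY y (I ∘ Fin.succ) (J ∘ Fin.succ)) where
  antitone := antitone_muX hx hJ.injective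
  antitone' := antitone_muX hx (hJ.injective.comp (Fin.succ_injective r))
  monotone := monotone_muY hy hy1 hI.injective
  le := hIJ
  X_eq a := by
    have := card_le_x (I := I) hx hx1 hJ.injective a
    simp only [muX, Fin.card_filter_univ_succ, Function.comp_apply] at this ⊢
    split_ifs at this ⊢ <;> omega
  Y_eq a := by
    have := card_le_y (J := J) hy hy1 hI.injective a
    simp only [muY, Fin.card_filter_univ_succ, Function.comp_apply] at this ⊢
    split_ifs at this ⊢ <;> omega

theorem outer_card_eq_zero (hI : StrictMono I) (hJ : StrictAnti J) {a : Fin n}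
    (ha : a ≤ I 0 ∨ J 0 ≤ a) :
    (Finset.univ.filter fun s => (I ∘ Fin.succ) s ≤ a ∧ a ≤ (J ∘ Fin.succ) s).card = 0 := by
  rw [Finset.card_eq_zero, Finset.filter_eq_empty_iff]
  intro s _
  have := hI (Fin.succ_pos s)
  have := hJ (Fin.succ_pos s)
  simp only [Function.comp_apply]
  omega

theorem piY_tail_eq (hI : StrictMono I) (hJ : StrictAnti J) {a : Fin n}
    (ha : a ≤ I 0 ∨ J 0 ≤ a) : piY y (I ∘ Fin.succ) (J ∘ Fin.succ) a = y a := by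
  rw [piY, outer_card_eq_zero hI hJ ha, Nat.add_zero]

theorem muY_tail_eq (hI : StrictMono I) (hJ : StrictAnti J) {a : Fin n}
    (ha : a ≤ I 0 ∨ J 0 ≤ a) : muY y (I ∘ Fin.succ) (J ∘ Fin.succ) a = y a := by
  rw [muY, outer_card_eq_zero hI hJ ha, Nat.sub_zero]

theorem piX_tail_eq (hI : StrictMono I) : piX x (I ∘ Fin.succ) (J ∘ Fin.succ) (I 0) = x (I 0) := by
  rw [piX, Finset.filter_false_of_mem]
  · simp
  · intro s _ hs
    exact absurd (hI (Fin.succ_pos s)) hs.1.not_gt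

theorem mu_eq_of_gt (hJ : StrictAnti J) {a : Fin n} (ha : J 0 < a) :
    muX x I J a = x a ∧ muY y I J a = y a := by
  have : ∀ s, ¬ a ≤ J s := fun s hs => absurd (hJ.antitone (Fin.zero_le s)) (ha.trans_le hs).not_ge
  simp [muX, muY, this]

theorem cornerPart_self (hx : StrictAnti x) (hy : StrictMono y) (a : Fin n) :
    cornerPart x y (y a) = x a :=
  cornerPart_eq_of_isLeast hx.antitone le_rfl fun _ hb => hy hb

theorem cornerPart_mu_outer (hx : StrictAnti x) (hx1 : ∀ a, 1 ≤ x a) (hy : StrictMono y)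
    (hy1 : ∀ a, 1 ≤ y a) (hI : StrictMono I) (hJ : StrictAnti J) (hIJ : I 0 ≤ J 0) :
    cornerPart (muX x I J) (muY y I J) (y (J 0)) = cornerPart x y (y (J 0) + 1) := by
  have H := isAddStrip_mu hx hx1 hy hy1 hI hJ hIJ
  have hj : ∀ b ≤ J 0, muY y I J b < y (J 0) := by
    intro b hb
    have h1 := H.monotone hb
    have h2 := H.Y_eq (J 0)
    rw [muY_tail_eq hI hJ (Or.inr le_rfl), if_pos ⟨hIJ, le_rfl⟩] at h2
    omega
  obtain h | ⟨m, hm, hlt⟩ := forall_lt_or_exists_least y (y (J 0) + 1)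
  · rw [cornerPart_eq_zero h, cornerPart_eq_zero]
    exact fun b => hj b (hy.le_iff_le.mp (by have := h b; omega))
  · have hJm : J 0 < m := hy.lt_iff_lt.mp hm
    obtain ⟨h1, h2⟩ := mu_eq_of_gt (x := x) (y := y) (I := I) hJ hJm
    rw [cornerPart_eq_of_isLeast hx.antitone hm hlt,
      cornerPart_eq_of_isLeast H.antitone (m := m) (by omega), h1]
    exact fun b hb => hj b (hy.le_iff_le.mp (by have := hlt b hb; omega))

end CoveringChain

/-- The odd cycle `inl u, inl (u + 1), …, inl v, inr v, inr (v - 1), …, inr u`, reversed. -/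
theorem exists_perm_sum_interval {m : ℕ} {u v : Fin m} (huv : u ≤ v) :
    ∃ κ : Equiv.Perm (Fin m ⊕ Fin m), Equiv.Perm.sign κ = -1 ∧
      (∀ p, p < u ∨ v < p → κ (Sum.inl p) = Sum.inl p ∧ κ (Sum.inr p) = Sum.inr p) ∧
      κ (Sum.inl u) = Sum.inr u ∧ κ (Sum.inr v) = Sum.inl v ∧
      ∀ p p' : Fin m, (p' : ℕ) + 1 = p → u < p → p ≤ v →
        κ (Sum.inl p) = Sum.inl p' ∧ κ (Sum.inr p') = Sum.inr p := by
  have : NeZero m := ⟨by have := u.2; omega⟩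
  set γ := Fin.cycleIcc u v with hγ
  have hout : ∀ p, p < u ∨ v < p → γ p = p := by
    rintro p (h | h)
    · exact Fin.cycleIcc_of_lt h
    · exact Fin.cycleIcc_of_gt h
  have hlast : γ v = u := Fin.cycleIcc_of_last huv
  have hmid : ∀ p p' : Fin m, (p' : ℕ) + 1 = p → u < p → p ≤ v → γ p' = p := by
    intro p p' h1 h2 h3
    rw [hγ, Fin.cycleIcc_of_ge_of_lt (by omega) (by omega)]
    ext
    rw [Fin.val_add_one_of_lt' (by omega)]
    exact h1
  refine ⟨Equiv.swap (Sum.inl v) (Sum.inr u) * Equiv.Perm.sumCongr γ.symm γ, ?_, ?_, ?_, ?_, ?_⟩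
  · rw [Equiv.Perm.sign_mul, Equiv.Perm.sign_swap (by simp), Equiv.Perm.sign_sumCongr]
    simp
  · intro p hp
    have h1 := hout p hp
    have h2 : γ.symm p = p := by rw [Equiv.symm_apply_eq, h1]
    have h3 : p ≠ u := by rintro rfl; omega
    have h4 : p ≠ v := by rintro rfl; omega
    constructor
    · simp [h2, Equiv.swap_apply_of_ne_of_ne, h4]
    · simp [h1, Equiv.swap_apply_of_ne_of_ne, h3]
  · have h2 : γ.symm u = v := by rw [Equiv.symm_apply_eq, hlast]
    simp [h2]
  · simp [hlast]
  · intro p p' h1 h2 h3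
    have h4 := hmid p p' h1 h2 h3
    have h5 : γ.symm p = p' := by rw [Equiv.symm_apply_eq, h4]
    have h6 : p' ≠ v := by rintro rfl; omega
    constructor
    · simp [h5, Equiv.swap_apply_of_ne_of_ne, h6]
    · simp [h4, Equiv.swap_apply_of_ne_of_ne, h2.ne']
section Rows

variable {R : Type*} [CommRing R] (h : ℤ → R) (N : ℕ)

/-- The row `(h z, h (z + 1), …, h (z + N))`. -/
def hRow (z : ℤ) : Fin (N + 1) → R := fun j => h (z + j)

/-- The rows of the Jacobi–Trudi matrix of size `N + 1`. -/
def topRow (p : ℕ → ℕ) (q : Fin (N + 1)) : Fin (N + 1) → R :=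
  hRow h N ((p (q + 1) : ℤ) - q)

/-- The rows of the Jacobi–Trudi matrix of size `N`, bordered by the first basis vector. -/
def botRow (p : ℕ → ℕ) (q : Fin (N + 1)) : Fin (N + 1) → R :=
  if q = 0 then Pi.single 0 1 else hRow h N ((p q : ℤ) - q)

/-- The rows of the block diagonal matrix with the blocks `topRow p` and `botRow p'`. -/
def blockRow (p p' : ℕ → ℕ) : Fin (N + 1) ⊕ Fin (N + 1) → Fin (N + 1) ⊕ Fin (N + 1) → R :=
  Sum.elim (fun q => Sum.elim (topRow h N p q) 0) (fun q => Sum.elim 0 (botRow h N p' q))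

/-- The rows of `blockRow p p`, each moved to the other block of coordinates. -/
def flipRow (p : ℕ → ℕ) : Fin (N + 1) ⊕ Fin (N + 1) → Fin (N + 1) ⊕ Fin (N + 1) → R :=
  Sum.elim (fun q => Sum.elim 0 (topRow h N p q)) (fun q => Sum.elim (botRow h N p q) 0)

variable {h N}

omit [CommRing R] in
theorem topRow_congr {p p' : ℕ → ℕ} {q q' : Fin (N + 1)}
    (hpq : (p (q + 1) : ℤ) - q = p' (q' + 1) - q') : topRow h N p q = topRow h N p' q' := by
  rw [topRow, hpq, topRow]

theorem botRow_congr {p p' : ℕ → ℕ} {q q' : Fin (N + 1)} (hq : (q : ℕ) ≠ 0) (hq' : (q' : ℕ) ≠ 0)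
    (hpq : (p q : ℤ) - q = p' q' - q') : botRow h N p q = botRow h N p' q' := by
  rw [botRow, botRow, if_neg fun hc => hq (by simp [hc]), if_neg fun hc => hq' (by simp [hc]), hpq]

theorem topRow_eq_botRow {p p' : ℕ → ℕ} {q q' : Fin (N + 1)} (hq' : (q' : ℕ) ≠ 0)
    (hpq : (p (q + 1) : ℤ) - q = p' q' - q') : topRow h N p q = botRow h N p' q' := by
  rw [botRow, topRow, if_neg fun hc => hq' (by simp [hc]), hpq]

variable {n : ℕ} {x y : Fin n → ℕ}

/-- The positions of the rows moved to the other block by the chain `I, J`. -/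
def chainSet (Y : Fin n → Fin (N + 1)) {r : ℕ} (I J : Fin r → Fin n) :
    Finset (Fin (N + 1) ⊕ Fin (N + 1)) :=
  Finset.univ.image (fun s => Sum.inr (Y (I s))) ∪ Finset.univ.image (fun s => Sum.inl (Y (J s)))

theorem inl_mem_chainSet {Y : Fin n → Fin (N + 1)} {r : ℕ} {I J : Fin r → Fin n} {q : Fin (N + 1)} :
    Sum.inl q ∈ chainSet Y I J ↔ ∃ s, Y (J s) = q := by
  simp [chainSet]

theorem inr_mem_chainSet {Y : Fin n → Fin (N + 1)} {r : ℕ} {I J : Fin r → Fin n} {q : Fin (N + 1)} :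
    Sum.inr q ∈ chainSet Y I J ↔ ∃ s, Y (I s) = q := by
  simp [chainSet]

theorem chainSet_succ {Y : Fin n → Fin (N + 1)} {r : ℕ} {I J : Fin (r + 1) → Fin n} :
    chainSet Y I J = insert (Sum.inr (Y (I 0))) (insert (Sum.inl (Y (J 0)))
      (chainSet Y (I ∘ Fin.succ) (J ∘ Fin.succ))) := by
  ext q
  rcases q with q | q
  · simp [inl_mem_chainSet, Fin.exists_fin_succ, eq_comm]
  · simp [inr_mem_chainSet, Fin.exists_fin_succ, eq_comm]

theorem exists_perm_piecewise_chainSet (hx : StrictAnti x) (hx1 : ∀ a, 1 ≤ x a)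
    (hy : StrictMono y) (hy1 : ∀ a, 1 ≤ y a) (Y : Fin n → Fin (N + 1)) (hY : ∀ a, (Y a : ℕ) = y a)
    (k : Fin n) : ∀ (r : ℕ) (I J : Fin r → Fin n), StrictMono I → StrictAnti J →
    (∀ s, I s ≤ k ∧ k ≤ J s) →
    ∃ Φ : Equiv.Perm (Fin (N + 1) ⊕ Fin (N + 1)), Equiv.Perm.sign Φ = (-1) ^ r ∧
      (∀ p, (∀ s, p < Y (I s) ∨ Y (J s) < p) →
        Φ (Sum.inl p) = Sum.inl p ∧ Φ (Sum.inr p) = Sum.inr p) ∧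
      ∀ q, (chainSet Y I J).piecewise (flipRow h N (cornerPart x y))
          (blockRow h N (cornerPart x y) (cornerPart x y)) (Φ q) =
        blockRow h N (cornerPart (piX x I J) (piY y I J)) (cornerPart (muX x I J) (muY y I J)) q := by
  intro r
  induction r with
  | zero =>
    intro I J _ _ _
    have h1 : piX x I J = x := by funext a; simp [piX]
    have h2 : piY y I J = y := by funext a; simp [piY]
    have h3 : muX x I J = x := by funext a; simp [muX]
    have h4 : muY y I J = y := by funext a; simp [muY]
    exact ⟨1, by simp, by simp, by simp [h1, h2, h3, h4, chainSet]⟩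
  | succ r ih =>
    intro I J hI hJ hk
    obtain ⟨Φ, hsign, hfix, hrow⟩ := ih (I ∘ Fin.succ) (J ∘ Fin.succ)
      (hI.comp (Fin.strictMono_succ)) (hJ.comp_strictMono Fin.strictMono_succ) fun s => hk s.succ
    have hIJ : I 0 ≤ J 0 := (hk 0).1.trans (hk 0).2
    have hYm : StrictMono Y := fun a b hab => by
      rw [Fin.lt_def, hY, hY]; exact hy hab
    have Hpi := isAddStrip_pi hx hy hI hJ hIJ
    have Hmu := isAddStrip_mu hx hx1 hy hy1 hI hJ hIJ
    have hpu := piY_tail_eq (y := y) hI hJ (Or.inl le_rfl)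
    have hpv := piY_tail_eq (y := y) hI hJ (Or.inr le_rfl)
    have hmu := Hmu.Y_eq (I 0)
    rw [muY_tail_eq hI hJ (Or.inl le_rfl), if_pos ⟨le_rfl, hIJ⟩] at hmu
    have hmv := Hmu.Y_eq (J 0)
    rw [muY_tail_eq hI hJ (Or.inr le_rfl), if_pos ⟨hIJ, le_rfl⟩] at hmv
    have hself := Hpi.cornerPart_self
    rw [hpu, piX_tail_eq hI, ← cornerPart_self hx hy] at hself
    have houter := cornerPart_mu_outer hx hx1 hy hy1 hI hJ hIJ
    have hyu := hY (I 0)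
    have hyv := hY (J 0)
    have hyu1 := hy1 (I 0)
    have hyv1 := hy1 (J 0)
    have huv : Y (I 0) ≤ Y (J 0) := hYm.monotone hIJ
    obtain ⟨κ, hκs, hκo, hκu, hκv, hκm⟩ := exists_perm_sum_interval huv
    have hin : ∀ s : Fin r, Y (I 0) < Y ((I ∘ Fin.succ) s) ∧ Y ((J ∘ Fin.succ) s) < Y (J 0) :=
      fun s => ⟨hYm (hI (Fin.succ_pos s)), hYm (hJ (Fin.succ_pos s))⟩
    have hΦu : Φ (Sum.inr (Y (I 0))) = Sum.inr (Y (I 0)) :=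
      (hfix _ fun s => Or.inl (hin s).1).2
    have hΦv : Φ (Sum.inl (Y (J 0))) = Sum.inl (Y (J 0)) :=
      (hfix _ fun s => Or.inr (hin s).2).1
    have hrest : ∀ q, q ≠ Sum.inr (Y (I 0)) → q ≠ Sum.inl (Y (J 0)) →
        (chainSet Y I J).piecewise (flipRow h N (cornerPart x y))
          (blockRow h N (cornerPart x y) (cornerPart x y)) (Φ q) =
        blockRow h N _ _ q := fun q h1 h2 => by
      rw [← hrow q, chainSet_succ, Finset.piecewise_insert_of_ne, Finset.piecewise_insert_of_ne]
      · rwa [← hΦv, Φ.injective.ne_iff]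
      · rwa [← hΦu, Φ.injective.ne_iff]
    refine ⟨Φ * κ, ?_, ?_, ?_⟩
    · rw [Equiv.Perm.sign_mul, hsign, hκs, pow_succ]
    · intro p hp
      obtain ⟨h1, h2⟩ := hκo p (hp 0)
      rw [Equiv.Perm.mul_apply, Equiv.Perm.mul_apply, h1, h2]
      exact hfix p fun s => hp s.succ
    · rintro (p | p)
      · rw [Equiv.Perm.mul_apply]
        rcases lt_trichotomy p (Y (I 0)) with hp | rfl | hp
        · rw [(hκo p (Or.inl hp)).1, hrest _ (by simp) (by simp; omega)]
          simp only [blockRow, Sum.elim_inl]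
          refine congrArg₂ Sum.elim (topRow_congr ?_) rfl
          rw [Hpi.cornerPart_of_lt (by omega)]
        · rw [hκu, hΦu, Finset.piecewise_eq_of_mem _ _ _ (by simp [chainSet_succ])]
          simp only [blockRow, flipRow, Sum.elim_inl, Sum.elim_inr]
          refine congrArg₂ Sum.elim (topRow_eq_botRow (by omega) ?_).symm rfl
          rw [hyu, hself]
        · rcases le_or_gt p (Y (J 0)) with hp' | hp'
          · obtain ⟨h1, -⟩ := hκm p ⟨p - 1, by omega⟩ (by dsimp; omega) hp hp'
            rw [h1, hrest _ (by simp) (by simp [Fin.ext_iff]; omega)]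
            simp only [blockRow, Sum.elim_inl]
            refine congrArg₂ Sum.elim (topRow_congr ?_) rfl
            rw [Hpi.cornerPart_of_mem (p := p) (by omega) (by omega)]
            dsimp only
            rw [Nat.sub_add_cancel (by omega)]
            omega
          · rw [(hκo p (Or.inr hp')).1, hrest _ (by simp) (by simp; omega)]
            simp only [blockRow, Sum.elim_inl]
            refine congrArg₂ Sum.elim (topRow_congr ?_) rfl
            rw [Hpi.cornerPart_of_gt (by omega)]
      · rw [Equiv.Perm.mul_apply]
        rcases lt_trichotomy p (Y (J 0)) with hp | rfl | hp
        · rcases lt_or_ge p (Y (I 0)) with hp' | hp'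
          · rw [(hκo p (Or.inl hp')).2, hrest _ (by simp; omega) (by simp)]
            simp only [blockRow, Sum.elim_inr]
            rcases Nat.eq_zero_or_pos p with h0 | h0
            · have : p = 0 := Fin.ext h0
              simp [botRow, this]
            · have := Hmu.cornerPart_of_lt (p := p - 1) (by omega)
              rw [Nat.sub_add_cancel h0] at this
              refine congrArg₂ Sum.elim rfl (botRow_congr (by omega) (by omega) ?_)
              rw [this]
          · obtain ⟨-, h1⟩ := hκm ⟨p + 1, by omega⟩ p rfl
              (by rw [Fin.lt_def]; dsimp; omega) (by rw [Fin.le_def]; dsimp; omega)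
            rw [h1, hrest _ (by simp [Fin.ext_iff]; omega) (by simp)]
            simp only [blockRow, Sum.elim_inr]
            refine congrArg₂ Sum.elim rfl (botRow_congr (by simp) (by omega) ?_)
            dsimp only
            rw [Hmu.cornerPart_of_mem (p := p) (by omega) (by omega)]
            omega
        · rw [hκv, hΦv, Finset.piecewise_eq_of_mem _ _ _ (by simp [chainSet_succ])]
          simp only [blockRow, flipRow, Sum.elim_inl, Sum.elim_inr]
          refine congrArg₂ Sum.elim rfl (topRow_eq_botRow (by omega) ?_)
          rw [hyv, houter]
        · rw [(hκo p (Or.inr hp)).2, hrest _ (by simp; omega) (by simp)]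
          simp only [blockRow, Sum.elim_inr]
          have := Hmu.cornerPart_of_gt (p := p - 1) (by omega)
          rw [Nat.sub_add_cancel (by omega)] at this
          refine congrArg₂ Sum.elim rfl (botRow_congr (by omega) (by omega) ?_)
          rw [this]

theorem det_topRow (h0 : h 0 = 1) (hneg : ∀ z : ℤ, z < 0 → h z = 0) {p : ℕ → ℕ}
    (hp : p (N + 1) = 0) : Matrix.det (Matrix.of (topRow h N p)) = schurPad h N p := by
  rw [Matrix.det_succ_row _ (Fin.last N), Finset.sum_eq_single (Fin.last N)]
  · simp only [Matrix.of_apply, topRow, hRow, Fin.val_last, hp]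
    simp only [Nat.cast_zero, zero_sub, neg_add_cancel, h0, mul_one, ← two_mul, pow_mul,
      even_two, Even.neg_pow, one_pow, one_mul, Fin.succAbove_last]
    rfl
  · intro j _ hj
    have : (j : ℕ) < N := Fin.val_lt_last hj
    simp only [Matrix.of_apply, topRow, hRow, Fin.val_last, hp]
    rw [hneg _ (by push_cast; omega)]
    simp
  · simp

theorem det_botRow (p : ℕ → ℕ) : Matrix.det (Matrix.of (botRow h N p)) = schurPad h N p := by
  rw [Matrix.det_succ_row_zero, Finset.sum_eq_single 0]
  · have hrow : Matrix.submatrix (Matrix.of (botRow h N p)) Fin.succ (Fin.succAbove 0) =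
        Matrix.of fun i j : Fin N => h ((p ((i : ℕ) + 1) : ℤ) - (i : ℕ) + (j : ℕ)) := by
      ext i j
      simp only [Matrix.submatrix_apply, Matrix.of_apply, botRow, Fin.succ_ne_zero, if_false, hRow,
        Fin.val_succ, Fin.zero_succAbove]
      congr 1
      push_cast
      ring
    rw [hrow, Matrix.of_apply, botRow, if_pos rfl, Pi.single_eq_same, Fin.val_zero, pow_zero,
      one_mul, one_mul, schurPad]
  · intro j _ hj
    simp [botRow, hj]
  · simp

theorem det_blockRow (h0 : h 0 = 1) (hneg : ∀ z : ℤ, z < 0 → h z = 0) {p : ℕ → ℕ}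
    (hp : p (N + 1) = 0) (p' : ℕ → ℕ) :
    Matrix.det (Matrix.of (blockRow h N p p')) = schurPad h N p * schurPad h N p' := by
  rw [← det_topRow h0 hneg hp, ← det_botRow p', ← Matrix.det_fromBlocks_zero₂₁ _ 0]
  congr 1

theorem exists_perm_shift_swap : ∀ ℓ ≤ N, ∃ ρ : Equiv.Perm (Fin (N + 1) ⊕ Fin (N + 1)),
    Equiv.Perm.sign ρ = (-1) ^ ℓ ∧
    (∀ p p' : Fin (N + 1), (p' : ℕ) = p + 1 → (p : ℕ) < ℓ →
      ρ (Sum.inl p) = Sum.inr p' ∧ ρ (Sum.inr p') = Sum.inl p) ∧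
    (∀ p : Fin (N + 1), ℓ ≤ p → ρ (Sum.inl p) = Sum.inl p) ∧
    ∀ p : Fin (N + 1), (p : ℕ) = 0 ∨ ℓ < p → ρ (Sum.inr p) = Sum.inr p := by
  intro ℓ
  induction ℓ with
  | zero => exact fun _ => ⟨1, by simp⟩
  | succ ℓ ih =>
    intro hℓ
    obtain ⟨ρ, hs, h1, h2, h3⟩ := ih (by omega)
    refine ⟨ρ * Equiv.swap (Sum.inl ⟨ℓ, by omega⟩) (Sum.inr ⟨ℓ + 1, by omega⟩), ?_, ?_, ?_, ?_⟩
    · rw [Equiv.Perm.sign_mul, hs, Equiv.Perm.sign_swap (by simp), pow_succ]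
    · intro p p' hp hpl
      rcases Nat.lt_succ_iff_lt_or_eq.mp hpl with hlt | heq
      · rw [Equiv.Perm.mul_apply, Equiv.Perm.mul_apply,
          Equiv.swap_apply_of_ne_of_ne (by simp [Fin.ext_iff]; omega) (by simp),
          Equiv.swap_apply_of_ne_of_ne (by simp) (by simp [Fin.ext_iff]; omega)]
        exact h1 p p' hp hlt
      · have e : p = ⟨ℓ, by omega⟩ := Fin.ext heq
        have e' : p' = ⟨ℓ + 1, by omega⟩ := Fin.ext (by dsimp; omega)
        rw [e, e', Equiv.Perm.mul_apply, Equiv.Perm.mul_apply, Equiv.swap_apply_left,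
          Equiv.swap_apply_right]
        exact ⟨h3 _ (Or.inr (Nat.lt_succ_self ℓ)), h2 _ le_rfl⟩
    · intro p hp
      rw [Equiv.Perm.mul_apply, Equiv.swap_apply_of_ne_of_ne (by simp [Fin.ext_iff]; omega) (by simp)]
      exact h2 p (by omega)
    · intro p hp
      rw [Equiv.Perm.mul_apply, Equiv.swap_apply_of_ne_of_ne (by simp) (by simp [Fin.ext_iff]; omega)]
      exact h3 p (by omega)

/-- The rows of `flipRow p` at the positions `ℓ ≤ q` of the first and `1 ≤ q ≤ ℓ` of the second
block, and zero elsewhere. -/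
def partialFlipRow (h : ℤ → R) (N ℓ : ℕ) (p : ℕ → ℕ) :
    Fin (N + 1) ⊕ Fin (N + 1) → Fin (N + 1) ⊕ Fin (N + 1) → R :=
  Sum.elim (fun q => if ℓ ≤ q then flipRow h N p (Sum.inl q) else 0)
    (fun q => if 1 ≤ (q : ℕ) ∧ (q : ℕ) ≤ ℓ then flipRow h N p (Sum.inr q) else 0)

theorem det_blockRow_add_partialFlipRow (h0 : h 0 = 1) (hneg : ∀ z : ℤ, z < 0 → h z = 0)
    {p : ℕ → ℕ} (hp : p (N + 1) = 0) {ℓ : ℕ} (hℓ : ℓ ≤ N) (hpos : ∀ q, q ≤ ℓ → 1 ≤ p q) :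
    Matrix.det (Matrix.of (partialFlipRow h N ℓ p + blockRow h N p p)) =
      schurPad h N (plusCol p ℓ) * schurPad h N (minusCol p ℓ) := by
  obtain ⟨ρ, hs, h1, h2, h3⟩ := exists_perm_shift_swap ℓ hℓ
  set A := Matrix.of (partialFlipRow h N ℓ p + blockRow h N p p) with hA
  let E : Matrix (Fin (N + 1) ⊕ Fin (N + 1)) (Fin (N + 1) ⊕ Fin (N + 1)) R :=
    Matrix.fromBlocks 1 (-1) 0 1
  let v : Fin (N + 1) → R := fun q => if 1 ≤ (q : ℕ) ∧ (q : ℕ) ≤ ℓ then -1 else 1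
  let C : Matrix (Fin (N + 1)) (Fin (N + 1)) R := Matrix.of fun i j =>
    (A * E) (ρ (Sum.inr i)) (Sum.inl j)
  have hAE : ∀ i, (A * E) i = Sum.elim (fun j => A i (Sum.inl j))
      (fun j => A i (Sum.inr j) - A i (Sum.inl j)) := by
    intro i
    ext (j | j)
    · simp [E, Matrix.mul_apply, Matrix.one_apply]
    · simp [E, Matrix.mul_apply, Matrix.one_apply]
      ring
  have hv : ∏ q, v q = (-1) ^ ℓ := by
    simp only [v]
    rw [Fin.prod_univ_eq_prod_range (fun q => if 1 ≤ q ∧ q ≤ ℓ then (-1 : R) else 1) (N + 1),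
      Finset.prod_ite, Finset.prod_const, Finset.prod_const_one, mul_one]
    congr 1
    rw [show (Finset.range (N + 1)).filter (fun q => 1 ≤ q ∧ q ≤ ℓ) = Finset.Icc 1 ℓ by
      ext q; simp; omega]
    simp
  have hblock : (A * E).submatrix ρ id = Matrix.fromBlocks (Matrix.of (topRow h N (minusCol p ℓ))) 0
      C (Matrix.of fun i j => v i * Matrix.of (botRow h N (plusCol p ℓ)) i j) := by
    have htop : ∀ q : Fin (N + 1), (A * E) (Sum.inl q) = Sum.elim (topRow h N p q)
        (if ℓ ≤ q then 0 else -topRow h N p q) := by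
      intro q
      rw [hAE]
      ext (j | j) <;> by_cases hq : ℓ ≤ (q : ℕ) <;>
        simp [hA, partialFlipRow, blockRow, flipRow, hq]
    have hbot : ∀ q : Fin (N + 1), (A * E) (Sum.inr q) =
        if 1 ≤ (q : ℕ) ∧ (q : ℕ) ≤ ℓ then Sum.elim (botRow h N p q) 0
        else Sum.elim 0 (botRow h N p q) := by
      intro q
      rw [hAE]
      ext (j | j) <;> simp only [hA, partialFlipRow, blockRow, flipRow, Matrix.of_apply,
        Pi.add_apply, Sum.elim_inl, Sum.elim_inr] <;> split_ifs <;> simp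
    ext (i | i) j
    · have hi : (A * E) (ρ (Sum.inl i)) = Sum.elim (topRow h N (minusCol p ℓ) i) 0 := by
        rcases lt_or_ge (i : ℕ) ℓ with hi | hi
        · have := hpos (i + 1) hi
          rw [(h1 i ⟨i + 1, by omega⟩ rfl hi).1, hbot, if_pos ⟨by simp, by dsimp; omega⟩]
          refine congrArg₂ Sum.elim (topRow_eq_botRow (by simp) ?_).symm rfl
          simp only [minusCol, if_pos (Nat.succ_le_of_lt hi)]
          push_cast [this]
          ring
        · rw [h2 i hi, htop, if_pos hi]
          refine congrArg₂ Sum.elim (topRow_congr ?_) rfl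
          simp [minusCol, Nat.not_le.mpr (Nat.lt_succ_of_le hi)]
      rw [Matrix.submatrix_apply, hi]
      rcases j with j | j <;> rfl
    · rcases j with j | j
      · rfl
      · rw [Matrix.submatrix_apply, id, Matrix.fromBlocks_apply₂₂, Matrix.of_apply, Matrix.of_apply]
        by_cases hi : 1 ≤ (i : ℕ) ∧ (i : ℕ) ≤ ℓ
        · rw [(h1 ⟨i - 1, by omega⟩ i (by dsimp; omega) (by dsimp; omega)).2, htop,
            if_neg (by dsimp; omega)]
          have : topRow h N p ⟨i - 1, by omega⟩ = botRow h N (plusCol p ℓ) i := by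
            refine topRow_eq_botRow (by omega) ?_
            dsimp only
            rw [Nat.sub_add_cancel hi.1, plusCol, if_pos hi.2]
            push_cast [hi.1]
            ring
          simp [v, this, hi]
        · rw [h3 i (by omega), hbot, if_neg hi]
          have : botRow h N p i = botRow h N (plusCol p ℓ) i := by
            rcases Nat.eq_zero_or_pos i with h0 | h0
            · simp [botRow, Fin.ext_iff, h0]
            · exact botRow_congr (by omega) (by omega) (by rw [plusCol, if_neg (by omega), add_zero])
          simp only [v, if_neg hi, this, one_mul, Sum.elim_inr]
  have hdet : A.det = (A * E).det := by
    rw [Matrix.det_mul, Matrix.det_fromBlocks_zero₂₁]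
    simp
  have hperm := Matrix.det_permute ρ (A * E)
  rw [hblock, Matrix.det_fromBlocks_zero₁₂, Matrix.det_mul_column, hv, det_botRow,
    det_topRow h0 hneg (by simp [minusCol, hp]), hs, ← hdet] at hperm
  have hsq : ((-1 : R) ^ ℓ) * (-1) ^ ℓ = 1 := by rw [← mul_pow]; simp
  push_cast at hperm
  linear_combination (-(-1 : R) ^ ℓ) * hperm +
    (schurPad h N (plusCol p ℓ) * schurPad h N (minusCol p ℓ) - A.det) * hsq

theorem det_eq_zero_of_card_ne {m : Type*} [Fintype m] [DecidableEq m]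
    (M : Matrix (m ⊕ m) (m ⊕ m) R) (S : Finset (m ⊕ m))
    (hS : ∀ i ∈ S, ∀ j, M i (Sum.inr j) = 0) (hS' : ∀ i ∉ S, ∀ j, M i (Sum.inl j) = 0)
    (hcard : S.card ≠ Fintype.card m) : M.det = 0 := by
  rw [Matrix.det_apply']
  refine Finset.sum_eq_zero fun σ _ => ?_
  by_cases hz : ∃ i, M (σ i) i = 0
  · obtain ⟨i, hi⟩ := hz
    exact mul_eq_zero_of_right _ (Finset.prod_eq_zero (Finset.mem_univ i) hi)
  · push Not at hz
    refine absurd ?_ hcard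
    have : S = Finset.univ.map (Function.Embedding.inl.trans σ.toEmbedding) := by
      ext i
      obtain ⟨i, rfl⟩ := σ.surjective i
      rcases i with i | i
      · simp only [Finset.mem_map, Finset.mem_univ, true_and, Function.Embedding.trans_apply,
          Function.Embedding.inl_apply, Equiv.coe_toEmbedding, EmbeddingLike.apply_eq_iff_eq,
          exists_apply_eq_apply, iff_true]
        by_contra hi
        exact hz _ (hS' _ hi i)
      · simp only [Finset.mem_map, Finset.mem_univ, true_and, Function.Embedding.trans_apply,
          Function.Embedding.inl_apply, Equiv.coe_toEmbedding, EmbeddingLike.apply_eq_iff_eq,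
          reduceCtorEq, exists_false, iff_false]
        exact fun hi => hz _ (hS _ hi i)
    rw [this, Finset.card_map, Finset.card_univ]

theorem cornerPart_succ_of_forall_ne {q : ℕ} (hq : ∀ a, y a ≠ q) :
    cornerPart x y (q + 1) = cornerPart x y q := by
  unfold cornerPart
  congr 1
  ext a
  have := hq a
  simp only [Finset.mem_filter, Finset.mem_univ, true_and]
  omega

theorem corner_of_det_piecewise_ne_zero (hy : StrictMono y) (hy1 : ∀ a, 1 ≤ y a)
    {Y : Fin n → Fin (N + 1)} (hY : ∀ a, (Y a : ℕ) = y a) {k : Fin n}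
    {U : Finset (Fin (N + 1) ⊕ Fin (N + 1))}
    (hU : Matrix.det (Matrix.of (U.piecewise (partialFlipRow h N (y k) (cornerPart x y))
      (blockRow h N (cornerPart x y) (cornerPart x y)))) ≠ 0) :
    (∀ q, Sum.inl q ∈ U → ∃ a, k ≤ a ∧ Y a = q) ∧ (∀ q, Sum.inr q ∈ U → ∃ a, a ≤ k ∧ Y a = q) ∧
      U.toLeft.card = U.toRight.card := by
  have hk := hy1 k
  have hl : ∀ q, Sum.inl q ∈ U → y k ≤ q := fun q hq => by
    by_contra hc
    refine hU (Matrix.det_eq_zero_of_row_eq_zero (Sum.inl q) fun j => ?_)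
    rw [Matrix.of_apply, Finset.piecewise_eq_of_mem _ _ _ hq]
    simp [partialFlipRow, hc]
  have hr : ∀ q, Sum.inr q ∈ U → 1 ≤ (q : ℕ) ∧ (q : ℕ) ≤ y k := fun q hq => by
    by_contra hc
    refine hU (Matrix.det_eq_zero_of_row_eq_zero (Sum.inr q) fun j => ?_)
    rw [Matrix.of_apply, Finset.piecewise_eq_of_mem _ _ _ hq, partialFlipRow, Sum.elim_inr,
      if_neg hc, Pi.zero_apply]
  refine ⟨fun q hq => ?_, fun q hq => ?_, ?_⟩
  · by_contra! hc
    have hlq := hl q hq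
    have hne : ∀ a, y a ≠ q := fun a ha =>
      hc a (hy.le_iff_le.mp (by omega)) (Fin.ext (by rw [hY, ha]))
    have := hne k
    have hqr : Sum.inr q ∉ U := fun hq' => by have := hr q hq'; omega
    refine hU (Matrix.det_zero_of_row_eq (i := Sum.inl q) (j := Sum.inr q) (by simp) (funext fun j => ?_))
    rw [Matrix.of_apply, Matrix.of_apply, Finset.piecewise_eq_of_mem _ _ _ hq,
      Finset.piecewise_eq_of_notMem _ _ _ hqr]
    simp only [partialFlipRow, blockRow, flipRow, Sum.elim_inl, Sum.elim_inr, if_pos hlq]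
    rw [topRow_eq_botRow (q' := q) (by omega) (by rw [cornerPart_succ_of_forall_ne hne])]
  · by_contra! hc
    have hrq := hr q hq
    have hne : ∀ a, y a ≠ q := fun a ha =>
      hc a (hy.le_iff_le.mp (by omega)) (Fin.ext (by rw [hY, ha]))
    have := hne k
    have hql : Sum.inl q ∉ U := fun hq' => by have := hl q hq'; omega
    refine hU (Matrix.det_zero_of_row_eq (i := Sum.inl q) (j := Sum.inr q) (by simp) (funext fun j => ?_))
    rw [Matrix.of_apply, Matrix.of_apply, Finset.piecewise_eq_of_mem _ _ _ hq,
      Finset.piecewise_eq_of_notMem _ _ _ hql]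
    simp only [partialFlipRow, blockRow, flipRow, Sum.elim_inl, Sum.elim_inr, if_pos hrq]
    rw [topRow_eq_botRow (q' := q) (by omega) (by rw [cornerPart_succ_of_forall_ne hne])]
  · by_contra hc
    refine hU (det_eq_zero_of_card_ne _ (U.toLeftᶜ.disjSum U.toRight) ?_ ?_ ?_)
    · rintro (q | q) hq j
      · replace hq : Sum.inl q ∉ U := by simpa using hq
        rw [Matrix.of_apply, Finset.piecewise_eq_of_notMem _ _ _ hq]
        rfl
      · replace hq : Sum.inr q ∈ U := by simpa using hq
        rw [Matrix.of_apply, Finset.piecewise_eq_of_mem _ _ _ hq, partialFlipRow, Sum.elim_inr,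
          if_pos (hr q hq)]
        rfl
    · rintro (q | q) hq j
      · replace hq : Sum.inl q ∈ U := by simpa using hq
        rw [Matrix.of_apply, Finset.piecewise_eq_of_mem _ _ _ hq, partialFlipRow, Sum.elim_inl,
          if_pos (hl q hq)]
        rfl
      · replace hq : Sum.inr q ∉ U := by simpa using hq
        rw [Matrix.of_apply, Finset.piecewise_eq_of_notMem _ _ _ hq]
        rfl
    · have := Finset.card_le_univ U.toLeft
      rw [Finset.card_disjSum, Finset.card_compl]
      omega

/-- The chains of `r` nested intervals around `k`. -/
abbrev NestedChain (k : Fin n) (r : ℕ) : Type :=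
  {c : (Fin r → Fin n) × (Fin r → Fin n) //
    (∀ a b : Fin r, a < b → c.1 a < c.1 b) ∧ (∀ a b : Fin r, a < b → c.2 b < c.2 a) ∧
      ∀ s : Fin r, c.1 s ≤ k ∧ k ≤ c.2 s}

theorem exists_nestedChain {Y : Fin n → Fin (N + 1)} (hY : Function.Injective Y) {k : Fin n}
    {U : Finset (Fin (N + 1) ⊕ Fin (N + 1))} (hl : ∀ q, Sum.inl q ∈ U → ∃ a, k ≤ a ∧ Y a = q)
    (hr : ∀ q, Sum.inr q ∈ U → ∃ a, a ≤ k ∧ Y a = q) (hcard : U.toLeft.card = U.toRight.card) :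
    ∃ r ≤ min ((k : ℕ) + 1) (n - k), ∃ c : NestedChain k r, chainSet Y c.1.1 c.1.2 = U := by
  let A : Finset (Fin n) := {a | Sum.inr (Y a) ∈ U}
  let B : Finset (Fin n) := {a | Sum.inl (Y a) ∈ U}
  have hA : A.map ⟨Y, hY⟩ = U.toRight := by
    ext q
    simp only [A, Finset.mem_map, Finset.mem_filter, Finset.mem_univ, true_and,
      Function.Embedding.coeFn_mk, Finset.mem_toRight]
    refine ⟨by rintro ⟨a, ha, rfl⟩; exact ha, fun hq => ?_⟩
    obtain ⟨a, -, rfl⟩ := hr q hq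
    exact ⟨a, hq, rfl⟩
  have hB : B.map ⟨Y, hY⟩ = U.toLeft := by
    ext q
    simp only [B, Finset.mem_map, Finset.mem_filter, Finset.mem_univ, true_and,
      Function.Embedding.coeFn_mk, Finset.mem_toLeft]
    refine ⟨by rintro ⟨a, ha, rfl⟩; exact ha, fun hq => ?_⟩
    obtain ⟨a, -, rfl⟩ := hl q hq
    exact ⟨a, hq, rfl⟩
  have hAk : A ⊆ Finset.Iic k := fun a ha => by
    obtain ⟨b, hb, hba⟩ := hr _ (Finset.mem_filter.mp ha).2
    exact Finset.mem_Iic.mpr (hY hba ▸ hb)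
  have hBk : B ⊆ Finset.Ici k := fun a ha => by
    obtain ⟨b, hb, hba⟩ := hl _ (Finset.mem_filter.mp ha).2
    exact Finset.mem_Ici.mpr (hY hba ▸ hb)
  have hBA : B.card = A.card := by
    rw [← Finset.card_map ⟨Y, hY⟩, ← Finset.card_map (s := A) ⟨Y, hY⟩, hA, hB, hcard]
  have hA' := Finset.card_le_card hAk
  have hB' := Finset.card_le_card hBk
  rw [Fin.card_Iic] at hA'
  rw [Fin.card_Ici, hBA] at hB'
  refine ⟨A.card, le_min hA' hB', ⟨(A.orderEmbOfFin rfl, fun s => B.orderEmbOfFin hBA s.rev),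
    fun a b hab => (A.orderEmbOfFin rfl).strictMono hab,
    fun a b hab => (B.orderEmbOfFin hBA).strictMono (Fin.rev_lt_rev.mpr hab),
    fun s => ⟨Finset.mem_Iic.mp (hAk (A.orderEmbOfFin_mem rfl s)),
      Finset.mem_Ici.mp (hBk (B.orderEmbOfFin_mem hBA s.rev))⟩⟩, ?_⟩
  ext (q | q)
  · rw [inl_mem_chainSet, ← Finset.mem_toLeft, ← hB, Finset.mem_map]
    constructor
    · rintro ⟨s, rfl⟩
      exact ⟨_, B.orderEmbOfFin_mem hBA s.rev, rfl⟩
    · rintro ⟨a, ha, rfl⟩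
      obtain ⟨s, rfl⟩ : a ∈ Set.range (B.orderEmbOfFin hBA) := by
        rw [Finset.range_orderEmbOfFin]; exact ha
      exact ⟨s.rev, by simp⟩
  · rw [inr_mem_chainSet, ← Finset.mem_toRight, ← hA, Finset.mem_map]
    constructor
    · rintro ⟨s, rfl⟩
      exact ⟨_, A.orderEmbOfFin_mem rfl s, rfl⟩
    · rintro ⟨a, ha, rfl⟩
      obtain ⟨s, rfl⟩ : a ∈ Set.range (A.orderEmbOfFin rfl) := by
        rw [Finset.range_orderEmbOfFin]; exact ha
      exact ⟨s, rfl⟩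

theorem chainSet_injective {Y : Fin n → Fin (N + 1)} (hY : Function.Injective Y) {k : Fin n}
    {c c' : Σ r, NestedChain k r}
    (hc : chainSet Y c.2.1.1 c.2.1.2 = chainSet Y c'.2.1.1 c'.2.1.2) : c = c' := by
  have hJ : Set.range c.2.1.2 = Set.range c'.2.1.2 := by
    ext a
    have := congrArg (Sum.inl (Y a) ∈ ·) hc
    simpa [inl_mem_chainSet, hY.eq_iff] using this
  have hI : Set.range c.2.1.1 = Set.range c'.2.1.1 := by
    ext a
    have := congrArg (Sum.inr (Y a) ∈ ·) hc
    simpa [inr_mem_chainSet, hY.eq_iff] using this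
  obtain ⟨r, ⟨I, J⟩, h1, h2, h3⟩ := c
  obtain ⟨r', ⟨I', J'⟩, h1', h2', h3'⟩ := c'
  have hIm : StrictMono I := fun a b => h1 a b
  have hIm' : StrictMono I' := fun a b => h1' a b
  have hJm : StrictAnti J := fun a b => h2 a b
  have hJm' : StrictAnti J' := fun a b => h2' a b
  dsimp only at hI hJ
  have hrr : r = r' := by
    have := congrArg Set.ncard hI
    rwa [← Set.image_univ, ← Set.image_univ, Set.ncard_image_of_injective _ hIm.injective,
      Set.ncard_image_of_injective _ hIm'.injective, Set.ncard_univ, Set.ncard_univ, Nat.card_fin,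
      Nat.card_fin] at this
  subst hrr
  have hII : I = I' := (hIm.range_inj hIm').mp hI
  have hJJ : J = J' := (StrictMono.range_inj (β := Fin r) (γ := (Fin n)ᵒᵈ) hJm hJm').mp hJ
  subst hII hJJ
  rfl

theorem det_piecewise_chainSet (h0 : h 0 = 1) (hneg : ∀ z : ℤ, z < 0 → h z = 0)
    (hx : StrictAnti x) (hx1 : ∀ a, 1 ≤ x a) (hy : StrictMono y) (hy1 : ∀ a, 1 ≤ y a)
    (hN : Finset.univ.sup y + 1 ≤ N) {Y : Fin n → Fin (N + 1)} (hY : ∀ a, (Y a : ℕ) = y a)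
    {k : Fin n} {r : ℕ} (c : NestedChain k r) :
    Matrix.det (Matrix.of ((chainSet Y c.1.1 c.1.2).piecewise
      (partialFlipRow h N (y k) (cornerPart x y))
      (blockRow h N (cornerPart x y) (cornerPart x y)))) =
    (-1) ^ r * schurPad h N (cornerPart (piX x c.1.1 c.1.2) (piY y c.1.1 c.1.2)) *
      schurPad h N (cornerPart (muX x c.1.1 c.1.2) (muY y c.1.1 c.1.2)) := by
  obtain ⟨⟨I, J⟩, hI, hJ, hk⟩ := c
  replace hI : StrictMono I := fun a b => hI a b
  replace hJ : StrictAnti J := fun a b => hJ a b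
  dsimp only at hk ⊢
  have hflip : (chainSet Y I J).piecewise (partialFlipRow h N (y k) (cornerPart x y))
      (blockRow h N (cornerPart x y) (cornerPart x y)) =
      (chainSet Y I J).piecewise (flipRow h N (cornerPart x y))
        (blockRow h N (cornerPart x y) (cornerPart x y)) := by
    refine (chainSet Y I J).piecewise_congr (fun q hq => ?_) fun _ _ => rfl
    rcases q with q | q
    · obtain ⟨s, rfl⟩ := inl_mem_chainSet.mp hq
      rw [partialFlipRow, Sum.elim_inl, if_pos]
      rw [hY]
      exact hy.monotone (hk s).2
    · obtain ⟨s, rfl⟩ := inr_mem_chainSet.mp hq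
      rw [partialFlipRow, Sum.elim_inr, if_pos]
      rw [hY]
      exact ⟨hy1 _, hy.monotone (hk s).1⟩
  obtain ⟨Φ, hsign, -, hrow⟩ :=
    exists_perm_piecewise_chainSet (h := h) hx hx1 hy hy1 Y hY k r I J hI hJ hk
  have hperm := Matrix.det_permute Φ (Matrix.of ((chainSet Y I J).piecewise
    (flipRow h N (cornerPart x y)) (blockRow h N (cornerPart x y) (cornerPart x y))))
  have hsub : (Matrix.of ((chainSet Y I J).piecewise (flipRow h N (cornerPart x y))
      (blockRow h N (cornerPart x y) (cornerPart x y)))).submatrix Φ id =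
      Matrix.of (blockRow h N (cornerPart (piX x I J) (piY y I J))
        (cornerPart (muX x I J) (muY y I J))) := by
    ext q j
    rw [Matrix.submatrix_apply, Matrix.of_apply, hrow]
    rfl
  have hpi : cornerPart (piX x I J) (piY y I J) (N + 1) = 0 :=
    cornerPart_eq_zero fun a => by
      have := piY_le (I := I) hy hJ.injective a
      omega
  rw [hsub, hsign, det_blockRow h0 hneg hpi] at hperm
  rw [hflip, mul_assoc, hperm]
  push_cast
  rw [← mul_assoc, ← mul_pow]
  simp

theorem schurPad_plusCol_mul_minusCol (h0 : h 0 = 1) (hneg : ∀ z : ℤ, z < 0 → h z = 0)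
    (hx : StrictAnti x) (hx1 : ∀ a, 1 ≤ x a) (hy : StrictMono y) (hy1 : ∀ a, 1 ≤ y a)
    (hN : Finset.univ.sup y + 1 ≤ N) (k : Fin n) :
    schurPad h N (plusCol (cornerPart x y) (y k)) * schurPad h N (minusCol (cornerPart x y) (y k)) =
      ∑ r ∈ Finset.range (min ((k : ℕ) + 1) (n - k) + 1), ∑ c : NestedChain k r,
        (-1) ^ r * schurPad h N (cornerPart (piX x c.1.1 c.1.2) (piY y c.1.1 c.1.2)) *
          schurPad h N (cornerPart (muX x c.1.1 c.1.2) (muY y c.1.1 c.1.2)) := by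
  have hle : ∀ a, y a ≤ Finset.univ.sup y := fun a => Finset.le_sup (Finset.mem_univ a)
  let Y : Fin n → Fin (N + 1) := fun a => ⟨y a, by have := hle a; omega⟩
  have hY : ∀ a, (Y a : ℕ) = y a := fun _ => rfl
  have hYinj : Function.Injective Y := fun a b hab => hy.injective (congrArg Fin.val hab)
  have hk := hle k
  have hp : cornerPart x y (N + 1) = 0 := cornerPart_eq_zero fun a => by have := hle a; omega
  have hpos : ∀ q, q ≤ y k → 1 ≤ cornerPart x y q := fun q hq =>
    (hx1 k).trans (Finset.le_sup (f := x) (by simpa using hq))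
  rw [← det_blockRow_add_partialFlipRow h0 hneg hp (by omega) hpos]
  have hexp := Matrix.detRowAlternating.toMultilinearMap.map_add_univ
    (partialFlipRow h N (y k) (cornerPart x y)) (blockRow h N (cornerPart x y) (cornerPart x y))
  refine hexp.trans ?_
  rw [Finset.sum_sigma']
  refine (Finset.sum_of_injOn (fun c => chainSet Y c.2.1.1 c.2.1.2)
    (fun c _ c' _ hc => chainSet_injective hYinj hc) (fun _ _ => by simp) (fun U _ hU => ?_)
    fun c _ => (det_piecewise_chainSet h0 hneg hx hx1 hy hy1 hN hY c.2).symm).symm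
  by_contra hne
  obtain ⟨hl, hr, hcard⟩ := corner_of_det_piecewise_ne_zero (k := k) hy hy1 hY hne
  obtain ⟨r, hr, c, hc⟩ := exists_nestedChain hYinj hl hr hcard
  exact hU ⟨⟨r, c⟩, by simpa using Nat.lt_succ_of_le hr, hc⟩

end Rows

/-- **Main theorem.**  Let `λ` be the partition with corner coordinates
`(x_1,y_1),…,(x_n,y_n)` (so `x_1 > ⋯ > x_n ≥ 1`, `1 ≤ y_1 < ⋯ < y_n`), pick the
`k`-th corner (`k : Fin n`, 0-indexed, so the 1-indexed value is `k+1`) and set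
`ℓ := y_k`, the `k`-th shortest column height.  Then
`s_λ·s_λ = s_{λ+ω_ℓ}·s_{λ−ω_ℓ} + Σ_{r=1}^{min(k,n−k+1)} Σ_{chains} (−1)^{r−1}
s_{π^{i_1⋯i_r}_{j_1⋯j_r}(λ)}·s_{μ^{i_1⋯i_r}_{j_1⋯j_r}(λ)}`,
the inner sum being over chains of nested intervals
`i_1 < ⋯ < i_r ≤ k ≤ j_r < ⋯ < j_1` in `{1,…,n}`. -/
theorem schur_hirota_general {R : Type*} [CommRing R] (h : ℤ → R)
    (h0 : h 0 = 1) (hneg : ∀ z : ℤ, z < 0 → h z = 0)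
    (n : ℕ) (x y : Fin n → ℕ)
    (hx : ∀ a b : Fin n, a < b → x b < x a) (hx1 : ∀ a, 1 ≤ x a)
    (hy : ∀ a b : Fin n, a < b → y a < y b) (hy1 : ∀ a, 1 ≤ y a)
    (k : Fin n) :
    (schurPad h (Finset.univ.sup y + 1) (cornerPart x y)) *
        (schurPad h (Finset.univ.sup y + 1) (cornerPart x y)) =
      (schurPad h (Finset.univ.sup y + 1) (plusCol (cornerPart x y) (y k))) *
          (schurPad h (Finset.univ.sup y + 1) (minusCol (cornerPart x y) (y k)))
        + ∑ r ∈ Finset.Icc 1 (min ((k : ℕ) + 1) (n - (k : ℕ))),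
            ∑ c : {c : (Fin r → Fin n) × (Fin r → Fin n) //
                (∀ a b : Fin r, a < b → c.1 a < c.1 b) ∧
                (∀ a b : Fin r, a < b → c.2 b < c.2 a) ∧
                (∀ s : Fin r, c.1 s ≤ k ∧ k ≤ c.2 s)},
              (-1 : R) ^ (r - 1) *
                schurPad h (Finset.univ.sup y + 1)
                  (cornerPart (piX x c.1.1 c.1.2) (piY y c.1.1 c.1.2)) *
                schurPad h (Finset.univ.sup y + 1)
                  (cornerPart (muX x c.1.1 c.1.2) (muY y c.1.1 c.1.2)) := by
  replace hx : StrictAnti x := fun a b => hx a b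
  replace hy : StrictMono y := fun a b => hy a b
  have hpi : ∀ I J : Fin 0 → Fin n, piX x I J = x ∧ piY y I J = y := fun I J =>
    ⟨by funext a; simp [piX], by funext a; simp [piY]⟩
  have hmu : ∀ I J : Fin 0 → Fin n, muX x I J = x ∧ muY y I J = y := fun I J =>
    ⟨by funext a; simp [muX], by funext a; simp [muY]⟩
  rw [schurPad_plusCol_mul_minusCol h0 hneg hx hx1 hy hy1 le_rfl k, Finset.sum_range_succ',
    show Finset.Icc 1 (min ((k : ℕ) + 1) (n - k)) = Finset.Ico 1 (min ((k : ℕ) + 1) (n - k) + 1)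
      from rfl, Finset.sum_Ico_eq_sum_range, Nat.add_sub_cancel, add_right_comm,
    ← Finset.sum_add_distrib, Finset.sum_eq_zero, zero_add]
  · let c₀ : NestedChain k 0 :=
      ⟨(Fin.elim0, Fin.elim0), fun a => a.elim0, fun a => a.elim0, fun a => a.elim0⟩
    rw [Fintype.sum_eq_single c₀ fun c hc => absurd (Subsingleton.elim c c₀) hc, (hpi _ _).1,
      (hpi _ _).2, (hmu _ _).1, (hmu _ _).2, pow_zero, one_mul]
  · intro r _
    rw [add_comm 1 r, ← Finset.sum_add_distrib]
    refine Finset.sum_eq_zero fun c _ => ?_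
    rw [Nat.add_sub_cancel]
    ring
end

section
/- Let R be a commutative ring and t : ℤ → ℤ → R an arbitrary function (no specialization), and define s_ν^{(u)} for weakly decreasing integer tuples ν as the shifted Jacobi–Trudi determinant. Let λ be a partition with exactly m positive parts whose Young diagram has n outside corners with coordinates (x_1,y_1),…,(x_n,y_n) (so y_n = m). Fix 1 ≤ k ≤ n and set ℓ := y_k. For a chain of nested intervals 1 ≤ i_1 < ⋯ < i_r ≤ k ≤ j_r < ⋯ < j_1 ≤ n, let α := π^{i_1⋯i_r}_{j_1⋯j_r}(λ), written as a tuple with m+1 entries if j_1 = n and with m entries if j_1 < n, and let β := μ^{i_1⋯i_r}_{j_1⋯j_r}(λ), written as a tuple with m−1 entries if j_1 = n and with m entries if j_1 < n (entries equal to 0 retained; in each case the number of entries is the value of y_n for the new corner coordinates). Then for every u ∈ ℤ: s_λ^{(u−1)} · s_λ^{(u+1)} = s_{λ+ω_ℓ}^{(u)} · s_{λ−ω_ℓ}^{(u)} + Σ over all such chains of (−1)^{r−1} · c, where c = s_α^{(u)} · s_β^{(u+λ_1−β_1)} if j_1 = n and c = s_α^{(u−1)} · s_β^{(u+λ_1−β_1+1)}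 if j_1 < n (β_1 denotes the first entry of β), and λ, λ+ω_ℓ, λ−ω_ℓ are all written as tuples with m entries. -/
/-- Shifted Jacobi–Trudi determinant with spectral parameter: for a tuple
`ν = (ν_1, …, ν_p)` and shift `u`,
`sShift t u ν = det (t_{ν_i − i + j}(u + ν_1 − ν_i + i + j − p − 1))_{i,j=1}^p`.
Rows/columns here are 0-indexed, giving entry
`t_{ν_{i'} − i' + j'}(u + ν_0 − ν_{i'} + i' + j' − p + 1)`; for `p = 0` it is `1`. -/
noncomputable def sShift {R : Type*} [CommRing R] (t : ℤ → ℤ → R) (u : ℤ) {p : ℕ}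
    (ν : Fin p → ℤ) : R :=
  Matrix.det (Matrix.of fun i j : Fin p =>
    t (ν i - (i : ℕ) + (j : ℕ))
      (u + ν ⟨0, i.pos⟩ - ν i + (i : ℕ) + (j : ℕ) - (p : ℕ) + 1))

namespace QuantumHirota

open Finset

section Split

variable {R ι κ : Type*} [CommRing R]

/-- The concatenation of two row vectors, indexed through `e : ι ≃ κ ⊕ κ`. -/
def pairRow (e : ι ≃ κ ⊕ κ) (a b : κ → R) : ι → R := fun j => Sum.elim a b (e j)

theorem pairRow_add (e : ι ≃ κ ⊕ κ) (a b a' b' : κ → R) :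
    pairRow e a b + pairRow e a' b' = pairRow e (a + a') (b + b') := by
  funext j
  simp only [pairRow, Pi.add_apply]
  cases e j <;> rfl

variable [Fintype ι] [Fintype κ]

theorem pairRow_vecMul [DecidableEq κ] (e : ι ≃ κ ⊕ κ) (a b : κ → R) :
    Matrix.vecMul (pairRow e a b)
      ((Matrix.fromBlocks (1 : Matrix κ κ R) (-1) 0 1).submatrix e e) =
      pairRow e a (b - a) := by
  have h : pairRow e a b = Sum.elim a b ∘ e := rfl
  rw [h, Matrix.submatrix_vecMul_equiv]
  funext j
  simp only [Function.comp_apply, pairRow]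
  rw [Function.comp_assoc, Equiv.self_comp_symm, Function.comp_id, Matrix.vecMul_fromBlocks]
  cases e j <;> simp [Matrix.vecMul_neg, sub_eq_neg_add]

variable [DecidableEq ι]

/-- The matrix with row `(w i | 0)` for `i ∈ A` and `(0 | w' i)` for `i ∉ A`. -/
def splitRows (e : ι ≃ κ ⊕ κ) (w w' : ι → κ → R) (A : Finset ι) : ι → ι → R :=
  fun i => if i ∈ A then pairRow e (w i) 0 else pairRow e 0 (w' i)

theorem det_splitRows_eq_zero (e : ι ≃ κ ⊕ κ) (w w' : ι → κ → R) (A : Finset ι)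
    (hA : #A ≠ Fintype.card κ) : Matrix.det (Matrix.of (splitRows e w w' A)) = 0 := by
  rw [Matrix.det_apply]
  refine Finset.sum_eq_zero fun σ _ => ?_
  have h : ∃ i, ¬ (σ i ∈ A ↔ (e i).isLeft) := by
    by_contra! h
    apply hA
    rw [← Finset.card_univ]
    symm
    refine Finset.card_bij (fun c _ => σ (e.symm (Sum.inl c))) ?_ ?_ ?_
    · intro c _
      rw [h]
      simp
    · intro c _ c' _ hc
      simpa using hc
    · intro b hb
      have := (h (σ.symm b)).1 (by simpa using hb)
      obtain ⟨c, hc⟩ := Sum.isLeft_iff.1 this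
      exact ⟨c, Finset.mem_univ _, by rw [← hc]; simp⟩
  obtain ⟨i, hi⟩ := h
  rw [Finset.prod_eq_zero (Finset.mem_univ i), smul_zero]
  simp only [Matrix.of_apply, splitRows]
  split_ifs with hσ <;> rcases hj : e i with c | c <;> simp_all [pairRow]

variable [DecidableEq κ]

/-- The two-block form of the Plücker (Sylvester) exchange relation. -/
theorem sum_det_splitRows (e : ι ≃ κ ⊕ κ) (w : ι → κ → R) (L F : Finset ι)
    (hLF : Disjoint L F) (hF : #F = Fintype.card κ) :
    ∑ s ∈ F.powerset, Matrix.det (Matrix.of (splitRows e w w (L ∪ s))) =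
      (-1) ^ #L * Matrix.det (Matrix.of (splitRows e w w F)) := by
  classical
  let f : MultilinearMap R (fun _ : ι => ι → R) R :=
    (Matrix.detRowAlternating : (ι → R) [⋀^ι]→ₗ[R] R).toMultilinearMap
  have hf : ∀ M : ι → ι → R, f M = Matrix.det (Matrix.of M) := fun M => rfl
  let l : ι → ι → R := fun i => pairRow e (w i) 0
  have key1 := f.map_piecewise_add l (splitRows e w w L) F
  have key2 := f.map_piecewise_add l (splitRows e w (fun i => if i ∈ L then -w i else w i) F) L
  have key3 := f.map_piecewise_smul (fun _ : ι => (-1 : R)) (splitRows e w w F) L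
  have hU : (Matrix.fromBlocks (1 : Matrix κ κ R) (-1) 0 (1 : Matrix κ κ R)).det = 1 := by
    simp
  have hmul : ∀ M : Matrix ι ι R,
      M.det = (M * (Matrix.fromBlocks (1 : Matrix κ κ R) (-1) 0 1).submatrix e e).det := by
    intro M
    rw [Matrix.det_mul, Matrix.det_submatrix_equiv_self, hU, mul_one]
  have hd : ∀ i, i ∈ L → i ∉ F := fun i h h' => Finset.disjoint_left.1 hLF h h'
  have e1 : ∀ s ∈ F.powerset, s.piecewise l (splitRows e w w L) = splitRows e w w (L ∪ s) := by
    intro s hs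
    funext i
    simp only [Finset.piecewise, splitRows, Finset.mem_union, l]
    by_cases h1 : i ∈ s <;> by_cases h2 : i ∈ L <;> simp [h1, h2]
  have e2 : ∀ s ∈ L.powerset, s.piecewise l
      (splitRows e w (fun i => if i ∈ L then -w i else w i) F) =
      splitRows e w (fun i => if i ∈ L then -w i else w i) (F ∪ s) := by
    intro s hs
    funext i
    simp only [Finset.piecewise, splitRows, Finset.mem_union, l]
    by_cases h1 : i ∈ s <;> by_cases h2 : i ∈ F <;> simp [h1, h2]
  have e3 : L.piecewise (fun i => (-1 : R) • splitRows e w w F i) (splitRows e w w F) =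
      splitRows e w (fun i => if i ∈ L then -w i else w i) F := by
    funext i j
    by_cases h1 : i ∈ L
    · simp only [Finset.piecewise, splitRows, h1, hd i h1, pairRow, if_true, if_false,
        Pi.smul_apply]
      cases e j <;> simp
    · simp only [Finset.piecewise, splitRows, h1, if_false]
  have e4 : Matrix.of (F.piecewise (l + splitRows e w w L) (splitRows e w w L)) *
      (Matrix.fromBlocks (1 : Matrix κ κ R) (-1) 0 1).submatrix e e =
      Matrix.of (L.piecewise (l + splitRows e w (fun i => if i ∈ L then -w i else w i) F)
        (splitRows e w (fun i => if i ∈ L then -w i else w i) F)) := by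
    refine Matrix.ext fun i => congrFun ?_
    rw [Matrix.mul_apply_eq_vecMul]
    change Matrix.vecMul (F.piecewise (l + splitRows e w w L) (splitRows e w w L) i) _ =
      L.piecewise (l + splitRows e w (fun i => if i ∈ L then -w i else w i) F)
        (splitRows e w (fun i => if i ∈ L then -w i else w i) F) i
    by_cases h1 : i ∈ L
    · have h2 := hd i h1
      simp only [Finset.piecewise, splitRows, h1, h2, if_true, if_false, pairRow_vecMul,
        Pi.add_apply, pairRow_add, l]
      simp
    · by_cases h2 : i ∈ F
      · simp only [Finset.piecewise, splitRows, h1, h2, if_true, if_false, pairRow_vecMul,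
          Pi.add_apply, pairRow_add, l]
        simp
      · simp only [Finset.piecewise, splitRows, h1, h2, if_false, pairRow_vecMul]
        simp
  rw [Finset.sum_congr rfl fun s hs => (congrArg f (e1 s hs))] at key1
  rw [Finset.sum_congr rfl fun s hs => (congrArg f (e2 s hs)),
    Finset.sum_eq_single ∅] at key2
  · simp only [hf] at key1 key2 key3
    rw [← key1, hmul, e4, key2, Finset.union_empty, ← e3, key3]
    simp
  · intro s hs hne
    rw [hf]
    apply det_splitRows_eq_zero
    rw [Finset.card_union_of_disjoint
      (Finset.disjoint_of_subset_right (Finset.mem_powerset.1 hs) hLF.symm), hF]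
    have := Finset.card_pos.2 (Finset.nonempty_iff_ne_empty.2 hne)
    omega
  · simp

end Split

section Minor

variable {R : Type*} [CommRing R] {N : ℕ}

/-- The minor on the rows in `A`, taken in increasing order (`0` if `A` has the wrong size). -/
def rowMinor (w : Fin (N + N) → Fin N → R) (A : Finset (Fin (N + N))) : R :=
  if h : #A = N then Matrix.det (Matrix.of fun i => w (A.orderEmbOfFin h i)) else 0

theorem card_compl_of_half {A : Finset (Fin (N + N))} (h : #A = N) : #Aᶜ = N := by
  rw [Finset.card_compl, h, Fintype.card_fin]; omega

theorem sign_shuffle (A : Finset (Fin (N + N))) (h : #A = N) :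
    (Equiv.Perm.sign (finSumFinEquiv.symm.trans
      (finSumEquivOfFinset h (card_compl_of_half h))) : ℤ) =
      (-1) ^ (∑ i : Fin N, (i : ℕ)) * (-1) ^ (∑ a ∈ A, (a : ℕ)) := by
  set g := A.orderEmbOfFin h with hg
  set g' := Aᶜ.orderEmbOfFin (card_compl_of_half h) with hg'
  have hne : ∀ a b, g a ≠ g' b := by
    intro a b hab
    have h1 := A.orderEmbOfFin_mem h a
    have h2 := Aᶜ.orderEmbOfFin_mem (card_compl_of_half h) b
    rw [← hg'] at h2
    rw [← hg, hab] at h1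
    exact Finset.mem_compl.1 h2 h1
  have hcount : ∀ a : Fin N, #{b | g' b < g a} + (a : ℕ) = (g a : ℕ) := by
    intro a
    have h1 : #(Finset.Iio (g a)) = (g a : ℕ) := Fin.card_Iio _
    have h2 : Finset.Iio (g a) = (Finset.univ.filter fun b => g' b < g a).map g'.toEmbedding ∪
        (Finset.Iio a).map g.toEmbedding := by
      ext z
      simp only [Finset.mem_Iio, Finset.mem_union, Finset.mem_map, Finset.mem_filter,
        Finset.mem_univ, true_and, RelEmbedding.coe_toEmbedding]
      constructor
      · intro hz
        by_cases hzA : z ∈ A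
        · right
          have : z ∈ Set.range g := by rw [hg, Finset.range_orderEmbOfFin]; exact hzA
          obtain ⟨c, rfl⟩ := this
          exact ⟨c, g.lt_iff_lt.1 hz, rfl⟩
        · left
          have : z ∈ Set.range g' := by
            rw [hg', Finset.range_orderEmbOfFin]; simpa using hzA
          obtain ⟨c, rfl⟩ := this
          exact ⟨c, hz, rfl⟩
      · rintro (⟨c, hc, rfl⟩ | ⟨c, hc, rfl⟩)
        · exact hc
        · exact g.lt_iff_lt.2 hc
    rw [h2, Finset.card_union_of_disjoint, Finset.card_map, Finset.card_map, Fin.card_Iio] at h1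
    · exact h1
    · rw [Finset.disjoint_left]
      intro z hz hz'
      obtain ⟨b, -, rfl⟩ := Finset.mem_map.1 hz
      obtain ⟨a', -, h'⟩ := Finset.mem_map.1 hz'
      exact hne a' b h'
  have hsum : ∑ a ∈ A, (a : ℕ) = ∑ i : Fin N, (g i : ℕ) := by
    conv_lhs => rw [← Finset.image_orderEmbOfFin_univ A h]
    rw [Finset.sum_image (fun a _ b _ hab => (A.orderEmbOfFin h).injective hab)]
  rw [Equiv.Perm.sign_eq_prod_prod_Ioi, hsum, ← pow_add, ← Finset.sum_add_distrib,
    ← Finset.prod_pow_eq_pow_sum, Units.coe_prod, ← finSumFinEquiv.prod_comp,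
    Fintype.prod_sum_type]
  have hr : ∀ b : Fin N, (∏ j ∈ Finset.Ioi (finSumFinEquiv (Sum.inr b : Fin N ⊕ Fin N)),
      if (finSumFinEquiv.symm.trans (finSumEquivOfFinset h (card_compl_of_half h)))
          (finSumFinEquiv (Sum.inr b)) <
        (finSumFinEquiv.symm.trans (finSumEquivOfFinset h (card_compl_of_half h))) j
      then (1 : ℤˣ) else -1) = 1 := by
    intro b
    refine Finset.prod_eq_one fun j hj => ?_
    obtain ⟨j, rfl⟩ := finSumFinEquiv.surjective j
    rcases j with j | j
    · simp [Fin.lt_def] at hj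
      omega
    · simp only [Equiv.trans_apply, Equiv.symm_apply_apply, finSumEquivOfFinset_inr]
      rw [if_pos]
      apply (Aᶜ.orderEmbOfFin _).lt_iff_lt.2
      simpa using hj
  have hl : ∀ a : Fin N, ((∏ j ∈ Finset.Ioi (finSumFinEquiv (Sum.inl a : Fin N ⊕ Fin N)),
      if (finSumFinEquiv.symm.trans (finSumEquivOfFinset h (card_compl_of_half h)))
          (finSumFinEquiv (Sum.inl a)) <
        (finSumFinEquiv.symm.trans (finSumEquivOfFinset h (card_compl_of_half h))) j
      then (1 : ℤˣ) else -1 : ℤˣ) : ℤ) = (-1) ^ ((a : ℕ) + (g a : ℕ)) := by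
    intro a
    have hI : Finset.Ioi (finSumFinEquiv (Sum.inl a : Fin N ⊕ Fin N)) =
        Finset.univ.filter (finSumFinEquiv (Sum.inl a : Fin N ⊕ Fin N) < ·) := by
      ext z; rw [Finset.mem_Ioi, Finset.mem_filter]; simp only [Finset.mem_univ, true_and]
    rw [hI, Finset.prod_filter, ← finSumFinEquiv.prod_comp, Fintype.prod_sum_type,
      Finset.prod_eq_one, one_mul]
    · simp only [Equiv.trans_apply, Equiv.symm_apply_apply, finSumEquivOfFinset_inr,
        finSumEquivOfFinset_inl]
      rw [← hg, ← hg']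
      have h1 : ∀ b : Fin N, (if finSumFinEquiv (Sum.inl a : Fin N ⊕ Fin N) <
          finSumFinEquiv (Sum.inr b) then if g a < g' b then (1 : ℤˣ) else -1 else 1) =
          if g' b < g a then -1 else 1 := by
        intro b
        rw [if_pos (by simp [Fin.lt_def]; omega)]
        rcases lt_trichotomy (g a) (g' b) with h | h | h
        · rw [if_pos h, if_neg h.not_gt]
        · exact absurd h (hne a b)
        · rw [if_neg h.not_gt, if_pos h]
      rw [Finset.prod_congr rfl fun b _ => h1 b, Finset.prod_ite, Finset.prod_const,
        Finset.prod_const_one, mul_one, ← hcount a, add_left_comm, pow_add,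
        Even.neg_one_pow ⟨_, rfl⟩]
      simp
    · intro b _
      split_ifs with h1 h2
      · rfl
      · refine absurd ?_ h2
        simp only [Equiv.trans_apply, Equiv.symm_apply_apply, finSumEquivOfFinset_inl]
        apply (A.orderEmbOfFin _).lt_iff_lt.2
        exact Fin.lt_def.2 (Fin.lt_def.1 h1)
      · rfl
  simp only [hr, hl]
  simp

theorem det_splitRows_eq (w : Fin (N + N) → Fin N → R) (A : Finset (Fin (N + N))) :
    Matrix.det (Matrix.of (splitRows finSumFinEquiv.symm w w A)) =
      (-1) ^ (∑ i : Fin N, (i : ℕ)) * ((-1) ^ (∑ a ∈ A, (a : ℕ)) *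
        (rowMinor w A * rowMinor w Aᶜ)) := by
  by_cases h : #A = N
  · have h' := card_compl_of_half h
    rw [rowMinor, rowMinor, dif_pos h, dif_pos h']
    set σ : Equiv.Perm (Fin (N + N)) := finSumFinEquiv.symm.trans (finSumEquivOfFinset h h')
      with hσ
    have h1 := Matrix.det_permute σ (Matrix.of (splitRows finSumFinEquiv.symm w w A))
    have h2 : (Matrix.submatrix (Matrix.of (splitRows finSumFinEquiv.symm w w A)) σ id).det =
        Matrix.det (Matrix.of fun i => w (A.orderEmbOfFin h i)) *
          Matrix.det (Matrix.of fun i => w (Aᶜ.orderEmbOfFin h' i)) := by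
      rw [← Matrix.det_submatrix_equiv_self finSumFinEquiv,
        ← Matrix.det_fromBlocks_zero₁₂ _ 0]
      congr 1
      ext i j
      rcases i with i | i
      · have : A.orderEmbOfFin h i ∈ A := A.orderEmbOfFin_mem h i
        rcases j with j | j <;> 
          simp [splitRows, pairRow, hσ, this, -finSumFinEquiv_apply_left,
            -finSumFinEquiv_apply_right]
      · have : Aᶜ.orderEmbOfFin h' i ∉ A := Finset.mem_compl.1 (Aᶜ.orderEmbOfFin_mem h' i)
        rcases j with j | j <;> 
          simp [splitRows, pairRow, hσ, this, -finSumFinEquiv_apply_left,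
            -finSumFinEquiv_apply_right]
    have h3 := congrArg (Int.cast : ℤ → R) (sign_shuffle A h)
    rw [← hσ] at h3
    push_cast at h3
    rw [h2, h3] at h1
    rw [h1, ← mul_assoc, ← mul_assoc]
    have hs : ∀ k : ℕ, (-1 : R) ^ k * (-1) ^ k = 1 := fun k => by
      rw [← mul_pow]; simp
    calc Matrix.det (Matrix.of (splitRows finSumFinEquiv.symm w w A))
        = 1 * 1 * Matrix.det (Matrix.of (splitRows finSumFinEquiv.symm w w A)) := by simp
      _ = ((-1 : R) ^ (∑ i : Fin N, (i : ℕ)) * (-1) ^ (∑ i : Fin N, (i : ℕ))) *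
          ((-1 : R) ^ (∑ a ∈ A, (a : ℕ)) * (-1) ^ (∑ a ∈ A, (a : ℕ))) *
          Matrix.det (Matrix.of (splitRows finSumFinEquiv.symm w w A)) := by
          rw [hs, hs]
      _ = _ := by ring
  · rw [det_splitRows_eq_zero _ _ _ _ (by simpa using h), rowMinor, dif_neg h]
    simp

theorem sum_rowMinor (w : Fin (N + N) → Fin N → R) (L F : Finset (Fin (N + N)))
    (hLF : Disjoint L F) (hF : #F = N) :
    ∑ s ∈ F.powerset, (-1) ^ (∑ a ∈ L ∪ s, (a : ℕ)) *
        (rowMinor w (L ∪ s) * rowMinor w (L ∪ s)ᶜ) =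
      (-1) ^ #L * ((-1) ^ (∑ a ∈ F, (a : ℕ)) * (rowMinor w F * rowMinor w Fᶜ)) := by
  have h := sum_det_splitRows finSumFinEquiv.symm w L F hLF (by simpa using hF)
  simp only [det_splitRows_eq, ← Finset.mul_sum] at h
  have hs : (-1 : R) ^ (∑ i : Fin N, (i : ℕ)) * (-1) ^ (∑ i : Fin N, (i : ℕ)) = 1 := by
    rw [← mul_pow]; simp
  generalize (-1 : R) ^ (∑ i : Fin N, (i : ℕ)) = z at h hs
  linear_combination z * h - (∑ s ∈ F.powerset, (-1) ^ (∑ a ∈ L ∪ s, (a : ℕ)) *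
        (rowMinor w (L ∪ s) * rowMinor w (L ∪ s)ᶜ) -
    (-1) ^ #L * ((-1) ^ (∑ a ∈ F, (a : ℕ)) * (rowMinor w F * rowMinor w Fᶜ))) * hs

end Minor

theorem rowMinor_eq_det {R : Type*} [CommRing R] {N : ℕ} (w : Fin (N + N) → Fin N → R)
    {A : Finset (Fin (N + N))} (hA : #A = N) (τ : Fin N → Fin (N + N)) (hτ : StrictMono τ)
    (hmem : ∀ i, τ i ∈ A) : rowMinor w A = Matrix.det (Matrix.of fun i => w (τ i)) := by
  rw [rowMinor, dif_pos hA, ← Finset.orderEmbOfFin_unique hA hmem hτ]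

theorem det_of_last_row {R : Type*} [CommRing R] {m : ℕ} (M : Matrix (Fin (m + 1)) (Fin (m + 1)) R)
    (h : M (Fin.last m) = Pi.single (Fin.last m) 1) :
    M.det = (M.submatrix Fin.castSucc Fin.castSucc).det := by
  rw [Matrix.det_succ_row M (Fin.last m), Finset.sum_eq_single (Fin.last m)]
  · rw [h, Fin.succAbove_last, Even.neg_one_pow ⟨_, rfl⟩]
    simp
  · intro j _ hj
    simp [h, hj]
  · simp

theorem det_of_first_row {R : Type*} [CommRing R] {m : ℕ}
    (M : Matrix (Fin (m + 1)) (Fin (m + 1)) R) (h : M 0 = Pi.single 0 1) :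
    M.det = (M.submatrix Fin.succ Fin.succ).det := by
  rw [Matrix.det_succ_row_zero, Finset.sum_eq_single 0]
  · simp [h]
  · intro j _ hj
    simp [h, hj]
  · simp

section Tuple

variable {R : Type*} [CommRing R] (t : ℤ → ℤ → R) (c : ℤ) (m : ℕ) (lab : ℕ → ℤ)

/-- The row at position `ω` of the merged sequence with labels `lab`: a Jacobi–Trudi row, except
that the first and last positions carry unit vectors. -/
def labRow (ω : Fin (m + 1 + (m + 1))) : Fin (m + 1) → R :=
  if (ω : ℕ) = 0 then Pi.single 0 1
  else if (ω : ℕ) = 2 * m + 1 then Pi.single (Fin.last m) 1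
  else fun j => t ((j : ℕ) - lab ω) (c + lab ω + (j : ℕ))

variable {c m lab}

theorem rowMinor_eq_sShift (hlab : Monotone lab) {A : Finset (Fin (m + 1 + (m + 1)))}
    (hA : #A = m + 1) {p : ℕ} (hp : p = m + 1) (ν : Fin p → ℤ) (u : ℤ)
    (hν : ∀ i j : Fin p, i < j → ((i : ℕ) : ℤ) - ν i < (j : ℕ) - ν j)
    (hmem : ∀ i : Fin p, ∃ ω ∈ A, (ω : ℕ) ≠ 0 ∧ (ω : ℕ) ≠ 2 * m + 1 ∧ lab ω = (i : ℕ) - ν i)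
    (hc : ∀ h : 0 < p, u + ν ⟨0, h⟩ - p + 1 = c) :
    rowMinor (labRow t c m lab) A = sShift t u ν := by
  subst hp
  choose f hf h0 h1 hl using hmem
  rw [rowMinor_eq_det _ hA f _ hf]
  · unfold sShift
    congr 1
    ext i j
    simp only [Matrix.of_apply, labRow, h0 i, h1 i, if_false, hl]
    rw [← hc (Nat.succ_pos _)]
    congr 1 <;> ring
  · intro i j hij
    by_contra! h
    have := hlab (show (f j : ℕ) ≤ f i from h)
    have := hν i j hij
    rw [hl, hl] at *
    omega

theorem rowMinor_eq_sShift_of_last (hlab : Monotone lab) {A : Finset (Fin (m + 1 + (m + 1)))}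
    (hA : #A = m + 1) (hlast : ∀ ω : Fin (m + 1 + (m + 1)), (ω : ℕ) = 2 * m + 1 → ω ∈ A)
    {p : ℕ} (hp : p = m) (ν : Fin p → ℤ) (u : ℤ)
    (hν : ∀ i j : Fin p, i < j → ((i : ℕ) : ℤ) - ν i < (j : ℕ) - ν j)
    (hmem : ∀ i : Fin p, ∃ ω ∈ A, (ω : ℕ) ≠ 0 ∧ (ω : ℕ) ≠ 2 * m + 1 ∧ lab ω = (i : ℕ) - ν i)
    (hc : ∀ h : 0 < p, u + ν ⟨0, h⟩ - p + 1 = c) :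
    rowMinor (labRow t c m lab) A = sShift t u ν := by
  subst hp
  choose f hf h0 h1 hl using hmem
  rw [rowMinor_eq_det _ hA (Fin.snoc (α := fun _ => Fin (p + 1 + (p + 1))) f
    ⟨2 * p + 1, by omega⟩), det_of_last_row]
  · unfold sShift
    congr 1
    ext i j
    simp only [Matrix.submatrix_apply, Matrix.of_apply, Fin.snoc_castSucc, labRow, h0 i, h1 i,
      if_false, hl, Fin.val_castSucc]
    rw [← hc i.pos]
    congr 1 <;> ring
  · funext j
    simp [labRow]
  · intro i j hij
    induction j using Fin.lastCases with
    | last =>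
      induction i using Fin.lastCases with
      | last => exact absurd hij (lt_irrefl _)
      | cast i =>
        simp only [Fin.snoc_castSucc, Fin.snoc_last, Fin.lt_def]
        have := h1 i
        omega
    | cast j =>
      induction i using Fin.lastCases with
      | last => exact absurd hij (Fin.castSucc_lt_last j).not_gt
      | cast i =>
        simp only [Fin.snoc_castSucc]
        by_contra! h
        have := hlab (show (f j : ℕ) ≤ f i from h)
        have := hν i j hij
        rw [hl, hl] at *
        omega
  · intro i
    induction i using Fin.lastCases with
    | last => simpa only [Fin.snoc_last] using hlast _ rfl
    | cast i => simpa only [Fin.snoc_castSucc] using hf i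

theorem rowMinor_eq_sShift_of_zero (hlab : Monotone lab) {A : Finset (Fin (m + 1 + (m + 1)))}
    (hA : #A = m + 1) (hzero : ∀ ω : Fin (m + 1 + (m + 1)), (ω : ℕ) = 0 → ω ∈ A)
    {p : ℕ} (hp : p = m) (ν : Fin p → ℤ) (u : ℤ)
    (hν : ∀ i j : Fin p, i < j → ((i : ℕ) : ℤ) - ν i < (j : ℕ) - ν j)
    (hmem : ∀ i : Fin p, ∃ ω ∈ A, (ω : ℕ) ≠ 0 ∧ (ω : ℕ) ≠ 2 * m + 1 ∧
      lab ω = (i : ℕ) + 1 - ν i)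
    (hc : ∀ h : 0 < p, u + ν ⟨0, h⟩ - p + 1 = c + 2) :
    rowMinor (labRow t c m lab) A = sShift t u ν := by
  subst hp
  choose f hf h0 h1 hl using hmem
  rw [rowMinor_eq_det _ hA (Fin.cons (α := fun _ => Fin (p + 1 + (p + 1)))
    ⟨0, by omega⟩ f), det_of_first_row]
  · unfold sShift
    congr 1
    ext i j
    simp only [Matrix.submatrix_apply, Matrix.of_apply, Fin.cons_succ, labRow, h0 i, h1 i,
      if_false, hl, Fin.val_succ]
    have := hc i.pos
    congr 1
    · push_cast; ring
    · push_cast; linarith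
  · funext j
    simp [labRow]
  · intro i j hij
    induction j using Fin.cases with
    | zero => exact absurd hij (Fin.not_lt_zero i)
    | succ j =>
      induction i using Fin.cases with
      | zero =>
        simp only [Fin.cons_succ, Fin.cons_zero, Fin.lt_def]
        have := h0 j
        omega
      | succ i =>
        simp only [Fin.cons_succ]
        by_contra! h
        have := hlab (show (f j : ℕ) ≤ f i from h)
        have := hν i j (Fin.succ_lt_succ_iff.1 hij)
        rw [hl, hl] at *
        omega
  · intro i
    induction i using Fin.cases with
    | zero => simpa only [Fin.cons_zero] using hzero _ rfl
    | succ i => simpa only [Fin.cons_succ] using hf i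

theorem rowMinor_eq_sShift_of_zero_of_last (hlab : Monotone lab)
    {A : Finset (Fin (m + 1 + (m + 1)))}
    (hA : #A = m + 1) (hzero : ∀ ω : Fin (m + 1 + (m + 1)), (ω : ℕ) = 0 → ω ∈ A)
    (hlast : ∀ ω : Fin (m + 1 + (m + 1)), (ω : ℕ) = 2 * m + 1 → ω ∈ A)
    {p : ℕ} (hp : p + 1 = m) (ν : Fin p → ℤ) (u : ℤ)
    (hν : ∀ i j : Fin p, i < j → ((i : ℕ) : ℤ) - ν i < (j : ℕ) - ν j)
    (hmem : ∀ i : Fin p, ∃ ω ∈ A, (ω : ℕ) ≠ 0 ∧ (ω : ℕ) ≠ 2 * m + 1 ∧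
      lab ω = (i : ℕ) + 1 - ν i)
    (hc : ∀ h : 0 < p, u + ν ⟨0, h⟩ - p + 1 = c + 2) :
    rowMinor (labRow t c m lab) A = sShift t u ν := by
  subst hp
  choose f hf h0 h1 hl using hmem
  rw [rowMinor_eq_det _ hA (Fin.cons (α := fun _ => Fin (p + 1 + 1 + (p + 1 + 1)))
    ⟨0, by omega⟩ (Fin.snoc (α := fun _ => Fin (p + 1 + 1 + (p + 1 + 1))) f
    ⟨2 * (p + 1) + 1, by omega⟩)), det_of_first_row, det_of_last_row]
  · unfold sShift
    congr 1
    ext i j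
    simp only [Matrix.submatrix_apply, Matrix.of_apply, Fin.cons_succ, Fin.snoc_castSucc, labRow,
      h0 i, h1 i, if_false, hl, Fin.val_succ, Fin.val_castSucc]
    have := hc i.pos
    congr 1
    · push_cast; ring
    · push_cast; linarith
  · funext j
    simp only [Matrix.submatrix_apply, Matrix.of_apply, Fin.cons_succ, Fin.snoc_last, labRow]
    rw [if_neg (by omega), if_pos trivial, ← Fin.succ_last]
    simp [Pi.single_apply]
  · funext j
    simp [labRow]
  · intro i j hij
    induction j using Fin.cases with
    | zero => exact absurd hij (Fin.not_lt_zero i)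
    | succ j =>
      induction i using Fin.cases with
      | zero =>
        simp only [Fin.cons_succ, Fin.cons_zero, Fin.lt_def]
        induction j using Fin.lastCases with
        | last => simp only [Fin.snoc_last]; omega
        | cast j =>
          simp only [Fin.snoc_castSucc]
          have := h0 j
          omega
      | succ i =>
        simp only [Fin.cons_succ]
        have hij := Fin.succ_lt_succ_iff.1 hij
        induction j using Fin.lastCases with
        | last =>
          induction i using Fin.lastCases with
          | last => exact absurd hij (lt_irrefl _)
          | cast i =>
            simp only [Fin.snoc_castSucc, Fin.snoc_last, Fin.lt_def]
            have := h1 i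
            omega
        | cast j =>
          induction i using Fin.lastCases with
          | last => exact absurd hij (Fin.castSucc_lt_last j).not_gt
          | cast i =>
            simp only [Fin.snoc_castSucc]
            by_contra! h
            have := hlab (show (f j : ℕ) ≤ f i from h)
            have := hν i j hij
            rw [hl, hl] at *
            omega
  · intro i
    induction i using Fin.cases with
    | zero => simpa only [Fin.cons_zero] using hzero _ rfl
    | succ i =>
      induction i using Fin.lastCases with
      | last => simpa only [Fin.cons_succ, Fin.snoc_last] using hlast _ rfl
      | cast i => simpa only [Fin.cons_succ, Fin.snoc_castSucc] using hf i

end Tuple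

theorem cornerPart_anti {n : ℕ} (X Y : Fin n → ℕ) : Antitone (cornerPart X Y) := by
  intro a b hab
  refine Finset.sup_mono fun i hi => ?_
  simp only [Finset.mem_filter, Finset.mem_univ, true_and] at hi ⊢
  exact hab.trans hi

theorem cornerPart_eq {n : ℕ} {X Y : Fin n → ℕ} (hX : Antitone X) {i : Fin n} {a : ℕ}
    (ha : a ≤ Y i) (hlt : ∀ j < i, Y j < a) : cornerPart X Y a = X i := by
  refine le_antisymm (Finset.sup_le fun j hj => hX ?_)
    (Finset.le_sup (f := X) (by simpa using ha))
  by_contra! h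
  have := hlt j h
  simp only [Finset.mem_filter, Finset.mem_univ, true_and] at hj
  omega

theorem cornerPart_succ_eq {n : ℕ} (X Y : Fin n → ℕ) {a : ℕ} (ha : ∀ i, Y i ≠ a) :
    cornerPart X Y (a + 1) = cornerPart X Y a := by
  unfold cornerPart
  congr 1
  ext i
  have := ha i
  simp only [Finset.mem_filter, Finset.mem_univ, true_and]
  omega

theorem exists_corner {n : ℕ} {Y : Fin n → ℕ} {a : ℕ} (ha : a < Finset.univ.sup Y) :
    ∃ i, a + 1 ≤ Y i ∧ ∀ j < i, Y j < a + 1 := by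
  obtain ⟨i, -, hi⟩ := Finset.lt_sup_iff.1 ha
  obtain ⟨i, hi, hmin⟩ := wellFounded_lt.has_min {i | a < Y i} ⟨i, hi⟩
  refine ⟨i, hi, fun j hj => ?_⟩
  by_contra! h
  exact hmin j h hj

theorem sup_eq_last {n : ℕ} {Y : Fin (n + 1) → ℕ} (hY : Monotone Y) :
    Finset.univ.sup Y = Y (Fin.last n) :=
  le_antisymm (Finset.sup_le fun i _ => hY (Fin.le_last i)) (Finset.le_sup (Finset.mem_univ _))

section Chain

variable {n r : ℕ} {I J : Fin r → Fin (n + 1)} {k : Fin (n + 1)}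

/-- The number of chain intervals `(I s, J s]` containing `a`. -/
def openCount (I J : Fin r → Fin (n + 1)) (a : Fin (n + 1)) : ℕ :=
  #{s | I s < a ∧ a ≤ J s}

/-- The number of chain intervals `[I s, J s]` containing `a`. -/
def closedCount (I J : Fin r → Fin (n + 1)) (a : Fin (n + 1)) : ℕ :=
  #{s | I s ≤ a ∧ a ≤ J s}

theorem card_fiber {f : Fin r → Fin (n + 1)} (hf : Function.Injective f) (i : Fin (n + 1)) :
    #{s | f s = i} = if ∃ s, f s = i then 1 else 0 := by
  split_ifs with h
  · obtain ⟨s, rfl⟩ := h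
    rw [Finset.card_eq_one]
    exact ⟨s, by ext s'; simp [hf.eq_iff]⟩
  · simpa [Finset.filter_eq_empty_iff] using h

theorem closedCount_eq (hI : Function.Injective I) (hk : ∀ s, I s ≤ k ∧ k ≤ J s)
    (i : Fin (n + 1)) :
    closedCount I J i = openCount I J i + if ∃ s, I s = i then 1 else 0 := by
  rw [← card_fiber hI, closedCount, openCount, ← Finset.card_union_of_disjoint]
  · congr 1
    ext s
    have := hk s
    simp only [Finset.mem_filter, Finset.mem_univ, true_and, Finset.mem_union, Fin.le_def,
      Fin.lt_def, Fin.ext_iff] at *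
    omega
  · rw [Finset.disjoint_left]
    intro s h1 h2
    simp only [Finset.mem_filter, Finset.mem_univ, true_and] at h1 h2
    exact h1.1.ne h2

theorem closedCount_castSucc (hJ : Function.Injective J) (hk : ∀ s, I s ≤ k ∧ k ≤ J s)
    (i : Fin n) : closedCount I J i.castSucc =
      openCount I J i.succ + if ∃ s, J s = i.castSucc then 1 else 0 := by
  rw [← card_fiber hJ, closedCount, openCount, ← Finset.card_union_of_disjoint]
  · congr 1
    ext s
    have := hk s
    simp only [Finset.mem_filter, Finset.mem_univ, true_and, Finset.mem_union, Fin.le_def,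
      Fin.lt_def, Fin.ext_iff, Fin.val_castSucc, Fin.val_succ] at *
    omega
  · rw [Finset.disjoint_left]
    intro s h1 h2
    simp only [Finset.mem_filter, Finset.mem_univ, true_and, Fin.le_def, Fin.lt_def, Fin.ext_iff,
      Fin.val_castSucc, Fin.val_succ] at h1 h2
    omega

theorem closedCount_last (hJ : Function.Injective J) :
    closedCount I J (Fin.last n) = if ∃ s, J s = Fin.last n then 1 else 0 := by
  rw [← card_fiber hJ, closedCount]
  congr 1
  ext s
  simp [Fin.le_last, Fin.last_le_iff]

theorem openCount_zero : openCount I J 0 = 0 := by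
  simp [openCount]

variable {x y : Fin (n + 1) → ℕ}

theorem piX_anti (hx : StrictAnti x) (hI : Function.Injective I) (hJ : Function.Injective J)
    (hk : ∀ s, I s ≤ k ∧ k ≤ J s) : Antitone (piX x I J) := by
  rw [Fin.antitone_iff_succ_le]
  intro i
  have h1 := closedCount_eq hI hk i.castSucc
  have h2 := closedCount_castSucc hJ hk i
  have h3 := hx (Fin.castSucc_lt_succ (i := i))
  change x _ + openCount I J _ ≤ x _ + openCount I J _
  split_ifs at h1 h2 <;> omega

theorem muX_anti (hx : StrictAnti x) (hI : Function.Injective I) (hJ : Function.Injective J)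
    (hk : ∀ s, I s ≤ k ∧ k ≤ J s) : Antitone (muX x I J) := by
  rw [Fin.antitone_iff_succ_le]
  intro i
  have h1 := closedCount_eq hI hk i.castSucc
  have h2 := closedCount_castSucc hJ hk i
  have h3 := hx (Fin.castSucc_lt_succ (i := i))
  change x _ - openCount I J _ ≤ x _ - openCount I J _
  split_ifs at h1 h2 <;> omega

theorem piY_mono (hy : StrictMono y) (hI : Function.Injective I) (hJ : Function.Injective J)
    (hk : ∀ s, I s ≤ k ∧ k ≤ J s) : Monotone (piY y I J) := by
  rw [Fin.monotone_iff_le_succ]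
  intro i
  have h1 := closedCount_eq hI hk i.succ
  have h2 := closedCount_castSucc hJ hk i
  have h3 := hy (Fin.castSucc_lt_succ (i := i))
  change y _ + closedCount I J _ ≤ y _ + closedCount I J _
  split_ifs at h1 h2 <;> omega

theorem closedCount_succ_le (hI : Function.Injective I) (hJ : Function.Injective J)
    (hk : ∀ s, I s ≤ k ∧ k ≤ J s) (i : Fin n) :
    closedCount I J i.succ ≤ closedCount I J i.castSucc + 1 := by
  have h1 := closedCount_eq hI hk i.succ
  have h2 := closedCount_castSucc hJ hk i
  split_ifs at h1 h2 <;> omega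

theorem muY_mono (hy : StrictMono y) (hI : Function.Injective I) (hJ : Function.Injective J)
    (hk : ∀ s, I s ≤ k ∧ k ≤ J s) : Monotone (muY y I J) := by
  rw [Fin.monotone_iff_le_succ]
  intro i
  have h1 := closedCount_succ_le hI hJ hk i
  have h3 := hy (Fin.castSucc_lt_succ (i := i))
  change y _ - closedCount I J _ ≤ y _ - closedCount I J _
  omega

theorem openCount_le (hx : StrictAnti x) (hx1 : ∀ a, 1 ≤ x a) (hI : Function.Injective I)
    (hJ : Function.Injective J) (hk : ∀ s, I s ≤ k ∧ k ≤ J s) (i : Fin (n + 1)) :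
    openCount I J i ≤ x i := by
  induction i using Fin.reverseInduction with
  | last =>
    have h1 := closedCount_eq hI hk (Fin.last n)
    have h2 := closedCount_last (I := I) hJ
    have := hx1 (Fin.last n)
    split_ifs at h1 h2 <;> omega
  | cast i ih =>
    have h1 := closedCount_eq hI hk i.castSucc
    have h2 := closedCount_castSucc hJ hk i
    have h3 := hx (Fin.castSucc_lt_succ (i := i))
    split_ifs at h1 h2 <;> omega

/-- The label at position `ω`: the sequences `i - λ_{i+1}` (odd positions) and `i - λ_i`
(even positions) merged into one weakly increasing sequence. -/
def cornerLab (x y : Fin (n + 1) → ℕ) (ω : ℕ) : ℤ :=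
  ((ω / 2 : ℕ) : ℤ) - cornerPart x y ((ω + 1) / 2)

theorem cornerLab_mono (x y : Fin (n + 1) → ℕ) : Monotone (cornerLab x y) := by
  intro a b hab
  have := cornerPart_anti x y (show (a + 1) / 2 ≤ (b + 1) / 2 by omega)
  unfold cornerLab
  omega

theorem cornerLab_even (x y : Fin (n + 1) → ℕ) (a : ℕ) :
    cornerLab x y (2 * a) = a - cornerPart x y a := by
  rw [cornerLab, show 2 * a / 2 = a by omega, show (2 * a + 1) / 2 = a by omega]

theorem cornerLab_odd (x y : Fin (n + 1) → ℕ) (a : ℕ) :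
    cornerLab x y (2 * a + 1) = a - cornerPart x y (a + 1) := by
  rw [cornerLab, show (2 * a + 1) / 2 = a by omega, show (2 * a + 1 + 1) / 2 = a + 1 by omega]

/-- All odd positions except those of the corners in `J`, together with the even positions of the
corners in `I`. -/
def cornerSet (y : Fin (n + 1) → ℕ) (M : ℕ) (I J : Finset (Fin (n + 1))) : Finset (Fin M) :=
  {ω | if (ω : ℕ) % 2 = 1 then ∀ j ∈ J, y j ≠ ω / 2 else ∃ i ∈ I, y i = ω / 2}

theorem exists_lab_pi (hx : StrictAnti x) (hy : StrictMono y) (hy1 : ∀ a, 1 ≤ y a)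
    (hI : Function.Injective I) (hJ : Function.Injective J) (hk : ∀ s, I s ≤ k ∧ k ≤ J s)
    {M : ℕ} (hM : 2 * y (Fin.last n) < M) {a : ℕ} (ha : a < Finset.univ.sup (piY y I J)) :
    ∃ ω ∈ cornerSet y M (Finset.univ.image I) (Finset.univ.image J),
      (ω : ℕ) ≠ 0 ∧ (ω : ℕ) ≠ 2 * y (Fin.last n) + 1 ∧
      cornerLab x y ω = a - cornerPart (piX x I J) (piY y I J) (a + 1) := by
  obtain ⟨i, hi, hlt⟩ := exists_corner ha
  rw [cornerPart_eq (piX_anti hx hI hJ hk) hi hlt]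
  change a + 1 ≤ y i + closedCount I J i at hi
  change ∀ j < i, y j + closedCount I J j < a + 1 at hlt
  change ∃ ω ∈ _, _ ∧ _ ∧ _ = (a : ℤ) - ((x i + openCount I J i : ℕ) : ℤ)
  rw [closedCount_eq hI hk] at hi
  have hym := hy.monotone (Fin.le_last i)
  obtain ⟨b, rfl, hb⟩ : ∃ b, a = b + openCount I J i ∧
      ∀ j < i, y j ≤ b ∧ ((∃ s, J s = j) → y j ≠ b) := by
    induction i using Fin.cases with
    | zero => exact ⟨a, by simp [openCount_zero], fun j hj => absurd hj (Fin.not_lt_zero j)⟩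
    | succ i =>
      have h1 := hlt i.castSucc Fin.castSucc_lt_succ
      rw [closedCount_castSucc hJ hk] at h1
      refine ⟨a - openCount I J i.succ, by omega, fun j hj => ?_⟩
      have h2 : j ≤ i.castSucc := Fin.le_castSucc_iff.2 hj
      have h3 := hy.monotone h2
      refine ⟨by omega, fun hJj h4 => ?_⟩
      have h5 : y j = y i.castSucc := by omega
      rw [hy.injective h5] at hJj
      rw [if_pos hJj] at h1
      omega
  by_cases hbi : b < y i
  · refine ⟨⟨2 * b + 1, by omega⟩, ?_, by simp, by simp; omega, ?_⟩
    · simp only [cornerSet, Finset.mem_filter, Finset.mem_univ, true_and]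
      rw [if_pos (by omega)]
      intro j hj hjb
      obtain ⟨s, -, rfl⟩ := Finset.mem_image.1 hj
      have h1 : y (J s) = b := by omega
      have h2 : J s < i := hy.lt_iff_lt.1 (by omega)
      exact (hb _ h2).2 ⟨s, rfl⟩ h1
    · simp only
      rw [cornerLab_odd, cornerPart_eq hx.antitone (i := i) (by omega)
        (fun j hj => by have := (hb j hj).1; omega)]
      push_cast
      ring
  · have hIi : ∃ s, I s = i := by
      by_contra h
      rw [if_neg h] at hi
      omega
    rw [if_pos hIi] at hi
    have hbe : b = y i := by omega
    subst hbe
    refine ⟨⟨2 * y i, by omega⟩, ?_, ?_, ?_, ?_⟩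
    · simp only [cornerSet, Finset.mem_filter, Finset.mem_univ, true_and]
      rw [if_neg (by omega)]
      obtain ⟨s, rfl⟩ := hIi
      exact ⟨I s, by simp, by omega⟩
    · have := hy1 i
      simp only; omega
    · simp only; omega
    · simp only
      rw [cornerLab_even, cornerPart_eq hx.antitone (i := i) le_rfl (fun j hj => hy hj)]
      push_cast
      ring

theorem exists_lab_mu (hx : StrictAnti x) (hx1 : ∀ a, 1 ≤ x a) (hy : StrictMono y)
    (hI : Function.Injective I) (hJ : Function.Injective J) (hk : ∀ s, I s ≤ k ∧ k ≤ J s)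
    {M : ℕ} (hM : 2 * y (Fin.last n) < M) {a : ℕ} (ha : a < Finset.univ.sup (muY y I J)) :
    ∃ ω ∈ (cornerSet y M (Finset.univ.image I) (Finset.univ.image J))ᶜ,
      (ω : ℕ) ≠ 0 ∧ (ω : ℕ) ≠ 2 * y (Fin.last n) + 1 ∧
      cornerLab x y ω = a + 1 - cornerPart (muX x I J) (muY y I J) (a + 1) := by
  obtain ⟨i, hi, hlt⟩ := exists_corner ha
  rw [cornerPart_eq (muX_anti hx hI hJ hk) hi hlt]
  change a + 1 ≤ y i - closedCount I J i at hi
  change ∀ j < i, y j - closedCount I J j < a + 1 at hlt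
  change ∃ ω ∈ _, _ ∧ _ ∧ _ = (a : ℤ) + 1 - ((x i - openCount I J i : ℕ) : ℤ)
  have hcx := openCount_le hx hx1 hI hJ hk i
  rw [closedCount_eq hI hk] at hi
  have hym := hy.monotone (Fin.le_last i)
  have hlow : (∀ j < i, y j ≤ a + openCount I J i) ∨
      ∃ s, J s < i ∧ y (J s) = a + openCount I J i + 1 ∧ ∀ j < i, j ≤ J s := by
    induction i using Fin.cases with
    | zero => exact Or.inl fun j hj => absurd hj (Fin.not_lt_zero j)
    | succ i =>
      have h1 := hlt i.castSucc Fin.castSucc_lt_succ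
      rw [closedCount_castSucc hJ hk] at h1
      by_cases h : y i.castSucc ≤ a + openCount I J i.succ
      · exact Or.inl fun j hj => (hy.monotone (Fin.le_castSucc_iff.2 hj)).trans h
      · right
        have hJi : ∃ s, J s = i.castSucc := by
          by_contra h'
          rw [if_neg h'] at h1
          omega
        rw [if_pos hJi] at h1
        obtain ⟨s, hs⟩ := hJi
        exact ⟨s, hs ▸ Fin.castSucc_lt_succ, by rw [hs]; omega,
          fun j hj => hs ▸ Fin.le_castSucc_iff.2 hj⟩
  rcases hlow with hlow | ⟨s, hsi, hs, hsj⟩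
  · refine ⟨⟨2 * (a + openCount I J i + 1), by omega⟩, ?_, by simp, by simp only; omega, ?_⟩
    · simp only [cornerSet, Finset.mem_compl, Finset.mem_filter, Finset.mem_univ, true_and]
      rw [if_neg (by omega)]
      rintro ⟨j, hj, hja⟩
      obtain ⟨s, -, rfl⟩ := Finset.mem_image.1 hj
      have h1 : y (I s) = a + openCount I J i + 1 := by omega
      have h2 : I s ≤ i := hy.le_iff_le.1 (by omega)
      rcases h2.lt_or_eq with h2 | h2
      · have := hlow _ h2
        omega
      · rw [if_pos ⟨s, h2⟩] at hi
        rw [h2] at h1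
        omega
    · simp only
      rw [cornerLab_even, cornerPart_eq hx.antitone (i := i) (by omega)
        (fun j hj => by have := hlow j hj; omega)]
      push_cast [hcx]
      ring
  · have h1 := hy hsi
    refine ⟨⟨2 * y (J s) + 1, by omega⟩, ?_, by simp, by simp only; omega, ?_⟩
    · simp only [cornerSet, Finset.mem_compl, Finset.mem_filter, Finset.mem_univ, true_and]
      rw [if_pos (by omega)]
      intro h
      exact h (J s) (by simp) (by omega)
    · simp only
      rw [cornerLab_odd, cornerPart_eq hx.antitone (i := i) (by omega)
        (fun j hj => by have := hy.monotone (hsj j hj); omega)]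
      push_cast [hcx, hs]
      ring

end Chain

theorem neg_one_pow_sum_val {R : Type*} [CommRing R] {N : ℕ} (A : Finset (Fin N)) :
    (-1 : R) ^ (∑ a ∈ A, (a : ℕ)) = (-1) ^ #(A.filter fun a : Fin N => (a : ℕ) % 2 = 1) := by
  rw [← Finset.prod_pow_eq_pow_sum, ← Finset.prod_const, Finset.prod_filter]
  refine Finset.prod_congr rfl fun a _ => ?_
  split_ifs with h
  · exact (Nat.odd_iff.2 h).neg_one_pow
  · exact (Nat.even_iff.2 (by omega)).neg_one_pow

section CornerSet

variable {n : ℕ} {x y : Fin (n + 1) → ℕ}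

theorem card_odd_cornerSet (hy : StrictMono y) (I J : Finset (Fin (n + 1))) :
    #((cornerSet y (y (Fin.last n) + 1 + (y (Fin.last n) + 1)) I J).filter
        fun ω : Fin _ => (ω : ℕ) % 2 = 1) +
      #J =
      y (Fin.last n) + 1 := by
  have hm : ∀ i, y i ≤ y (Fin.last n) := fun i => hy.monotone (Fin.le_last i)
  generalize y (Fin.last n) = m at hm ⊢
  have h1 : #(J.image fun j => (⟨y j, Nat.lt_succ_of_le (hm j)⟩ : Fin (m + 1))) = #J :=
    Finset.card_image_of_injective _ fun a b h => hy.injective (by simpa using h)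
  have h2 := Finset.card_add_card_compl
    (J.image fun j => (⟨y j, Nat.lt_succ_of_le (hm j)⟩ : Fin (m + 1)))
  rw [h1, Fintype.card_fin, add_comm] at h2
  rw [← h2]
  congr 1
  symm
  refine Finset.card_bij (fun i _ => ⟨2 * (i : ℕ) + 1, by omega⟩) ?_ ?_ ?_
  · intro i hi
    simp only [Finset.mem_compl, Finset.mem_image, not_exists, not_and, Fin.ext_iff] at hi
    simp only [cornerSet, Finset.mem_filter, Finset.mem_univ, true_and]
    rw [if_pos (by omega)]
    exact ⟨fun j hj h => hi j hj (by omega), by omega⟩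
  · intro i _ j _ h
    simp only [Fin.ext_iff] at h ⊢
    omega
  · intro ω hω
    simp only [cornerSet, Finset.mem_filter, Finset.mem_univ, true_and] at hω
    obtain ⟨h1, h2⟩ := hω
    rw [if_pos h2] at h1
    refine ⟨⟨ω / 2, by omega⟩, ?_, by ext; simp only; omega⟩
    simp only [Finset.mem_compl, Finset.mem_image, not_exists, not_and, Fin.ext_iff]
    exact h1

theorem card_even_cornerSet (hy : StrictMono y) (I J : Finset (Fin (n + 1))) :
    #((cornerSet y (y (Fin.last n) + 1 + (y (Fin.last n) + 1)) I J).filter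
      fun ω : Fin _ => ¬ (ω : ℕ) % 2 = 1) =
      #I := by
  have hm : ∀ i, y i ≤ y (Fin.last n) := fun i => hy.monotone (Fin.le_last i)
  generalize y (Fin.last n) = m at hm ⊢
  symm
  refine Finset.card_bij (fun i _ => ⟨2 * y i, by have := hm i; omega⟩) ?_ ?_ ?_
  · intro i hi
    simp only [cornerSet, Finset.mem_filter, Finset.mem_univ, true_and]
    rw [if_neg (by omega)]
    exact ⟨⟨i, hi, by omega⟩, by omega⟩
  · intro i _ j _ h
    simp only [Fin.ext_iff] at h
    exact hy.injective (by omega)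
  · intro ω hω
    simp only [cornerSet, Finset.mem_filter, Finset.mem_univ, true_and] at hω
    obtain ⟨h1, h2⟩ := hω
    rw [if_neg h2] at h1
    obtain ⟨i, hi, h⟩ := h1
    exact ⟨i, hi, by ext; simp only; omega⟩

theorem card_cornerSet (hy : StrictMono y) (I J : Finset (Fin (n + 1))) :
    #(cornerSet y (y (Fin.last n) + 1 + (y (Fin.last n) + 1)) I J) + #J =
      y (Fin.last n) + 1 + #I := by
  have h1 := card_odd_cornerSet hy I J
  have h2 := card_even_cornerSet hy I J
  rw [← Finset.card_filter_add_card_filter_not (fun ω : Fin _ => (ω : ℕ) % 2 = 1)]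
  omega

end CornerSet

section ChainTerm

variable {n r : ℕ} {I J : Fin r → Fin (n + 1)} {k : Fin (n + 1)} {x y : Fin (n + 1) → ℕ}

theorem sup_piY (hy : StrictMono y) (hI : Function.Injective I) (hJ : Function.Injective J)
    (hk : ∀ s, I s ≤ k ∧ k ≤ J s) : Finset.univ.sup (piY y I J) =
      y (Fin.last n) + if ∃ s, J s = Fin.last n then 1 else 0 := by
  rw [sup_eq_last (piY_mono hy hI hJ hk), ← closedCount_last (I := I) hJ]
  rfl

theorem sup_muY (hy : StrictMono y) (hI : Function.Injective I) (hJ : Function.Injective J)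
    (hk : ∀ s, I s ≤ k ∧ k ≤ J s) : Finset.univ.sup (muY y I J) =
      y (Fin.last n) - if ∃ s, J s = Fin.last n then 1 else 0 := by
  rw [sup_eq_last (muY_mono hy hI hJ hk), ← closedCount_last (I := I) hJ]
  rfl

theorem cornerPart_pi_one (hx : StrictAnti x) (hy1 : ∀ a, 1 ≤ y a) (hI : Function.Injective I)
    (hJ : Function.Injective J) (hk : ∀ s, I s ≤ k ∧ k ≤ J s) :
    cornerPart (piX x I J) (piY y I J) 1 = cornerPart x y 1 := by
  rw [cornerPart_eq hx.antitone (hy1 0) fun j hj => absurd hj (Fin.not_lt_zero j),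
    cornerPart_eq (piX_anti hx hI hJ hk) (i := 0) ((hy1 0).trans (Nat.le_add_right _ _))
      fun j hj => absurd hj (Fin.not_lt_zero j)]
  change x 0 + openCount I J 0 = x 0
  rw [openCount_zero, add_zero]

theorem sub_cornerPart_lt (X Y : Fin (n + 1) → ℕ) {a b : ℕ} (hab : a < b) :
    (a : ℤ) - (cornerPart X Y (a + 1) : ℤ) < b - (cornerPart X Y (b + 1) : ℤ) := by
  have := cornerPart_anti X Y (show a + 1 ≤ b + 1 by omega)
  omega

theorem chain_term {R : Type*} [CommRing R] (t : ℤ → ℤ → R) (hx : StrictAnti x)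
    (hx1 : ∀ a, 1 ≤ x a) (hy : StrictMono y) (hy1 : ∀ a, 1 ≤ y a) (hI : Function.Injective I)
    (hJ : Function.Injective J) (hk : ∀ s, I s ≤ k ∧ k ≤ J s) (u : ℤ) :
    (if ∃ s : Fin r, (J s : ℕ) = n + 1 - 1 then
        sShift t u (fun a : Fin (Finset.univ.sup (piY y I J)) =>
            (cornerPart (piX x I J) (piY y I J) ((a : ℕ) + 1) : ℤ)) *
          sShift t (u + (cornerPart x y 1 : ℤ) - (cornerPart (muX x I J) (muY y I J) 1 : ℤ))
            (fun a : Fin (Finset.univ.sup (muY y I J)) =>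
              (cornerPart (muX x I J) (muY y I J) ((a : ℕ) + 1) : ℤ))
      else
        sShift t (u - 1) (fun a : Fin (Finset.univ.sup (piY y I J)) =>
            (cornerPart (piX x I J) (piY y I J) ((a : ℕ) + 1) : ℤ)) *
          sShift t (u + (cornerPart x y 1 : ℤ) - (cornerPart (muX x I J) (muY y I J) 1 : ℤ) + 1)
            (fun a : Fin (Finset.univ.sup (muY y I J)) =>
              (cornerPart (muX x I J) (muY y I J) ((a : ℕ) + 1) : ℤ))) =
    rowMinor (labRow t (u + cornerPart x y 1 - y (Fin.last n)) (y (Fin.last n)) (cornerLab x y))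
        (cornerSet y _ (Finset.univ.image I) (Finset.univ.image J)) *
      rowMinor (labRow t (u + cornerPart x y 1 - y (Fin.last n)) (y (Fin.last n)) (cornerLab x y))
        (cornerSet y _ (Finset.univ.image I) (Finset.univ.image J))ᶜ := by
  have hA : #(cornerSet y (y (Fin.last n) + 1 + (y (Fin.last n) + 1)) (Finset.univ.image I)
      (Finset.univ.image J)) = y (Fin.last n) + 1 := by
    have := card_cornerSet hy (Finset.univ.image I) (Finset.univ.image J)
    rw [Finset.card_image_of_injective _ hI, Finset.card_image_of_injective _ hJ] at this
    omega
  have hA' := card_compl_of_half hA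
  have hm := hy1 (Fin.last n)
  have hsp := sup_piY hy hI hJ hk
  have hsm := sup_muY hy hI hJ hk
  have h1 := cornerPart_pi_one hx hy1 hI hJ hk
  have hzero : ∀ ω : Fin (y (Fin.last n) + 1 + (y (Fin.last n) + 1)), (ω : ℕ) = 0 →
      ω ∈ (cornerSet y _ (Finset.univ.image I) (Finset.univ.image J))ᶜ := by
    intro ω hω
    simp only [cornerSet, Finset.mem_compl, Finset.mem_filter, Finset.mem_univ, true_and]
    rw [if_neg (by omega)]
    rintro ⟨i, -, hi⟩
    have := hy1 i
    omega
  have hpi := fun a : Fin (Finset.univ.sup (piY y I J)) =>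
    exists_lab_pi hx hy hy1 hI hJ hk (M := y (Fin.last n) + 1 + (y (Fin.last n) + 1))
      (by omega) a.isLt
  have hmu := fun a : Fin (Finset.univ.sup (muY y I J)) =>
    exists_lab_mu hx hx1 hy hI hJ hk (M := y (Fin.last n) + 1 + (y (Fin.last n) + 1))
      (by omega) a.isLt
  have hlt : ∀ (X Y : Fin (n + 1) → ℕ) (p : ℕ) (i j : Fin p), i < j →
      ((i : ℕ) : ℤ) - (cornerPart X Y ((i : ℕ) + 1) : ℤ) <
        (j : ℕ) - (cornerPart X Y ((j : ℕ) + 1) : ℤ) :=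
    fun X Y p i j hij => sub_cornerPart_lt X Y hij
  have hiff : (∃ s : Fin r, (J s : ℕ) = n + 1 - 1) ↔ ∃ s, J s = Fin.last n := by
    simp [Fin.ext_iff]
  rw [if_congr hiff rfl rfl]
  split_ifs with hl
  · rw [if_pos hl] at hsp hsm
    congr 1
    · refine (rowMinor_eq_sShift t (cornerLab_mono x y) hA hsp _ u (hlt _ _ _) hpi fun h => ?_).symm
      simp only [zero_add, h1]
      omega
    · have hp : Finset.univ.sup (muY y I J) + 1 = y (Fin.last n) := by clear hl hiff; omega
      refine (rowMinor_eq_sShift_of_zero_of_last t (cornerLab_mono x y) hA' hzero ?_ hp _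
        (u + (cornerPart x y 1 : ℤ) - (cornerPart (muX x I J) (muY y I J) 1 : ℤ))
        (hlt _ _ _) hmu fun h => ?_).symm
      · intro ω hω
        obtain ⟨s, hs⟩ := hl
        simp only [cornerSet, Finset.mem_compl, Finset.mem_filter, Finset.mem_univ, true_and]
        rw [if_pos (by omega)]
        intro h
        exact h (Fin.last n) (by rw [← hs]; simp) (by omega)
      · simp only [zero_add]
        omega
  · rw [if_neg hl] at hsp hsm
    congr 1
    · refine (rowMinor_eq_sShift_of_last t (cornerLab_mono x y) hA ?_ hsp _ _ (hlt _ _ _) hpi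
        fun h => ?_).symm
      · intro ω hω
        simp only [cornerSet, Finset.mem_filter, Finset.mem_univ, true_and]
        rw [if_pos (by omega)]
        intro j hj hjω
        have : j = Fin.last n := hy.injective (by omega)
        subst this
        exact hl (by simpa using hj)
      · simp only [zero_add, h1]
        omega
    · refine (rowMinor_eq_sShift_of_zero t (cornerLab_mono x y) hA' hzero hsm _
        (u + (cornerPart x y 1 : ℤ) - (cornerPart (muX x I J) (muY y I J) 1 : ℤ) + 1)
        (hlt _ _ _) hmu fun h => ?_).symm
      simp only [zero_add]
      clear hl hiff
      omega

end ChainTerm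

theorem rowMinor_eq_zero {R : Type*} [CommRing R] {N : ℕ} (w : Fin (N + N) → Fin N → R)
    {A : Finset (Fin (N + N))} {a b : Fin (N + N)} (ha : a ∈ A) (hb : b ∈ A) (hab : a ≠ b)
    (hw : w a = w b) : rowMinor w A = 0 := by
  rw [rowMinor]
  split_ifs with h
  · have ha' : a ∈ Set.range (A.orderEmbOfFin h) := by rwa [Finset.range_orderEmbOfFin]
    have hb' : b ∈ Set.range (A.orderEmbOfFin h) := by rwa [Finset.range_orderEmbOfFin]
    obtain ⟨i, rfl⟩ := ha'
    obtain ⟨j, rfl⟩ := hb'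
    exact Matrix.det_zero_of_row_eq (fun hij => hab (by rw [hij])) hw
  · rfl

/-- The even positions `2, 4, …, 2 * l` and the odd positions from `2 * l + 1` on. -/
def switchSet (m l : ℕ) : Finset (Fin (m + 1 + (m + 1))) :=
  {ω | if (ω : ℕ) % 2 = 1 then l ≤ ω / 2 else 1 ≤ (ω : ℕ) / 2 ∧ (ω : ℕ) / 2 ≤ l}

theorem mem_switchSet {m l : ℕ} {ω : Fin (m + 1 + (m + 1))} : ω ∈ switchSet m l ↔
    if (ω : ℕ) % 2 = 1 then l ≤ ω / 2 else 1 ≤ (ω : ℕ) / 2 ∧ (ω : ℕ) / 2 ≤ l := by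
  simp [switchSet]

/-- The odd positions before `2 * l`. -/
def oddBelow (m l : ℕ) : Finset (Fin (m + 1 + (m + 1))) :=
  {ω | (ω : ℕ) % 2 = 1 ∧ (ω : ℕ) / 2 < l}

theorem mem_oddBelow {m l : ℕ} {ω : Fin (m + 1 + (m + 1))} : ω ∈ oddBelow m l ↔
    (ω : ℕ) % 2 = 1 ∧ (ω : ℕ) / 2 < l := by
  simp [oddBelow]

theorem disjoint_oddBelow_switchSet (m l : ℕ) : Disjoint (oddBelow m l) (switchSet m l) := by
  rw [Finset.disjoint_left]
  intro ω h1 h2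
  rw [mem_oddBelow] at h1
  rw [mem_switchSet, if_pos h1.1] at h2
  omega

theorem card_switchSet {m l : ℕ} (hl : l ≤ m) : #(switchSet m l) = m + 1 := by
  conv_rhs => rw [← Fintype.card_fin (m + 1), ← Finset.card_univ]
  symm
  refine Finset.card_bij (fun i _ =>
    ⟨if (i : ℕ) < l then 2 * (i : ℕ) + 2 else 2 * (i : ℕ) + 1, by split_ifs <;> omega⟩) ?_ ?_ ?_
  · intro i _
    rw [mem_switchSet]
    simp only
    split_ifs <;> omega
  · intro i _ j _ h
    simp only [Fin.ext_iff] at h ⊢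
    split_ifs at h <;> omega
  · intro ω hω
    rw [mem_switchSet] at hω
    split_ifs at hω with h
    · exact ⟨⟨ω / 2, by omega⟩, Finset.mem_univ _, by ext; simp only; split_ifs <;> omega⟩
    · exact ⟨⟨ω / 2 - 1, by omega⟩, Finset.mem_univ _, by ext; simp only; split_ifs <;> omega⟩

theorem card_oddBelow_add {m l : ℕ} :
    #(oddBelow m l) + #((switchSet m l).filter fun ω : Fin _ => (ω : ℕ) % 2 = 1) = m + 1 := by
  have h : #(Finset.univ.filter fun ω : Fin (m + 1 + (m + 1)) => (ω : ℕ) % 2 = 1) = m + 1 := by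
    conv_rhs => rw [← Fintype.card_fin (m + 1), ← Finset.card_univ]
    symm
    refine Finset.card_bij (fun i _ => ⟨2 * (i : ℕ) + 1, by omega⟩) ?_ ?_ ?_
    · intro i _
      simp only [Finset.mem_filter, Finset.mem_univ, true_and]
      omega
    · intro i _ j _ h
      simp only [Fin.ext_iff] at h ⊢
      omega
    · intro ω hω
      simp only [Finset.mem_filter, Finset.mem_univ, true_and] at hω
      exact ⟨⟨ω / 2, by omega⟩, Finset.mem_univ _, by ext; simp only; omega⟩
  rw [← Finset.card_union_of_disjoint
    (Finset.disjoint_of_subset_right (Finset.filter_subset _ _) (disjoint_oddBelow_switchSet m l))]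
  refine Eq.trans (congrArg Finset.card ?_) h
  ext ω
  simp only [Finset.mem_union, mem_oddBelow, Finset.mem_filter, mem_switchSet, Finset.mem_univ,
    true_and]
  split_ifs <;> omega

section Switch

variable {R : Type*} [CommRing R] (t : ℤ → ℤ → R) {n : ℕ} {x y : Fin (n + 1) → ℕ}

theorem rowMinor_switchSet (hx : StrictAnti x) (hx1 : ∀ a, 1 ≤ x a) (hy : StrictMono y)
    (hy1 : ∀ a, 1 ≤ y a) (k : Fin (n + 1)) (u : ℤ) :
    rowMinor (labRow t (u + cornerPart x y 1 - y (Fin.last n)) (y (Fin.last n)) (cornerLab x y))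
        (switchSet (y (Fin.last n)) (y k)) =
      sShift t u (fun a : Fin (Finset.univ.sup y) =>
        (cornerPart x y ((a : ℕ) + 1) : ℤ) - (if (a : ℕ) + 1 ≤ y k then 1 else 0)) := by
  have hsup := sup_eq_last hy.monotone
  have hyk := hy.monotone (Fin.le_last k)
  have hk1 := hy1 k
  have hdrop : cornerPart x y (y k + 1) < cornerPart x y (y k) := by
    rw [cornerPart_eq hx.antitone (i := k) le_rfl (fun j hj => hy hj), cornerPart,
      Finset.sup_lt_iff (hx1 k)]
    intro i hi
    simp only [Finset.mem_filter, Finset.mem_univ, true_and] at hi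
    exact hx (hy.lt_iff_lt.1 hi)
  refine rowMinor_eq_sShift_of_last t (cornerLab_mono x y) (card_switchSet hyk) ?_ hsup _ u
    ?_ ?_ ?_
  · intro ω hω
    rw [mem_switchSet, if_pos (by omega)]
    omega
  · intro i j hij
    have hij' : (i : ℕ) < j := hij
    have h1 := cornerPart_anti x y (show (i : ℕ) + 1 ≤ j + 1 by omega)
    split_ifs with h2 h3 h3
    · omega
    · have h4 := cornerPart_anti x y h2
      have h5 := cornerPart_anti x y (show y k + 1 ≤ (j : ℕ) + 1 by omega)
      omega
    · omega
    · omega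
  · intro i
    have hi : (i : ℕ) < y (Fin.last n) := hsup ▸ i.isLt
    by_cases h : (i : ℕ) + 1 ≤ y k
    · refine ⟨⟨2 * (i + 1), by omega⟩, ?_, by simp, by simp only; omega, ?_⟩
      · rw [mem_switchSet, if_neg (by simp only; omega)]
        simp only
        omega
      · simp only
        rw [cornerLab_even, if_pos h]
        push_cast
        ring
    · refine ⟨⟨2 * i + 1, by omega⟩, ?_, by simp, by simp only; omega, ?_⟩
      · rw [mem_switchSet, if_pos (by simp only; omega)]
        simp only
        omega
      · simp only
        rw [cornerLab_odd, if_neg h]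
        ring
  · intro h
    simp only [zero_add]
    rw [if_pos hk1]
    omega

theorem rowMinor_compl_switchSet (hy : StrictMono y)
    (hy1 : ∀ a, 1 ≤ y a) (k : Fin (n + 1)) (u : ℤ) :
    rowMinor (labRow t (u + cornerPart x y 1 - y (Fin.last n)) (y (Fin.last n)) (cornerLab x y))
        (switchSet (y (Fin.last n)) (y k))ᶜ =
      sShift t u (fun a : Fin (Finset.univ.sup y) =>
        (cornerPart x y ((a : ℕ) + 1) : ℤ) + (if (a : ℕ) + 1 ≤ y k then 1 else 0)) := by
  have hsup := sup_eq_last hy.monotone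
  have hyk := hy.monotone (Fin.le_last k)
  have hk1 := hy1 k
  refine rowMinor_eq_sShift_of_zero t (cornerLab_mono x y)
    (card_compl_of_half (card_switchSet hyk)) ?_ hsup _ u ?_ ?_ ?_
  · intro ω hω
    rw [Finset.mem_compl, mem_switchSet, if_neg (by omega)]
    omega
  · intro i j hij
    have hij' : (i : ℕ) < j := hij
    have h1 := cornerPart_anti x y (show (i : ℕ) + 1 ≤ j + 1 by omega)
    split_ifs <;> omega
  · intro i
    have hi : (i : ℕ) < y (Fin.last n) := hsup ▸ i.isLt
    by_cases h : (i : ℕ) + 1 ≤ y k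
    · refine ⟨⟨2 * i + 1, by omega⟩, ?_, by simp, by simp only; omega, ?_⟩
      · rw [Finset.mem_compl, mem_switchSet, if_pos (by simp only; omega)]
        simp only
        omega
      · simp only
        rw [cornerLab_odd, if_pos h]
        ring
    · refine ⟨⟨2 * (i + 1), by omega⟩, ?_, by simp, by simp only; omega, ?_⟩
      · rw [Finset.mem_compl, mem_switchSet, if_neg (by simp only; omega)]
        simp only
        omega
      · simp only
        rw [cornerLab_even, if_neg h]
        push_cast
        ring
  · intro h
    simp only [zero_add]
    rw [if_pos hk1]
    omega

theorem labRow_eq_labRow (c : ℤ) {m a : ℕ} (ha : a ≠ 0) (ham : a < m) (hay : ∀ i, y i ≠ a)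
    {ω ω' : Fin (m + 1 + (m + 1))} (hω : (ω : ℕ) = 2 * a) (hω' : (ω' : ℕ) = 2 * a + 1) :
    labRow t c m (cornerLab x y) ω = labRow t c m (cornerLab x y) ω' := by
  unfold labRow
  rw [if_neg (by omega), if_neg (by omega), if_neg (by omega), if_neg (by omega), hω, hω',
    cornerLab_even, cornerLab_odd, cornerPart_succ_eq x y hay]

end Switch

section ChainSum

variable {n : ℕ} {x y : Fin (n + 1) → ℕ}

theorem cornerSet_inj (hy : StrictMono y) {M : ℕ} (hM : 2 * y (Fin.last n) + 1 < M)
    {I J I' J' : Finset (Fin (n + 1))} (h : cornerSet y M I J = cornerSet y M I' J') :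
    I = I' ∧ J = J' := by
  have hm : ∀ i, y i ≤ y (Fin.last n) := fun i => hy.monotone (Fin.le_last i)
  simp only [Finset.ext_iff, cornerSet, Finset.mem_filter, Finset.mem_univ, true_and] at h
  constructor
  · ext i
    have h1 := h ⟨2 * y i, by have := hm i; omega⟩
    simp only [Nat.mul_mod_right, zero_ne_one, if_false,
      show 2 * y i / 2 = y i by omega, hy.injective.eq_iff, exists_eq_right] at h1
    exact h1
  · ext j
    have h1 := h ⟨2 * y j + 1, by have := hm j; omega⟩
    simp only [show (2 * y j + 1) % 2 = 1 by omega, if_true,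
      show (2 * y j + 1) / 2 = y j by omega, hy.injective.ne_iff] at h1
    constructor
    · intro hj
      by_contra hj'
      exact h1.2 (fun a ha haj => hj' (haj ▸ ha)) j hj rfl
    · intro hj
      by_contra hj'
      exact h1.1 (fun a ha haj => hj' (haj ▸ ha)) j hj rfl

/-- Chains of `r` nested intervals around `k`. -/
abbrev NestedChain (k : Fin (n + 1)) (r : ℕ) : Type :=
  {c : (Fin r → Fin (n + 1)) × (Fin r → Fin (n + 1)) //
    (∀ a b : Fin r, a < b → c.1 a < c.1 b) ∧
    (∀ a b : Fin r, a < b → c.2 b < c.2 a) ∧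
    (∀ s : Fin r, c.1 s ≤ k ∧ k ≤ c.2 s)}

/-- The set of positions attached to a chain. -/
def chainSet (y : Fin (n + 1) → ℕ) {k : Fin (n + 1)} (c : Σ r, NestedChain k r) :
    Finset (Fin (y (Fin.last n) + 1 + (y (Fin.last n) + 1))) :=
  cornerSet y _ (Finset.univ.image c.2.1.1) (Finset.univ.image c.2.1.2)

theorem NestedChain.injective_fst {k : Fin (n + 1)} {r : ℕ} (c : NestedChain k r) :
    Function.Injective c.1.1 :=
  StrictMono.injective fun a b => c.2.1 a b

theorem NestedChain.injective_snd {k : Fin (n + 1)} {r : ℕ} (c : NestedChain k r) :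
    Function.Injective c.1.2 :=
  StrictAnti.injective fun a b => c.2.2.1 a b

theorem chainSet_injective (hy : StrictMono y) {k : Fin (n + 1)} :
    Function.Injective (chainSet y (k := k)) := by
  rintro ⟨r, c⟩ ⟨r', c'⟩ h
  obtain ⟨h1, h2⟩ := cornerSet_inj hy (by omega) h
  simp only at h1 h2
  have h3 := congrArg Finset.card h1
  rw [Finset.card_image_of_injective _ c.injective_fst,
    Finset.card_image_of_injective _ c'.injective_fst, Finset.card_fin, Finset.card_fin] at h3
  subst h3
  congr 1
  have hr : ∀ f g : Fin r → Fin (n + 1), Finset.univ.image f = Finset.univ.image g →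
      Set.range f = Set.range g := by
    intro f g hfg
    have := congrArg (fun s : Finset (Fin (n + 1)) => (s : Set (Fin (n + 1)))) hfg
    simpa using this
  refine Subtype.ext (Prod.ext ?_ ?_)
  · exact (StrictMono.range_inj (fun a b => c.2.1 a b) fun a b => c'.2.1 a b).1 (hr _ _ h1)
  · have h4 := (StrictMono.range_inj (f := OrderDual.toDual ∘ c.1.2)
      (g := OrderDual.toDual ∘ c'.1.2) (fun a b => c.2.2.1 a b) fun a b => c'.2.2.1 a b).1 (by
        rw [Set.range_comp, Set.range_comp, hr _ _ h2])
    exact funext fun a => congrFun h4 a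

theorem exists_chainSet_eq (k : Fin (n + 1)) {I J : Finset (Fin (n + 1))}
    (hIJ : #I = #J) (hI : ∀ i ∈ I, i ≤ k) (hJ : ∀ j ∈ J, k ≤ j) :
    ∃ c : Σ r, NestedChain k r, c.1 ∈ Finset.range (n + 2) ∧
      chainSet y c = cornerSet y _ I J := by
  refine ⟨⟨#I, ⟨(I.orderEmbOfFin rfl, fun s => J.orderEmbOfFin hIJ.symm s.rev),
    fun a b hab => (I.orderEmbOfFin rfl).lt_iff_lt.2 hab,
    fun a b hab => (J.orderEmbOfFin _).lt_iff_lt.2 (Fin.rev_lt_rev.2 hab),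
    fun s => ⟨hI _ (I.orderEmbOfFin_mem rfl s), hJ _ (J.orderEmbOfFin_mem _ _)⟩⟩⟩, ?_, ?_⟩
  · have := Finset.card_le_univ I
    rw [Fintype.card_fin] at this
    simp only [Finset.mem_range]
    omega
  · unfold chainSet
    congr 1
    · simp
    · rw [← Finset.coe_inj]
      simp only [Finset.coe_image, Finset.coe_univ, Set.image_univ]
      rw [← Finset.range_orderEmbOfFin J hIJ.symm]
      exact Fin.rev_surjective.range_comp (J.orderEmbOfFin hIJ.symm)

theorem oddBelow_subset_chainSet (hy : StrictMono y) {k : Fin (n + 1)}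
    (c : Σ r, NestedChain k r) : oddBelow (y (Fin.last n)) (y k) ⊆ chainSet y c := by
  intro ω hω
  rw [mem_oddBelow] at hω
  simp only [chainSet, cornerSet, Finset.mem_filter, Finset.mem_univ, true_and]
  rw [if_pos hω.1]
  intro j hj hjω
  obtain ⟨s, -, rfl⟩ := Finset.mem_image.1 hj
  have := hy.monotone (c.2.2.2.2 s).2
  omega

theorem chainSet_sdiff_subset (hy : StrictMono y) (hy1 : ∀ a, 1 ≤ y a) {k : Fin (n + 1)}
    (c : Σ r, NestedChain k r) :
    chainSet y c \ oddBelow (y (Fin.last n)) (y k) ⊆ switchSet (y (Fin.last n)) (y k) := by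
  intro ω hω
  rw [Finset.mem_sdiff, mem_oddBelow] at hω
  simp only [chainSet, cornerSet, Finset.mem_filter, Finset.mem_univ, true_and] at hω
  rw [mem_switchSet]
  obtain ⟨h1, h2⟩ := hω
  split_ifs with h
  · omega
  · rw [if_neg h] at h1
    obtain ⟨i, hi, hiω⟩ := h1
    obtain ⟨s, -, rfl⟩ := Finset.mem_image.1 hi
    have := hy.monotone (c.2.2.2.2 s).1
    have := hy1 (c.2.1.1 s)
    omega

theorem exists_chain_of_rowMinor_ne_zero {R : Type*} [CommRing R] (t : ℤ → ℤ → R) (d : ℤ)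
    (hy : StrictMono y) (hy1 : ∀ a, 1 ≤ y a) (k : Fin (n + 1))
    {A : Finset (Fin (y (Fin.last n) + 1 + (y (Fin.last n) + 1)))}
    (hA : rowMinor (labRow t d (y (Fin.last n)) (cornerLab x y)) A ≠ 0)
    (hA' : rowMinor (labRow t d (y (Fin.last n)) (cornerLab x y)) Aᶜ ≠ 0)
    (hL : oddBelow (y (Fin.last n)) (y k) ⊆ A)
    (hF : A ⊆ oddBelow (y (Fin.last n)) (y k) ∪ switchSet (y (Fin.last n)) (y k)) :
    ∃ c : Σ r, NestedChain k r, c.1 ∈ Finset.range (n + 2) ∧ chainSet y c = A := by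
  have hm : ∀ i, y i ≤ y (Fin.last n) := fun i => hy.monotone (Fin.le_last i)
  have hk1 := hy1 k
  have hcard : #A = y (Fin.last n) + 1 := by
    by_contra h
    exact hA (by rw [rowMinor, dif_neg h])
  have hF' : ∀ ω ∈ A, ((ω : ℕ) % 2 = 1 ∧ (ω : ℕ) / 2 < y k) ∨
      (if (ω : ℕ) % 2 = 1 then y k ≤ ω / 2 else 1 ≤ (ω : ℕ) / 2 ∧ (ω : ℕ) / 2 ≤ y k) := by
    intro ω hω
    have := hF hω
    rwa [Finset.mem_union, mem_oddBelow, mem_switchSet] at this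
  have hL' : ∀ ω : Fin _, (ω : ℕ) % 2 = 1 → (ω : ℕ) / 2 < y k → ω ∈ A :=
    fun ω h1 h2 => hL (mem_oddBelow.2 ⟨h1, h2⟩)
  let I : Finset (Fin (n + 1)) :=
    Finset.univ.filter fun i => ⟨2 * y i, by have := hm i; omega⟩ ∈ A
  let J : Finset (Fin (n + 1)) :=
    Finset.univ.filter fun j => ⟨2 * y j + 1, by have := hm j; omega⟩ ∉ A
  have hIJ : cornerSet y _ I J = A := by
    ext ω
    simp only [cornerSet, Finset.mem_filter, Finset.mem_univ, true_and, I, J]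
    split_ifs with h
    · constructor
      · intro hj
        by_contra hω
        have hge : y k ≤ (ω : ℕ) / 2 := by
          by_contra! h'
          exact hω (hL' ω h h')
        have hne : ∀ i, y i ≠ (ω : ℕ) / 2 := by
          intro i hi
          refine hj i ?_ hi
          convert hω
          omega
        have h1 := hne (Fin.last n)
        have h2 := hne k
        have hω' : (⟨2 * ((ω : ℕ) / 2), by omega⟩ : Fin _) ∉ A := by
          intro h3
          have h4 := hF' _ h3
          simp only [Nat.mul_mod_right, zero_ne_one, if_false, false_and, false_or] at h4
          omega
        exact hA' (rowMinor_eq_zero _ (Finset.mem_compl.2 hω') (Finset.mem_compl.2 hω)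
          (by rw [Ne, Fin.ext_iff]; simp only; omega)
          (labRow_eq_labRow t d (by omega) (by omega) hne rfl (by omega)))
      · intro hω j hj hjω
        apply hj
        convert hω
        omega
    · constructor
      · rintro ⟨i, hi, hiω⟩
        convert hi
        omega
      · intro hω
        by_contra! hne
        have hne : ∀ i, y i ≠ (ω : ℕ) / 2 := by
          intro i hi
          refine hne i ?_ hi
          convert hω
          omega
        have h1 := hne k
        have h2 := hF' ω hω
        rw [if_neg h] at h2
        have h3 := hm k
        have hω' : (⟨2 * ((ω : ℕ) / 2) + 1, by omega⟩ : Fin _) ∈ A :=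
          hL' _ (by simp only; omega) (by simp only; omega)
        exact hA (rowMinor_eq_zero _ hω hω'
          (by rw [Ne, Fin.ext_iff]; simp only; omega)
          (labRow_eq_labRow t d (by omega) (by omega) hne (by omega) rfl))
  have hcIJ : #I = #J := by
    have := card_cornerSet hy I J
    rw [hIJ] at this
    omega
  obtain ⟨c, hc, h⟩ := exists_chainSet_eq k hcIJ
    (fun i hi => by
      have h1 := hF' _ (Finset.mem_filter.1 hi).2
      simp only [Nat.mul_mod_right, zero_ne_one, if_false, false_and, false_or] at h1
      exact hy.le_iff_le.1 (by omega))
    (fun j hj => by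
      by_contra! h
      have h1 := hy h
      exact (Finset.mem_filter.1 hj).2 (hL' _ (by simp only; omega) (by simp only; omega)))
  exact ⟨c, hc, h.trans hIJ⟩

theorem sum_nestedChain {R : Type*} [CommRing R] (t : ℤ → ℤ → R) (d : ℤ)
    (hy : StrictMono y) (hy1 : ∀ a, 1 ≤ y a) (k : Fin (n + 1)) :
    ∑ r ∈ Finset.range (n + 2), ∑ c : NestedChain k r, (-1 : R) ^ r *
      (rowMinor (labRow t d (y (Fin.last n)) (cornerLab x y)) (chainSet y ⟨r, c⟩) *
        rowMinor (labRow t d (y (Fin.last n)) (cornerLab x y)) (chainSet y ⟨r, c⟩)ᶜ) =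
    rowMinor (labRow t d (y (Fin.last n)) (cornerLab x y)) (switchSet (y (Fin.last n)) (y k)) *
      rowMinor (labRow t d (y (Fin.last n)) (cornerLab x y))
        (switchSet (y (Fin.last n)) (y k))ᶜ := by
  set w := labRow t d (y (Fin.last n)) (cornerLab x y)
  set L := oddBelow (y (Fin.last n)) (y k) with hLdef
  have key := sum_rowMinor w _ _ (disjoint_oddBelow_switchSet (y (Fin.last n)) (y k))
    (card_switchSet (hy.monotone (Fin.le_last k)))
  rw [← hLdef] at key
  rw [← mul_assoc, neg_one_pow_sum_val (switchSet _ _), ← pow_add, card_oddBelow_add] at key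
  have hs : ∀ a : ℕ, (-1 : R) ^ a * (-1) ^ a = 1 := fun a => by rw [← mul_pow]; simp
  have key2 := congrArg ((-1 : R) ^ (y (Fin.last n) + 1) * ·) key
  simp only [← mul_assoc, hs, one_mul] at key2
  rw [← key2, Finset.mul_sum, Finset.sum_sigma']
  have hun : ∀ c : Σ r, NestedChain k r, L ∪ chainSet y c \ L = chainSet y c := fun c =>
    Finset.union_sdiff_of_subset (oddBelow_subset_chainSet hy c)
  refine Finset.sum_of_injOn (fun c => chainSet y c \ L) ?_ ?_ ?_ ?_
  · intro c _ c' _ h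
    refine chainSet_injective hy ?_
    rw [← hun c, ← hun c']
    exact congrArg (L ∪ ·) h
  · intro c _
    exact Finset.mem_coe.2 (Finset.mem_powerset.2 (chainSet_sdiff_subset hy hy1 c))
  · intro s hs hne
    rw [Finset.mem_powerset] at hs
    by_contra h0
    have h1 : rowMinor w (L ∪ s) ≠ 0 := fun h => h0 (by simp [h])
    have h2 : rowMinor w (L ∪ s)ᶜ ≠ 0 := fun h => h0 (by rw [h, mul_zero, mul_zero])
    obtain ⟨c, hc, h⟩ := exists_chain_of_rowMinor_ne_zero t d hy hy1 k h1 h2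
      Finset.subset_union_left (Finset.union_subset_union_right hs)
    refine hne ⟨c, by simpa using hc, ?_⟩
    simp only [h]
    exact Finset.union_sdiff_cancel_left
      (Finset.disjoint_of_subset_right hs (disjoint_oddBelow_switchSet _ _))
  · rintro ⟨r, c⟩ _
    simp only [hun]
    have h1 := card_odd_cornerSet hy (Finset.univ.image c.1.1) (Finset.univ.image c.1.2)
    rw [Finset.card_image_of_injective _ c.injective_snd, Finset.card_fin] at h1
    change #((chainSet y ⟨r, c⟩).filter fun ω : Fin _ => (ω : ℕ) % 2 = 1) + r = _ at h1
    rw [neg_one_pow_sum_val]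
    generalize #((chainSet y ⟨r, c⟩).filter fun ω : Fin _ => (ω : ℕ) % 2 = 1) = q at h1 ⊢
    have e : (-1 : R) ^ r = (-1) ^ (y (Fin.last n) + 1) * (-1) ^ q := by
      rw [← h1, pow_add, mul_right_comm, hs, one_mul]
    rw [e]
    ring

end ChainSum
end QuantumHirota

/-- **Quantum main theorem.**  Let `λ` be the partition with corner coordinates
`(x_1,y_1),…,(x_n,y_n)`; it has `m = y_n` (`= Finset.univ.sup y`) positive parts.
Pick the `k`-th corner (`k : Fin n`, 0-indexed) and set `ℓ := y k`.  Then for all `u`,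
`s_λ^{(u−1)} s_λ^{(u+1)} = s_{λ+ω_ℓ}^{(u)} s_{λ−ω_ℓ}^{(u)} + Σ (−1)^{r−1} c`,
summed over all chains of nested intervals `i_1 < ⋯ < i_r ≤ k ≤ j_r < ⋯ < j_1`,
where, with `α = π^{i_1⋯i_r}_{j_1⋯j_r}(λ)` and `β = μ^{i_1⋯i_r}_{j_1⋯j_r}(λ)`
written as tuples with number of entries equal to the last `y`-value of the new
corner coordinates, `c = s_α^{(u)} s_β^{(u+λ_1−β_1)}` if `j_1 = n` and
`c = s_α^{(u−1)} s_β^{(u+λ_1−β_1+1)}` if `j_1 < n` (since the `j`'s are strictly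
decreasing, `j_1 = n` iff some `j_s = n`). -/
theorem quantum_hirota_general {R : Type*} [CommRing R] (t : ℤ → ℤ → R)
    (n : ℕ) (x y : Fin n → ℕ)
    (hx : ∀ a b : Fin n, a < b → x b < x a) (hx1 : ∀ a, 1 ≤ x a)
    (hy : ∀ a b : Fin n, a < b → y a < y b) (hy1 : ∀ a, 1 ≤ y a)
    (k : Fin n) (u : ℤ) :
    sShift t (u - 1)
        (fun a : Fin (Finset.univ.sup y) => (cornerPart x y ((a : ℕ) + 1) : ℤ)) *
      sShift t (u + 1)
        (fun a : Fin (Finset.univ.sup y) => (cornerPart x y ((a : ℕ) + 1) : ℤ)) =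
    sShift t u
        (fun a : Fin (Finset.univ.sup y) =>
          (cornerPart x y ((a : ℕ) + 1) : ℤ) + (if (a : ℕ) + 1 ≤ y k then 1 else 0)) *
      sShift t u
        (fun a : Fin (Finset.univ.sup y) =>
          (cornerPart x y ((a : ℕ) + 1) : ℤ) - (if (a : ℕ) + 1 ≤ y k then 1 else 0))
    + ∑ r ∈ Finset.Icc 1 n,
        ∑ c : {c : (Fin r → Fin n) × (Fin r → Fin n) //
            (∀ a b : Fin r, a < b → c.1 a < c.1 b) ∧
            (∀ a b : Fin r, a < b → c.2 b < c.2 a) ∧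
            (∀ s : Fin r, c.1 s ≤ k ∧ k ≤ c.2 s)},
          (-1 : R) ^ (r - 1) *
            (if ∃ s : Fin r, (c.1.2 s : ℕ) = n - 1 then
              sShift t u
                  (fun a : Fin (Finset.univ.sup (piY y c.1.1 c.1.2)) =>
                    (cornerPart (piX x c.1.1 c.1.2) (piY y c.1.1 c.1.2)
                      ((a : ℕ) + 1) : ℤ)) *
                sShift t
                  (u + (cornerPart x y 1 : ℤ) -
                    (cornerPart (muX x c.1.1 c.1.2) (muY y c.1.1 c.1.2) 1 : ℤ))
                  (fun a : Fin (Finset.univ.sup (muY y c.1.1 c.1.2)) =>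
                    (cornerPart (muX x c.1.1 c.1.2) (muY y c.1.1 c.1.2)
                      ((a : ℕ) + 1) : ℤ))
            else
              sShift t (u - 1)
                  (fun a : Fin (Finset.univ.sup (piY y c.1.1 c.1.2)) =>
                    (cornerPart (piX x c.1.1 c.1.2) (piY y c.1.1 c.1.2)
                      ((a : ℕ) + 1) : ℤ)) *
                sShift t
                  (u + (cornerPart x y 1 : ℤ) -
                    (cornerPart (muX x c.1.1 c.1.2) (muY y c.1.1 c.1.2) 1 : ℤ) + 1)
                  (fun a : Fin (Finset.univ.sup (muY y c.1.1 c.1.2)) =>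
                    (cornerPart (muX x c.1.1 c.1.2) (muY y c.1.1 c.1.2)
                      ((a : ℕ) + 1) : ℤ))) := by
  obtain _ | n := n
  · exact k.elim0
  have hx' : StrictAnti x := fun a b => hx a b
  have hy' : StrictMono y := fun a b => hy a b
  have hsum := QuantumHirota.sum_nestedChain (x := x) t
    (u + cornerPart x y 1 - y (Fin.last n)) hy' hy1 k
  rw [QuantumHirota.rowMinor_switchSet t hx' hx1 hy' hy1,
    QuantumHirota.rowMinor_compl_switchSet t hy' hy1] at hsum
  have hterm := fun (r : ℕ) (c : QuantumHirota.NestedChain k r) =>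
    QuantumHirota.chain_term t hx' hx1 hy' hy1 c.injective_fst c.injective_snd c.2.2.2 u
  have hIcc : ∀ f : ℕ → R, ∑ r ∈ Finset.Icc 1 (n + 1), f r =
      ∑ r ∈ Finset.range (n + 1), f (r + 1) := by
    intro f
    rw [Finset.range_eq_Ico, Finset.sum_Ico_add' f 0 (n + 1) 1]
    rfl
  have hempty : Fintype.card (QuantumHirota.NestedChain k 0) = 1 :=
    Fintype.card_eq_one_iff.2 ⟨⟨(Fin.elim0, Fin.elim0), by simp⟩,
      fun c => Subtype.ext (Subsingleton.elim _ _)⟩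
  have hpiX : ∀ I J : Fin 0 → Fin (n + 1), piX x I J = x := fun I J => by funext a; simp [piX]
  have hpiY : ∀ I J : Fin 0 → Fin (n + 1), piY y I J = y := fun I J => by funext a; simp [piY]
  have hmuX : ∀ I J : Fin 0 → Fin (n + 1), muX x I J = x := fun I J => by funext a; simp [muX]
  have hmuY : ∀ I J : Fin 0 → Fin (n + 1), muY y I J = y := fun I J => by funext a; simp [muY]
  have hzero : ∑ c : QuantumHirota.NestedChain k 0, (-1 : R) ^ 0 *
      (QuantumHirota.rowMinor (QuantumHirota.labRow t (u + cornerPart x y 1 - y (Fin.last n))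
          (y (Fin.last n)) (QuantumHirota.cornerLab x y)) (QuantumHirota.chainSet y ⟨0, c⟩) *
        QuantumHirota.rowMinor (QuantumHirota.labRow t (u + cornerPart x y 1 - y (Fin.last n))
          (y (Fin.last n)) (QuantumHirota.cornerLab x y)) (QuantumHirota.chainSet y ⟨0, c⟩)ᶜ) =
      sShift t (u - 1) (fun a : Fin (Finset.univ.sup y) => (cornerPart x y ((a : ℕ) + 1) : ℤ)) *
      sShift t (u + 1)
        (fun a : Fin (Finset.univ.sup y) => (cornerPart x y ((a : ℕ) + 1) : ℤ)) := by
    refine (Finset.sum_congr rfl fun c _ => ?_).trans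
      (by rw [Finset.sum_const, Finset.card_univ, hempty, one_smul])
    rw [pow_zero, one_mul]
    refine (hterm 0 c).symm.trans ?_
    rw [if_neg (by simp), hpiX, hpiY, hmuX, hmuY, add_sub_cancel_right]
  rw [Finset.sum_range_succ', hzero] at hsum
  simp only [QuantumHirota.chainSet, ← hterm, pow_succ, mul_neg, mul_one, neg_mul,
    Finset.sum_neg_distrib] at hsum
  rw [mul_comm (sShift t u _), hIcc]
  simp only [Nat.add_sub_cancel] at hsum ⊢
  linear_combination hsum
end

section
/- Let R be a commutative ring and h : ℤ → R a function satisfying h(0) = 1 and h(k) = 0 for all k < 0, and define Schur functions by the Jacobi–Trudi determinant. Then for all integers m ≥ 1 and ℓ ≥ 1, s_{(m^ℓ)} · s_{(m^ℓ)} = s_{((m+1)^ℓ)} · s_{((m−1)^ℓ)} + s_{(m^{ℓ+1})} · s_{(m^{ℓ−1})}, where (a^b) denotes the rectangular partition with b parts each equal to a, and the Schur function of the empty partition (arising when m = 1 or ℓ = 1) equals 1. -/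
/-- The Jacobi–Trudi determinant: for a tuple `lam = (λ_1, …, λ_p)` (weakly decreasing
in the intended applications), `jtSchur h lam = det (h (λ_i − i + j))_{i,j=1}^p`.
Here rows/columns are 0-indexed, which gives the same matrix. For `p = 0` (the empty
partition) the determinant is `1`. -/
noncomputable def jtSchur {R : Type*} [CommRing R] (h : ℤ → R) {p : ℕ}
    (lam : Fin p → ℤ) : R :=
  Matrix.det (Matrix.of fun i j : Fin p => h (lam i - (i : ℕ) + (j : ℕ)))

open Matrix in
/-- Jacobi's complementary minor identity, multiplied by the determinant. -/
theorem Matrix.det_mul_det_toBlocks₁₁_adjugate {R m n : Type*} [CommRing R] [Fintype m]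
    [Fintype n] [DecidableEq m] [DecidableEq n] (M : Matrix (m ⊕ n) (m ⊕ n) R) :
    M.det * M.adjugate.toBlocks₁₁.det = M.det ^ Fintype.card m * M.toBlocks₂₂.det := by
  have hM : M * fromBlocks M.adjugate.toBlocks₁₁ 0 M.adjugate.toBlocks₂₁ 1 =
      fromBlocks (M.det • 1) M.toBlocks₁₂ 0 M.toBlocks₂₂ := by
    have h : fromBlocks M.toBlocks₁₁ M.toBlocks₁₂ M.toBlocks₂₁ M.toBlocks₂₂ *
        fromBlocks M.adjugate.toBlocks₁₁ M.adjugate.toBlocks₁₂ M.adjugate.toBlocks₂₁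
          M.adjugate.toBlocks₂₂ = M.det • fromBlocks 1 0 0 1 := by
      rw [fromBlocks_toBlocks, fromBlocks_toBlocks, fromBlocks_one, mul_adjugate]
    rw [fromBlocks_multiply, fromBlocks_smul, fromBlocks_inj] at h
    conv_lhs => rw [← fromBlocks_toBlocks M]
    rw [fromBlocks_multiply]
    simp only [fromBlocks_toBlocks, h.1, h.2.2.1, smul_zero, Matrix.mul_zero, Matrix.mul_one, zero_add]
  simpa [det_mul, det_fromBlocks_zero₁₂, det_fromBlocks_zero₂₁] using congrArg det hM

/-- The middle indices of `Fin (k + 2)`, preceded by its two endpoints. -/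
noncomputable def finEndpointsSumEquiv (k : ℕ) : Fin 2 ⊕ Fin k ≃ Fin (k + 2) :=
  Equiv.ofBijective (Sum.elim ![0, Fin.last (k + 1)] fun j => j.castSucc.succ) <| by
    rw [Fintype.bijective_iff_injective_and_card]
    refine ⟨?_, by simp [add_comm]⟩
    rintro (a | a) (b | b) hab
    · fin_cases a <;> fin_cases b <;> simp_all [Fin.ext_iff]
    · fin_cases a <;> simp [Fin.ext_iff] at hab; omega
    · fin_cases b <;> simp [Fin.ext_iff] at hab; omega
    · simpa [Fin.ext_iff] using hab

/-- The Desnanot–Jacobi identity, multiplied by the determinant. -/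
theorem Matrix.det_mul_desnanot_jacobi {R : Type*} [CommRing R] {k : ℕ}
    (A : Matrix (Fin (k + 2)) (Fin (k + 2)) R) :
    A.det * ((A.submatrix Fin.succ Fin.succ).det * (A.submatrix Fin.castSucc Fin.castSucc).det -
      (A.submatrix Fin.succ Fin.castSucc).det * (A.submatrix Fin.castSucc Fin.succ).det) =
    A.det * (A.det * (A.submatrix (fun i : Fin k => i.castSucc.succ)
      fun i : Fin k => i.castSucc.succ).det) := by
  have h := det_mul_det_toBlocks₁₁_adjugate
    (A.submatrix (finEndpointsSumEquiv k) (finEndpointsSumEquiv k))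
  have h0 : finEndpointsSumEquiv k (Sum.inl 0) = 0 := rfl
  have h1 : finEndpointsSumEquiv k (Sum.inl 1) = Fin.last (k + 1) := rfl
  have h22 : (A.submatrix (finEndpointsSumEquiv k) (finEndpointsSumEquiv k)).toBlocks₂₂ =
      A.submatrix (fun i : Fin k => i.castSucc.succ) fun i : Fin k => i.castSucc.succ := rfl
  have hs : (-1 : R) ^ (k + 1) * (-1) ^ (k + 1) = 1 := by
    rw [← mul_pow]; simp
  rw [h22, det_submatrix_equiv_self, adjugate_submatrix_equiv_self, det_fin_two] at h
  simp only [toBlocks₁₁, of_apply, submatrix_apply, h0, h1, adjugate_fin_succ_eq_det_submatrix,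
    Fin.succAbove_zero, Fin.succAbove_last, Fin.val_zero, Fin.val_last, Fintype.card_fin,
    add_zero, zero_add, pow_zero, pow_add (-1 : R) (k + 1) (k + 1), hs, one_mul] at h
  linear_combination h + A.det * (A.submatrix Fin.succ Fin.castSucc).det *
    (A.submatrix Fin.castSucc Fin.succ).det * hs

open Polynomial in
/-- The Desnanot–Jacobi identity (Dodgson condensation). -/
theorem Matrix.desnanot_jacobi {R : Type*} [CommRing R] {k : ℕ}
    (A : Matrix (Fin (k + 2)) (Fin (k + 2)) R) :
    (A.submatrix Fin.succ Fin.succ).det * (A.submatrix Fin.castSucc Fin.castSucc).det -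
      (A.submatrix Fin.succ Fin.castSucc).det * (A.submatrix Fin.castSucc Fin.succ).det =
    A.det * (A.submatrix (fun i : Fin k => i.castSucc.succ)
      fun i : Fin k => i.castSucc.succ).det := by
  have hA : (charmatrix (-A)).map (evalRingHom 0) = A := by
    ext i j
    by_cases hij : i = j <;> simp [hij]
  have h := (charpoly_monic (-A)).isRegular.left (det_mul_desnanot_jacobi (charmatrix (-A)))
  simpa only [map_mul, map_sub, RingHom.map_det, RingHom.mapMatrix_apply, ← submatrix_map, hA]
    using congrArg (evalRingHom (0 : R)) h

/-- Discrete Hirota relation for Schur functions of rectangular partitions: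
`s_{(m^ℓ)} · s_{(m^ℓ)} = s_{((m+1)^ℓ)} · s_{((m−1)^ℓ)} + s_{(m^{ℓ+1})} · s_{(m^{ℓ−1})}`. -/
theorem rectangular_hirota {R : Type*} [CommRing R] (h : ℤ → R)
    (h0 : h 0 = 1) (hneg : ∀ z : ℤ, z < 0 → h z = 0)
    (m ℓ : ℕ) (hm : 1 ≤ m) (hl : 1 ≤ ℓ) :
    jtSchur h (fun _ : Fin ℓ => (m : ℤ)) * jtSchur h (fun _ : Fin ℓ => (m : ℤ)) =
      jtSchur h (fun _ : Fin ℓ => (m : ℤ) + 1) * jtSchur h (fun _ : Fin ℓ => (m : ℤ) - 1)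
        + jtSchur h (fun _ : Fin (ℓ + 1) => (m : ℤ)) *
            jtSchur h (fun _ : Fin (ℓ - 1) => (m : ℤ)) := by
  obtain ⟨k, rfl⟩ := Nat.exists_eq_add_of_le' hl
  have hminor {p : ℕ} (c : ℤ) (r s : Fin p → Fin (k + 2))
      (hrs : ∀ i j, (m : ℤ) - (r i : ℕ) + (s j : ℕ) = c - (i : ℕ) + (j : ℕ)) :
      ((Matrix.of fun i j : Fin (k + 2) => h ((m : ℤ) - (i : ℕ) + (j : ℕ))).submatrix r s).det =
        jtSchur h (fun _ : Fin p => c) := by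
    rw [jtSchur]
    congr 1
    ext i j
    simp [hrs]
  have hD := Matrix.desnanot_jacobi
    (Matrix.of fun i j : Fin (k + 2) => h ((m : ℤ) - (i : ℕ) + (j : ℕ)))
  rw [hminor m _ _ fun i j => by simp; ring, hminor m _ _ fun i j => by simp,
    hminor (m - 1) _ _ fun i j => by simp; ring, hminor (m + 1) _ _ fun i j => by simp; ring,
    hminor m _ _ fun i j => by simp; ring] at hD
  change _ = jtSchur h (fun _ : Fin (k + 1 + 1) => (m : ℤ)) * _ at hD
  rw [Nat.add_sub_cancel]
  linear_combination hD
end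

section
/- Let R be a commutative ring and t : ℤ → ℤ → R an arbitrary function, and define s_ν^{(u)} for weakly decreasing integer tuples ν as the shifted Jacobi–Trudi determinant. Then for all integers m ≥ 1, ℓ ≥ 1 and all u ∈ ℤ: s_{(m^ℓ)}^{(u−1)} · s_{(m^ℓ)}^{(u+1)} = s_{((m+1)^ℓ)}^{(u)} · s_{((m−1)^ℓ)}^{(u)} + s_{(m^{ℓ+1})}^{(u)} · s_{(m^{ℓ−1})}^{(u)}, where (a^b) denotes the tuple with b entries each equal to a (so ((m−1)^ℓ) has ℓ entries even when m = 1, and (m^{ℓ−1}) has ℓ−1 entries, the empty tuple when ℓ = 1). -/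
namespace Matrix

/-- Jacobi's complementary minor identity, multiplied through by the determinant. -/
theorem det_mul_det_adjugate_toBlocks₁₁ {R m n : Type*} [CommRing R] [Fintype m] [DecidableEq m]
    [Fintype n] [DecidableEq n] (A : Matrix (m ⊕ n) (m ⊕ n) R) :
    A.det * A.adjugate.toBlocks₁₁.det = A.det ^ Fintype.card m * A.toBlocks₂₂.det := by
  have h : A * A.adjugate = A.det • 1 := mul_adjugate A
  have h₁ : A.toBlocks₁₁ * A.adjugate.toBlocks₁₁ + A.toBlocks₁₂ * A.adjugate.toBlocks₂₁ =
        A.det • 1 ∧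
      A.toBlocks₂₁ * A.adjugate.toBlocks₁₁ + A.toBlocks₂₂ * A.adjugate.toBlocks₂₁ = 0 := by
    have h₂ := h
    rw [← fromBlocks_toBlocks A.adjugate, ← fromBlocks_one, fromBlocks_smul] at h₂
    nth_rewrite 1 [← fromBlocks_toBlocks A] at h₂
    rw [fromBlocks_multiply, fromBlocks_inj] at h₂
    exact ⟨h₂.1, by simpa using h₂.2.2.1⟩
  have h₃ : A * fromBlocks A.adjugate.toBlocks₁₁ 0 A.adjugate.toBlocks₂₁ 1 =
      fromBlocks (A.det • 1) A.toBlocks₁₂ 0 A.toBlocks₂₂ := by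
    nth_rewrite 1 [← fromBlocks_toBlocks A]
    rw [fromBlocks_multiply, h₁.1, h₁.2]
    simp
  simpa [det_smul] using congrArg det h₃

/-- The complementary minor of a two-dimensional block of the adjugate. -/
theorem det_adjugate_toBlocks₁₁_fin_two {R n : Type*} [CommRing R] [Fintype n] [DecidableEq n]
    (A : Matrix (Fin 2 ⊕ n) (Fin 2 ⊕ n) R) :
    A.adjugate.toBlocks₁₁.det = A.det * A.toBlocks₂₂.det := by
  have generic : (mvPolynomialX (Fin 2 ⊕ n) (Fin 2 ⊕ n) ℤ).adjugate.toBlocks₁₁.det =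
      (mvPolynomialX (Fin 2 ⊕ n) (Fin 2 ⊕ n) ℤ).det *
        (mvPolynomialX (Fin 2 ⊕ n) (Fin 2 ⊕ n) ℤ).toBlocks₂₂.det := by
    apply mul_left_cancel₀ (det_mvPolynomialX_ne_zero (Fin 2 ⊕ n) ℤ)
    rw [det_mul_det_adjugate_toBlocks₁₁, Fintype.card_fin, sq, mul_assoc]
  let f : MvPolynomial ((Fin 2 ⊕ n) × (Fin 2 ⊕ n)) ℤ →+* R :=
    MvPolynomial.eval₂Hom (Int.castRingHom R) fun p => A p.1 p.2
  have hA : f.mapMatrix (mvPolynomialX (Fin 2 ⊕ n) (Fin 2 ⊕ n) ℤ) = A := by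
    ext i j
    simp [f]
  have h₁ (B : Matrix (Fin 2 ⊕ n) (Fin 2 ⊕ n) (MvPolynomial ((Fin 2 ⊕ n) × (Fin 2 ⊕ n)) ℤ)) :
      f.mapMatrix B.toBlocks₁₁ = (f.mapMatrix B).toBlocks₁₁ := rfl
  have h₂ (B : Matrix (Fin 2 ⊕ n) (Fin 2 ⊕ n) (MvPolynomial ((Fin 2 ⊕ n) × (Fin 2 ⊕ n)) ℤ)) :
      f.mapMatrix B.toBlocks₂₂ = (f.mapMatrix B).toBlocks₂₂ := rfl
  have h := congrArg f generic
  rwa [map_mul, RingHom.map_det, RingHom.map_det, RingHom.map_det, h₁, h₂,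
    RingHom.map_adjugate, hA] at h

/-- The Desnanot–Jacobi identity (Dodgson condensation). -/
theorem det_mul_det_submatrix_castSucc_succ {R : Type*} [CommRing R] {k : ℕ}
    (A : Matrix (Fin (k + 2)) (Fin (k + 2)) R) :
    A.det * (A.submatrix (fun i : Fin k => i.castSucc.succ) (fun j : Fin k => j.castSucc.succ)).det =
      (A.submatrix Fin.succ Fin.succ).det * (A.submatrix Fin.castSucc Fin.castSucc).det -
        (A.submatrix Fin.succ Fin.castSucc).det * (A.submatrix Fin.castSucc Fin.succ).det := by
  let g : Fin 2 ⊕ Fin k → Fin (k + 2) :=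
    Sum.elim ![0, Fin.last (k + 1)] fun i => i.castSucc.succ
  have hg : g.Injective := by
    rintro (i | i) (j | j) h
    · fin_cases i <;> fin_cases j <;> simp_all [g, Fin.ext_iff]
    · fin_cases i <;> simp [g, Fin.ext_iff] at h
      omega
    · fin_cases j <;> simp [g, Fin.ext_iff] at h
      omega
    · simpa [g, Fin.ext_iff] using h
  have hb : g.Bijective :=
    (Fintype.bijective_iff_injective_and_card g).2 ⟨hg, by simp [add_comm]⟩
  let e : Fin 2 ⊕ Fin k ≃ Fin (k + 2) := Equiv.ofBijective g hb
  have h := det_adjugate_toBlocks₁₁_fin_two (A.submatrix e e)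
  rw [det_submatrix_equiv_self, adjugate_submatrix_equiv_self, det_fin_two] at h
  have hinner : (A.submatrix e e).toBlocks₂₂ =
      A.submatrix (fun i : Fin k => i.castSucc.succ) fun j : Fin k => j.castSucc.succ := rfl
  have e₀ : e (Sum.inl 0) = 0 := rfl
  have e₁ : e (Sum.inl 1) = Fin.last (k + 1) := rfl
  simp only [toBlocks₁₁, of_apply, submatrix_apply, e₀, e₁, hinner,
    adjugate_fin_succ_eq_det_submatrix, Fin.succAbove_zero, Fin.succAbove_last, Fin.val_zero,
    Fin.val_last] at h
  rw [← h]
  have hs : ((-1 : R) ^ (k + 1)) * (-1) ^ (k + 1) = 1 := by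
    rw [← mul_pow]
    simp
  simp only [zero_add, add_zero, pow_zero, pow_add _ (k + 1) (k + 1), hs, one_mul]
  linear_combination
    -((A.submatrix Fin.succ Fin.castSucc).det * (A.submatrix Fin.castSucc Fin.succ).det) * hs

end Matrix

/-- Quantum discrete Hirota relation for rectangles:
`s_{(m^ℓ)}^{(u−1)} s_{(m^ℓ)}^{(u+1)} = s_{((m+1)^ℓ)}^{(u)} s_{((m−1)^ℓ)}^{(u)}
+ s_{(m^{ℓ+1})}^{(u)} s_{(m^{ℓ−1})}^{(u)}`, for an arbitrary `t : ℤ → ℤ → R`. -/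
theorem quantum_rectangular_hirota {R : Type*} [CommRing R] (t : ℤ → ℤ → R)
    (m ℓ : ℕ) (hm : 1 ≤ m) (hl : 1 ≤ ℓ) (u : ℤ) :
    sShift t (u - 1) (fun _ : Fin ℓ => (m : ℤ)) *
        sShift t (u + 1) (fun _ : Fin ℓ => (m : ℤ)) =
      sShift t u (fun _ : Fin ℓ => (m : ℤ) + 1) *
          sShift t u (fun _ : Fin ℓ => (m : ℤ) - 1)
        + sShift t u (fun _ : Fin (ℓ + 1) => (m : ℤ)) *
            sShift t u (fun _ : Fin (ℓ - 1) => (m : ℤ)) := by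
  obtain ⟨k, rfl⟩ : ∃ k, ℓ = k + 1 := ⟨ℓ - 1, by omega⟩
  rw [Nat.add_sub_cancel]
  have h := Matrix.det_mul_det_submatrix_castSucc_succ
    (Matrix.of fun i j : Fin (k + 2) => t (m - (i : ℕ) + (j : ℕ)) (u + (i : ℕ) + (j : ℕ) - k - 1))
  have h₁ : sShift t (u - 1) (fun _ : Fin (k + 1) => (m : ℤ)) =
      ((Matrix.of fun i j : Fin (k + 2) =>
        t (m - (i : ℕ) + (j : ℕ)) (u + (i : ℕ) + (j : ℕ) - k - 1)).submatrix
          Fin.castSucc Fin.castSucc).det := by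
    unfold sShift
    congr 1
    ext i j
    simp only [Matrix.submatrix_apply, Matrix.of_apply, Fin.val_castSucc, Nat.cast_add,
      Nat.cast_one]
    congr 1
    ring
  have h₂ : sShift t (u + 1) (fun _ : Fin (k + 1) => (m : ℤ)) =
      ((Matrix.of fun i j : Fin (k + 2) =>
        t (m - (i : ℕ) + (j : ℕ)) (u + (i : ℕ) + (j : ℕ) - k - 1)).submatrix
          Fin.succ Fin.succ).det := by
    unfold sShift
    congr 1
    ext i j
    simp only [Matrix.submatrix_apply, Matrix.of_apply, Fin.val_succ, Nat.cast_add, Nat.cast_one]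
    congr 1 <;> ring
  have h₃ : sShift t u (fun _ : Fin (k + 1) => (m : ℤ) + 1) =
      ((Matrix.of fun i j : Fin (k + 2) =>
        t (m - (i : ℕ) + (j : ℕ)) (u + (i : ℕ) + (j : ℕ) - k - 1)).submatrix
          Fin.castSucc Fin.succ).det := by
    unfold sShift
    congr 1
    ext i j
    simp only [Matrix.submatrix_apply, Matrix.of_apply, Fin.val_succ, Fin.val_castSucc,
      Nat.cast_add, Nat.cast_one]
    congr 1 <;> ring
  have h₄ : sShift t u (fun _ : Fin (k + 1) => (m : ℤ) - 1) =
      ((Matrix.of fun i j : Fin (k + 2) =>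
        t (m - (i : ℕ) + (j : ℕ)) (u + (i : ℕ) + (j : ℕ) - k - 1)).submatrix
          Fin.succ Fin.castSucc).det := by
    unfold sShift
    congr 1
    ext i j
    simp only [Matrix.submatrix_apply, Matrix.of_apply, Fin.val_succ, Fin.val_castSucc,
      Nat.cast_add, Nat.cast_one]
    congr 1 <;> ring
  have h₅ : sShift t u (fun _ : Fin (k + 1 + 1) => (m : ℤ)) =
      (Matrix.of fun i j : Fin (k + 2) =>
        t (m - (i : ℕ) + (j : ℕ)) (u + (i : ℕ) + (j : ℕ) - k - 1)).det := by
    unfold sShift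
    congr 1
    ext i j
    simp only [Matrix.of_apply, Nat.cast_add, Nat.cast_one]
    congr 1
    ring
  have h₆ : sShift t u (fun _ : Fin k => (m : ℤ)) =
      ((Matrix.of fun i j : Fin (k + 2) =>
        t (m - (i : ℕ) + (j : ℕ)) (u + (i : ℕ) + (j : ℕ) - k - 1)).submatrix
          (fun i : Fin k => i.castSucc.succ) (fun j : Fin k => j.castSucc.succ)).det := by
    unfold sShift
    congr 1
    ext i j
    simp only [Matrix.submatrix_apply, Matrix.of_apply, Fin.val_succ, Fin.val_castSucc,
      Nat.cast_add, Nat.cast_one]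
    congr 1 <;> ring
  rw [h₁, h₂, h₃, h₄, h₅, h₆]
  linear_combination -h
end

section
/- Let R be a commutative ring, n ≥ 1, and let v_1,…,v_n, w_1,…,w_n be 2n vectors in R^n. For vectors u_1,…,u_n write [u_1 u_2 ⋯ u_n] for the determinant of the n×n matrix whose i-th row is u_i. Then for every k with 1 ≤ k ≤ n and every choice 1 ≤ r_1 < r_2 < ⋯ < r_k ≤ n, the Plücker relation holds: [v_1 ⋯ v_n] · [w_1 ⋯ w_n] = Σ_{1 ≤ s_1 < s_2 < ⋯ < s_k ≤ n} [v'] · [w'], where [v'] is the determinant of the matrix obtained from rows (v_1,…,v_n) by replacing v_{r_i} (in its position) with w_{s_i} for each i = 1,…,k, and [w'] is the determinant of the matrix obtained from rows (w_1,…,w_n) by replacing w_{s_i} (in its position) with v_{r_i} for each i = 1,…,k. -/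
open Classical in
/-- Replace rows: given two families of rows `x, y : Fin n → Fin n → R` and two
tuples of indices `P Q : Fin k → Fin n`, `plRep x y P Q` is the family obtained
from `x` by replacing, for each `i`, the row in position `P i` by the row `y (Q i)`.
(When `P` is injective, as in the applications, the choice of `i` is unique.) -/
noncomputable def plRep {R : Type*} [CommRing R] {n k : ℕ}
    (x y : Fin n → Fin n → R) (P Q : Fin k → Fin n) : Fin n → Fin n → R :=
  fun a => if h : ∃ i, P i = a then y (Q h.choose) else x a

theorem plRep_eq_extend {R : Type*} [CommRing R] {n k : ℕ}
    (x y : Fin n → Fin n → R) (P Q : Fin k → Fin n) :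
    plRep x y P Q = Function.extend P (y ∘ Q) x := by
  funext a
  simp only [plRep, Function.extend, Function.comp_apply]

theorem Function.Injective.extend_update {α β γ : Type*} [DecidableEq α] [DecidableEq β]
    {f : α → β} (hf : f.Injective) (g : α → γ) (e : β → γ) (i : α) (c : γ) :
    Function.extend f (Function.update g i c) e =
      Function.update (Function.extend f g e) (f i) c := by
  funext b
  by_cases hb : ∃ a, f a = b
  · obtain ⟨a, rfl⟩ := hb
    rw [hf.extend_apply]
    by_cases h : a = i
    · subst h
      simp
    · rw [Function.update_of_ne h, Function.update_of_ne (hf.ne h), hf.extend_apply]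
  · have hne : b ≠ f i := fun h => hb ⟨i, h.symm⟩
    rw [Function.extend_apply' _ _ _ hb, Function.update_of_ne hne,
      Function.extend_apply' _ _ _ hb]

theorem Function.Injective.extend_comp_self {α β γ : Type*} {f : α → β} (hf : f.Injective)
    (g : β → γ) : Function.extend f (g ∘ f) g = g := by
  funext b
  by_cases hb : ∃ a, f a = b
  · obtain ⟨a, rfl⟩ := hb
    rw [hf.extend_apply, Function.comp_apply]
  · rw [Function.extend_apply' _ _ _ hb]

/-- The alternating map obtained from `g` by fixing the arguments outside the range of the
injective map `f` to be those of `e`. -/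
noncomputable def AlternatingMap.fixOutside {R M N α β : Type*} [CommRing R] [AddCommGroup M]
    [Module R M] [AddCommGroup N] [Module R N] (g : M [⋀^β]→ₗ[R] N)
    {f : α → β} (hf : f.Injective) (e : β → M) : M [⋀^α]→ₗ[R] N where
  toFun u := g (Function.extend f u e)
  map_update_add' u i x y := by
    classical
    simp only [hf.extend_update, g.map_update_add]
  map_update_smul' u i c x := by
    classical
    simp only [hf.extend_update, g.map_update_smul]
  map_eq_zero_of_eq' u i j h hij :=
    g.map_eq_zero_of_eq _ (by rw [hf.extend_apply, hf.extend_apply, h]) (hf.ne hij)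

@[simp]
theorem AlternatingMap.fixOutside_apply {R M N α β : Type*} [CommRing R] [AddCommGroup M]
    [Module R M] [AddCommGroup N] [Module R N] (g : M [⋀^β]→ₗ[R] N)
    {f : α → β} (hf : f.Injective) (e : β → M) (u : α → M) :
    g.fixOutside hf e u = g (Function.extend f u e) :=
  rfl

/-- A sum over all maps `Fin k → α` of a function vanishing on non-injective maps is a sum over
strictly increasing maps and permutations. -/
theorem Fin.sum_pi_eq_sum_strictMono_perm {α N : Type*} [LinearOrder α] [Fintype α]
    [AddCommMonoid N] {k : ℕ} [Fintype {s : Fin k → α // StrictMono s}]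
    (F : (Fin k → α) → N) (hF : ∀ f, ¬ f.Injective → F f = 0) :
    ∑ f, F f = ∑ s : {s : Fin k → α // StrictMono s}, ∑ σ : Equiv.Perm (Fin k), F (s.1 ∘ σ) := by
  classical
  rw [← Fintype.sum_prod_type']
  symm
  refine Finset.sum_of_injOn
    (fun p : {s : Fin k → α // StrictMono s} × Equiv.Perm (Fin k) => p.1.1 ∘ p.2)
    ?_ (fun _ _ => Finset.mem_coe.2 (Finset.mem_univ _)) ?_ (fun _ _ => rfl)
  · rintro ⟨⟨s, hs⟩, σ⟩ - ⟨⟨t, ht⟩, τ⟩ - h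
    dsimp only at h
    have hst : s = t := by
      rw [← hs.range_inj ht]
      simpa [σ.surjective.range_comp, τ.surjective.range_comp] using congrArg Set.range h
    subst hst
    have hστ : σ = τ := Equiv.ext fun i => hs.injective (congrFun h i)
    rw [hστ]
  · intro f _ hf
    refine hF f fun hinj => hf ?_
    refine ⟨(⟨f ∘ Tuple.sort f, (Tuple.monotone_sort f).strictMono_of_injective
      (hinj.comp (Tuple.sort f).injective)⟩, (Tuple.sort f)⁻¹), by simp, ?_⟩
    funext i
    simp

/-- Cauchy–Binet expansion of an alternating map evaluated at linear combinations. -/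
theorem AlternatingMap.map_sum_smul_eq_sum_strictMono {R M N α : Type*} [CommRing R]
    [AddCommGroup M] [Module R M] [AddCommGroup N] [Module R N] [LinearOrder α] [Fintype α]
    {k : ℕ} [Fintype {s : Fin k → α // StrictMono s}]
    (g : M [⋀^Fin k]→ₗ[R] N) (A : Matrix (Fin k) α R) (w : α → M) :
    g (fun i => ∑ j, A i j • w j) =
      ∑ s : {s : Fin k → α // StrictMono s}, (A.submatrix id s.1).det • g (w ∘ s.1) := by
  have expand : g (fun i => ∑ j, A i j • w j) =
      ∑ f : Fin k → α, (∏ i, A i (f i)) • g (w ∘ f) := by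
    rw [← AlternatingMap.coe_multilinearMap, MultilinearMap.map_sum]
    exact Finset.sum_congr rfl fun f _ => g.toMultilinearMap.map_smul_univ _ _
  rw [expand, Fin.sum_pi_eq_sum_strictMono_perm]
  · refine Finset.sum_congr rfl fun s _ => ?_
    rw [← Matrix.det_transpose, Matrix.det_apply, Finset.sum_smul]
    refine Finset.sum_congr rfl fun σ _ => ?_
    rw [← Function.comp_assoc, g.map_perm, smul_comm, ← smul_assoc]
    rfl
  · intro f hf
    rw [g.map_eq_zero_of_not_injective, smul_zero]
    exact fun h => hf h.of_comp

theorem StrictMono.exists_notMem_range_of_ne {α : Type*} [LinearOrder α] {k : ℕ}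
    {s t : Fin k → α} (hs : StrictMono s) (ht : StrictMono t) (hst : t ≠ s) :
    ∃ i, t i ∉ Set.range s := by
  by_contra! h
  refine hst ((ht.range_inj hs).1 ?_)
  refine Set.eq_of_subset_of_ncard_le (Set.range_subset_iff.2 h) ?_ (Set.finite_range _)
  rw [← Set.image_univ, ← Set.image_univ, Set.ncard_image_of_injective _ hs.injective,
    Set.ncard_image_of_injective _ ht.injective]

/-- Replacing rows of `w` by linear combinations of all rows multiplies the determinant by
a minor of the matrix of coefficients. -/
theorem Matrix.det_extend_sum_smul {R : Type*} [CommRing R] {n k : ℕ}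
    (w : Fin n → Fin n → R) {s : Fin k → Fin n} (hs : StrictMono s)
    (A : Matrix (Fin k) (Fin n) R) :
    det (of (Function.extend s (fun i => ∑ j, A i j • w j) w)) =
      (A.submatrix id s).det * det (of w) := by
  have h := (detRowAlternating.fixOutside hs.injective w).map_sum_smul_eq_sum_strictMono A w
  refine h.trans ?_
  rw [Finset.sum_eq_single_of_mem ⟨s, hs⟩ (Finset.mem_univ _)]
  · rw [AlternatingMap.fixOutside_apply, hs.injective.extend_comp_self]
    rfl
  · rintro ⟨t, ht⟩ - hts
    obtain ⟨i, hi⟩ := hs.exists_notMem_range_of_ne ht fun h => hts (Subtype.ext h)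
    rw [AlternatingMap.fixOutside_apply,
      AlternatingMap.map_eq_zero_of_eq _ _ (i := s i) (j := t i), smul_zero]
    · rw [hs.injective.extend_apply, Function.extend_apply' _ _ _ hi, Function.comp_apply]
    · exact fun h => hi ⟨i, h⟩

/-- The difference of the two sides of the Plücker relation. -/
noncomputable def pluckerDefect {R : Type*} [CommRing R] {n k : ℕ}
    (v w : Fin n → Fin n → R) (r : Fin k → Fin n) : R :=
  Matrix.det (Matrix.of v) * Matrix.det (Matrix.of w) -
    ∑ s : {s : Fin k → Fin n // ∀ a b : Fin k, a < b → s a < s b},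
      Matrix.det (Matrix.of (plRep v w r s.1)) * Matrix.det (Matrix.of (plRep w v s.1 r))

theorem plRep_map {R S : Type*} [CommRing R] [CommRing S] (φ : R →+* S) {n k : ℕ}
    (x y : Fin n → Fin n → R) (P Q : Fin k → Fin n) :
    plRep (fun i j => φ (x i j)) (fun i j => φ (y i j)) P Q =
      fun i j => φ (plRep x y P Q i j) := by
  funext i j
  unfold plRep
  split_ifs <;> rfl

theorem map_pluckerDefect {R S : Type*} [CommRing R] [CommRing S] (φ : R →+* S) {n k : ℕ}
    (v w : Fin n → Fin n → R) (r : Fin k → Fin n) :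
    φ (pluckerDefect v w r) =
      pluckerDefect (fun i j => φ (v i j)) (fun i j => φ (w i j)) r := by
  have hdet (x : Fin n → Fin n → R) :
      φ (Matrix.det (Matrix.of x)) = Matrix.det (Matrix.of fun i j => φ (x i j)) :=
    φ.map_det _
  simp only [pluckerDefect, map_sub, map_mul, map_sum, hdet, plRep_map]

theorem pluckerDefect_eq_zero_of_isUnit {R : Type*} [CommRing R] {n k : ℕ}
    (v w : Fin n → Fin n → R) {r : Fin k → Fin n} (hr : StrictMono r)
    (hw : IsUnit (Matrix.det (Matrix.of w))) : pluckerDefect v w r = 0 := by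
  obtain ⟨A, hA⟩ : ∃ A : Matrix (Fin n) (Fin n) R, ∀ i, v i = ∑ j, A i j • w j := by
    refine ⟨Matrix.of v * (Matrix.of w)⁻¹, fun i => ?_⟩
    have h : Matrix.of v * (Matrix.of w)⁻¹ * Matrix.of w = Matrix.of v :=
      Matrix.nonsing_inv_mul_cancel_right _ _ hw
    funext l
    simpa [Matrix.mul_apply] using (congrFun (congrFun h i) l).symm
  have hvr : v ∘ r = fun i => ∑ j, A.submatrix r id i j • w j := funext fun i => hA (r i)
  have hdet : Matrix.det (Matrix.of v) =
      ∑ s : {s : Fin k → Fin n // ∀ a b : Fin k, a < b → s a < s b},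
        ((A.submatrix r id).submatrix id s.1).det *
          Matrix.det (Matrix.of (Function.extend r (w ∘ s.1) v)) := by
    let _ : Fintype {s : Fin k → Fin n // StrictMono s} :=
      inferInstanceAs (Fintype {s : Fin k → Fin n // ∀ a b : Fin k, a < b → s a < s b})
    have h := (Matrix.detRowAlternating.fixOutside hr.injective
      v).map_sum_smul_eq_sum_strictMono (A.submatrix r id) w
    rw [← hvr, AlternatingMap.fixOutside_apply, hr.injective.extend_comp_self] at h
    exact h
  rw [pluckerDefect, sub_eq_zero, hdet, Finset.sum_mul]
  refine Finset.sum_congr rfl fun s _ => ?_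
  have hs : StrictMono s.1 := s.2
  rw [plRep_eq_extend, plRep_eq_extend, hvr, Matrix.det_extend_sum_smul w hs]
  ring

open Polynomial in
theorem pluckerDefect_eq_zero {R : Type*} [CommRing R] {n k : ℕ}
    (v w : Fin n → Fin n → R) {r : Fin k → Fin n} (hr : StrictMono r) :
    pluckerDefect v w r = 0 := by
  let v' : Fin n → Fin n → R[X] := fun i j => C (v i j)
  let w' : Fin n → Fin n → R[X] := Matrix.charmatrix (-Matrix.of w)
  have hw' : Matrix.det (Matrix.of w') ∈ nonZeroDivisors R[X] :=
    ((-Matrix.of w).charpoly_monic).mem_nonZeroDivisors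
  have hgeneric : pluckerDefect v' w' r = 0 := by
    apply IsLocalization.injective (Localization (nonZeroDivisors R[X])) le_rfl
    rw [map_pluckerDefect, map_zero]
    refine pluckerDefect_eq_zero_of_isUnit _ _ hr ?_
    have h := IsLocalization.map_units (Localization (nonZeroDivisors R[X])) ⟨_, hw'⟩
    rwa [RingHom.map_det] at h
  have heval := congrArg (evalRingHom (0 : R)) hgeneric
  rw [map_pluckerDefect, map_zero] at heval
  convert heval using 2
  · funext i j
    simp [v']
  · funext i j
    by_cases h : i = j <;> simp [w', h]

/-- The Plücker relations: for vectors `v_1,…,v_n, w_1,…,w_n ∈ Rⁿ`, `1 ≤ k ≤ n`,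
and indices `r_1 < ⋯ < r_k`,
`[v_1 ⋯ v_n]·[w_1 ⋯ w_n] = Σ_{s_1 < ⋯ < s_k} [v']·[w']`,
where `v'` is obtained from `(v_1,…,v_n)` by replacing `v_{r_i}` (in its position)
by `w_{s_i}` and `w'` is obtained from `(w_1,…,w_n)` by replacing `w_{s_i}` (in its
position) by `v_{r_i}`. -/
theorem pluecker_relations {R : Type*} [CommRing R] (n k : ℕ)
    (hn : 1 ≤ n) (hk1 : 1 ≤ k) (hkn : k ≤ n)
    (v w : Fin n → Fin n → R)
    (r : Fin k → Fin n) (hr : ∀ a b : Fin k, a < b → r a < r b) :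
    Matrix.det (Matrix.of v) * Matrix.det (Matrix.of w) =
      ∑ s : {s : Fin k → Fin n // ∀ a b : Fin k, a < b → s a < s b},
        Matrix.det (Matrix.of (plRep v w r s.1)) *
          Matrix.det (Matrix.of (plRep w v s.1 r)) := by
  exact sub_eq_zero.1 (pluckerDefect_eq_zero v w fun a b => hr a b)
end

section
/- Let R be a commutative ring and h : ℤ → R a function satisfying h(0) = 1 and h(k) = 0 for all k < 0, and define Schur functions by the Jacobi–Trudi determinant. Then s_{(3,2,1)} · s_{(3,2,1)} = s_{(4,3,1)} · s_{(2,1,1)} + s_{(3,2,2)} · s_{(3,1,1)} + s_{(3,3,3)} · s_{(1,1,1)} + s_{(3,2,2,2)} · s_{(3)} + s_{(3,3,3,2)} · s_{(1)} − s_{(3,3,3,3)}. -/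
/-- `s_{(3,2,1)}² = s_{(4,3,1)} s_{(2,1,1)} + s_{(3,2,2)} s_{(3,1,1)} + s_{(3,3,3)} s_{(1,1,1)}
+ s_{(3,2,2,2)} s_{(3)} + s_{(3,3,3,2)} s_{(1)} − s_{(3,3,3,3)}`. -/
theorem schur_staircase_relation {R : Type*} [CommRing R] (h : ℤ → R)
    (h0 : h 0 = 1) (hneg : ∀ z : ℤ, z < 0 → h z = 0) :
    jtSchur h ![(3 : ℤ), 2, 1] * jtSchur h ![(3 : ℤ), 2, 1] =
      jtSchur h ![(4 : ℤ), 3, 1] * jtSchur h ![(2 : ℤ), 1, 1]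
        + jtSchur h ![(3 : ℤ), 2, 2] * jtSchur h ![(3 : ℤ), 1, 1]
        + jtSchur h ![(3 : ℤ), 3, 3] * jtSchur h ![(1 : ℤ), 1, 1]
        + jtSchur h ![(3 : ℤ), 2, 2, 2] * jtSchur h ![(3 : ℤ)]
        + jtSchur h ![(3 : ℤ), 3, 3, 2] * jtSchur h ![(1 : ℤ)]
        - jtSchur h ![(3 : ℤ), 3, 3, 3] := by
  simp only [jtSchur, Matrix.det_succ_row_zero, Matrix.det_fin_zero, Fin.sum_univ_succ,
    Fin.sum_univ_zero, Matrix.submatrix_apply, Matrix.of_apply]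
  simp [Fin.succAbove, h0, hneg]
  ring
end

section
/- Let R be a commutative ring and t : ℤ → ℤ → R an arbitrary function (no specialization), and define s_ν^{(u)} for weakly decreasing integer tuples ν as the shifted Jacobi–Trudi determinant. Then for every u ∈ ℤ: s_{(3,2,1)}^{(u−1)} · s_{(3,2,1)}^{(u+1)} = s_{(4,3,1)}^{(u)} · s_{(2,1,1)}^{(u)} + s_{(3,2,2)}^{(u−1)} · s_{(3,1,1)}^{(u+1)} + s_{(3,3,3)}^{(u−1)} · s_{(1,1,1)}^{(u+3)} + s_{(3,2,2,2)}^{(u)} · s_{(3,0)}^{(u)} + s_{(3,3,3,2)}^{(u)} · s_{(1,0)}^{(u+2)} − s_{(3,3,3,3)}^{(u)} · s_{(0,0)}^{(u+3)}, where the tuples (3,0), (1,0), (0,0) have exactly two entries each, including the zero entries. -/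
theorem sShift_two {R : Type*} [CommRing R] (t : ℤ → ℤ → R) (u a b : ℤ) :
    sShift t u ![a, b] =
      t a (u - 1) * t b (u + a - b + 1) - t (a + 1) u * t (b - 1) (u + a - b) := by
  simp only [sShift, Matrix.det_fin_two, Matrix.of_apply]
  simp
  ring_nf

theorem sShift_three {R : Type*} [CommRing R] (t : ℤ → ℤ → R) (u a b c : ℤ) :
    sShift t u ![a, b, c] = Matrix.det !![
      t a (u - 2), t (a + 1) (u - 1), t (a + 2) u;
      t (b - 1) (u + a - b - 1), t b (u + a - b), t (b + 1) (u + a - b + 1);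
      t (c - 2) (u + a - c), t (c - 1) (u + a - c + 1), t c (u + a - c + 2)] := by
  unfold sShift
  congr 1
  ext i j
  fin_cases i <;> fin_cases j <;> simp <;> ring_nf

theorem sShift_four {R : Type*} [CommRing R] (t : ℤ → ℤ → R) (u a b c d : ℤ) :
    sShift t u ![a, b, c, d] = Matrix.det !![
      t a (u - 3), t (a + 1) (u - 2), t (a + 2) (u - 1), t (a + 3) u;
      t (b - 1) (u + a - b - 2), t b (u + a - b - 1), t (b + 1) (u + a - b),
        t (b + 2) (u + a - b + 1);
      t (c - 2) (u + a - c - 1), t (c - 1) (u + a - c), t c (u + a - c + 1),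
        t (c + 1) (u + a - c + 2);
      t (d - 3) (u + a - d), t (d - 2) (u + a - d + 1), t (d - 1) (u + a - d + 2),
        t d (u + a - d + 3)] := by
  unfold sShift
  congr 1
  ext i j
  fin_cases i <;> fin_cases j <;> simp <;> ring_nf

/-- The quantum relation of Example 321:
`s_{(3,2,1)}^{(u−1)} s_{(3,2,1)}^{(u+1)} = s_{(4,3,1)}^{(u)} s_{(2,1,1)}^{(u)}
+ s_{(3,2,2)}^{(u−1)} s_{(3,1,1)}^{(u+1)} + s_{(3,3,3)}^{(u−1)} s_{(1,1,1)}^{(u+3)}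
+ s_{(3,2,2,2)}^{(u)} s_{(3,0)}^{(u)} + s_{(3,3,3,2)}^{(u)} s_{(1,0)}^{(u+2)}
− s_{(3,3,3,3)}^{(u)} s_{(0,0)}^{(u+3)}`, where `(3,0)`, `(1,0)`, `(0,0)` are
tuples with exactly two entries. -/
theorem quantum_staircase_relation {R : Type*} [CommRing R] (t : ℤ → ℤ → R) (u : ℤ) :
    sShift t (u - 1) ![(3 : ℤ), 2, 1] * sShift t (u + 1) ![(3 : ℤ), 2, 1] =
      sShift t u ![(4 : ℤ), 3, 1] * sShift t u ![(2 : ℤ), 1, 1]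
        + sShift t (u - 1) ![(3 : ℤ), 2, 2] * sShift t (u + 1) ![(3 : ℤ), 1, 1]
        + sShift t (u - 1) ![(3 : ℤ), 3, 3] * sShift t (u + 3) ![(1 : ℤ), 1, 1]
        + sShift t u ![(3 : ℤ), 2, 2, 2] * sShift t u ![(3 : ℤ), 0]
        + sShift t u ![(3 : ℤ), 3, 3, 2] * sShift t (u + 2) ![(1 : ℤ), 0]
        - sShift t u ![(3 : ℤ), 3, 3, 3] * sShift t (u + 3) ![(0 : ℤ), 0] := by
  simp only [sShift_two, sShift_three, sShift_four, Matrix.det_fin_three,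
    Matrix.det_succ_row_zero (n := 3), Fin.sum_univ_four]
  simp [Fin.succAbove, Fin.lt_def, Matrix.submatrix]
  ring_nf
end

section
/- Let x_1 > x_2 > … > x_n ≥ 1 and 1 ≤ y_1 < y_2 < … < y_n be the corner coordinates of a partition λ, and let 1 ≤ i_1 < … < i_r ≤ j_r < … < j_1 ≤ n be a chain of nested intervals. Define new coordinates by x'_a := x_a + #{s : i_s + 1 ≤ a ≤ j_s} and y'_a := y_a + #{s : i_s ≤ a ≤ j_s} (for the operation π^{i_1⋯i_r}_{j_1⋯j_r}), respectively x''_a := x_a − #{s : i_s + 1 ≤ a ≤ j_s} and y''_a := y_a − #{s : i_s ≤ a ≤ j_s} (for μ^{i_1⋯i_r}_{j_1⋯j_r}). Then x'_1 ≥ x'_2 ≥ … ≥ x'_n ≥ 1 and 1 ≤ y'_1 ≤ … ≤ y'_n, and likewise x''_1 ≥ x''_2 ≥ … ≥ x''_n ≥ 0 and 0 ≤ y''_1 ≤ … ≤ y''_n; consequently π^{i_1⋯i_r}_{j_1⋯j_r}(λ) and μ^{i_1⋯i_r}_{j_1⋯j_r}(λ) are well-defined partitions, each has at most n outside corners, the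 largest part of π^{i_1⋯i_r}_{j_1⋯j_r}(λ) equals λ_1, and the largest part of μ^{i_1⋯i_r}_{j_1⋯j_r}(λ) is at most λ_1. -/
/-- The `a`-th part (for `a ≥ 1`) of the partition determined by corner
coordinates `X, Y : Fin n → ℤ` (with `X` weakly decreasing and `Y` weakly
increasing): the part is `X i` for `Y_{i−1} < a ≤ Y i`, i.e. the maximum of
`X i` over `i` with `a ≤ Y i`, and `0` if there is no such `i`. -/
noncomputable def partZ {n : ℕ} (X Y : Fin n → ℤ) (a : ℤ) : ℤ :=
  if h : (Finset.univ.filter fun i => a ≤ Y i).Nonempty then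
    (Finset.univ.filter fun i => a ≤ Y i).sup' h X
  else 0

/-- The number of outside corners of the partition determined by corner
coordinates `X, Y`: the number of distinct positive parts. -/
noncomputable def cornersCount {n : ℕ} (X Y : Fin n → ℤ) : ℕ :=
  (((Finset.Icc (1 : ℤ) (Finset.univ.sup fun i => (Y i).toNat : ℕ)).image
      fun a => partZ X Y a).filter fun v => 0 < v).card

theorem card_filter_le_add_sub {r n : ℕ} {f : Fin r → Fin n} (hf : Function.Injective f)
    (p q : Fin r → Prop) [DecidablePred p] [DecidablePred q] {l u : ℕ} (hlu : l ≤ u)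
    (h : ∀ s, p s → q s ∨ (l ≤ (f s : ℕ) ∧ (f s : ℕ) < u)) :
    ((Finset.univ.filter p).card : ℤ) ≤ (Finset.univ.filter q).card + ((u : ℤ) - l) := by
  have hsub : Finset.univ.filter p ⊆ Finset.univ.filter q ∪
      Finset.univ.filter fun s => l ≤ (f s : ℕ) ∧ (f s : ℕ) < u := by
    intro s hs
    simpa using h s (by simpa using hs)
  have hcard : (Finset.univ.filter fun s => l ≤ (f s : ℕ) ∧ (f s : ℕ) < u).card ≤ u - l := by
    rw [← Nat.card_Ico]
    refine Finset.card_le_card_of_injOn (fun s => (f s : ℕ)) ?_ ?_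
    · intro s hs
      simpa using hs
    · intro s _ t _ hst
      exact hf (Fin.ext hst)
  have := (Finset.card_le_card hsub).trans (Finset.card_union_le _ _)
  omega

theorem add_sub_le_of_strictMono {n : ℕ} {y : Fin n → ℤ} (hy : StrictMono y) {a b : Fin n}
    (hab : a ≤ b) : y a + ((b : ℤ) - a) ≤ y b := by
  obtain ⟨b, hb⟩ := b
  have hle : (a : ℕ) ≤ b := hab
  clear hab
  induction b, hle using Nat.le_induction with
  | base => simp
  | succ m _ ih =>
    have h₁ := ih (by omega)
    have h₂ : y ⟨m, by omega⟩ < y ⟨m + 1, hb⟩ := hy (by simp)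
    push_cast at h₁ ⊢
    omega

theorem partZ_le {n : ℕ} {X Y : Fin n → ℤ} {a c : ℤ} (hc : 0 ≤ c)
    (h : ∀ i, a ≤ Y i → X i ≤ c) : partZ X Y a ≤ c := by
  unfold partZ
  split_ifs
  · exact Finset.sup'_le _ _ fun i hi => h i (by simpa using hi)
  · exact hc

theorem le_partZ {n : ℕ} {X Y : Fin n → ℤ} {a : ℤ} {i : Fin n} (h : a ≤ Y i) :
    X i ≤ partZ X Y a := by
  have hi : i ∈ Finset.univ.filter fun i => a ≤ Y i := by simpa using h
  rw [partZ, dif_pos ⟨i, hi⟩]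
  exact Finset.le_sup' X hi

theorem partZ_nonneg {n : ℕ} {X Y : Fin n → ℤ} (hX : ∀ i, 0 ≤ X i) (a : ℤ) :
    0 ≤ partZ X Y a := by
  by_cases h : ∃ i, a ≤ Y i
  · obtain ⟨i, hi⟩ := h
    exact (hX i).trans (le_partZ hi)
  · rw [partZ, dif_neg]
    simpa [Finset.filter_nonempty_iff] using h

theorem cornersCount_le {n : ℕ} (X Y : Fin n → ℤ) : cornersCount X Y ≤ n := by
  have hsub : (((Finset.Icc (1 : ℤ) (Finset.univ.sup fun i => (Y i).toNat : ℕ)).image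
      fun a => partZ X Y a).filter fun v => 0 < v) ⊆ Finset.univ.image X := by
    intro v hv
    obtain ⟨hv, hpos⟩ := Finset.mem_filter.1 hv
    obtain ⟨a, -, rfl⟩ := Finset.mem_image.1 hv
    unfold partZ at hpos ⊢
    split_ifs at hpos ⊢ with h
    · obtain ⟨i, -, hi⟩ := Finset.exists_mem_eq_sup' h X
      exact Finset.mem_image.2 ⟨i, Finset.mem_univ i, hi.symm⟩
    · exact absurd hpos (lt_irrefl 0)
  calc cornersCount X Y ≤ (Finset.univ.image X).card := Finset.card_le_card hsub
    _ ≤ n := Finset.card_image_le.trans_eq (by simp)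

/-- Adding (for `π`) and removing (for `μ`) nested border strips is well defined
on corner coordinates: given corner coordinates `x_1 > ⋯ > x_n ≥ 1`,
`1 ≤ y_1 < ⋯ < y_n` and a chain of nested intervals
`1 ≤ i_1 < ⋯ < i_r ≤ j_r < ⋯ < j_1 ≤ n` (indices of `Fin n` are 0-indexed, so
`i_s + 1 ≤ a ≤ j_s` reads `I s < a ∧ a ≤ J s`, and `i_s ≤ a ≤ j_s` reads
`I s ≤ a ∧ a ≤ J s`), the new coordinates
`x'_a = x_a + #{s : i_s+1 ≤ a ≤ j_s}`, `y'_a = y_a + #{s : i_s ≤ a ≤ j_s}`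
(resp. `x''_a = x_a − ⋯`, `y''_a = y_a − ⋯`) satisfy
`x'_1 ≥ ⋯ ≥ x'_n ≥ 1`, `1 ≤ y'_1 ≤ ⋯ ≤ y'_n`, `x''_1 ≥ ⋯ ≥ x''_n ≥ 0`,
`0 ≤ y''_1 ≤ ⋯ ≤ y''_n`; consequently they determine partitions with at most
`n` outside corners, the largest part of `π(λ)` equals `λ_1`, and the largest
part of `μ(λ)` is at most `λ_1`. -/
theorem borderstrip_ops_well_defined (n r : ℕ) (x y : Fin n → ℤ)
    (hx : ∀ a b : Fin n, a < b → x b < x a) (hx1 : ∀ a, 1 ≤ x a)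
    (hy : ∀ a b : Fin n, a < b → y a < y b) (hy1 : ∀ a, 1 ≤ y a)
    (I J : Fin r → Fin n)
    (hI : ∀ a b : Fin r, a < b → I a < I b)
    (hJ : ∀ a b : Fin r, a < b → J b < J a)
    (hIJ : ∀ s : Fin r, I s ≤ J s) :
    (∀ a b : Fin n, a ≤ b →
      x b + ((Finset.univ.filter fun s => I s < b ∧ b ≤ J s).card : ℤ) ≤
        x a + ((Finset.univ.filter fun s => I s < a ∧ a ≤ J s).card : ℤ)) ∧
    (∀ a : Fin n,
      1 ≤ x a + ((Finset.univ.filter fun s => I s < a ∧ a ≤ J s).card : ℤ)) ∧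
    (∀ a b : Fin n, a ≤ b →
      y a + ((Finset.univ.filter fun s => I s ≤ a ∧ a ≤ J s).card : ℤ) ≤
        y b + ((Finset.univ.filter fun s => I s ≤ b ∧ b ≤ J s).card : ℤ)) ∧
    (∀ a : Fin n,
      1 ≤ y a + ((Finset.univ.filter fun s => I s ≤ a ∧ a ≤ J s).card : ℤ)) ∧
    (∀ a b : Fin n, a ≤ b →
      x b - ((Finset.univ.filter fun s => I s < b ∧ b ≤ J s).card : ℤ) ≤
        x a - ((Finset.univ.filter fun s => I s < a ∧ a ≤ J s).card : ℤ)) ∧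
    (∀ a : Fin n,
      0 ≤ x a - ((Finset.univ.filter fun s => I s < a ∧ a ≤ J s).card : ℤ)) ∧
    (∀ a b : Fin n, a ≤ b →
      y a - ((Finset.univ.filter fun s => I s ≤ a ∧ a ≤ J s).card : ℤ) ≤
        y b - ((Finset.univ.filter fun s => I s ≤ b ∧ b ≤ J s).card : ℤ)) ∧
    (∀ a : Fin n,
      0 ≤ y a - ((Finset.univ.filter fun s => I s ≤ a ∧ a ≤ J s).card : ℤ)) ∧
    cornersCount
      (fun a => x a + ((Finset.univ.filter fun s => I s < a ∧ a ≤ J s).card : ℤ))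
      (fun a => y a + ((Finset.univ.filter fun s => I s ≤ a ∧ a ≤ J s).card : ℤ))
        ≤ n ∧
    cornersCount
      (fun a => x a - ((Finset.univ.filter fun s => I s < a ∧ a ≤ J s).card : ℤ))
      (fun a => y a - ((Finset.univ.filter fun s => I s ≤ a ∧ a ≤ J s).card : ℤ))
        ≤ n ∧
    partZ
      (fun a => x a + ((Finset.univ.filter fun s => I s < a ∧ a ≤ J s).card : ℤ))
      (fun a => y a + ((Finset.univ.filter fun s => I s ≤ a ∧ a ≤ J s).card : ℤ))
      1 = partZ x y 1 ∧
    partZ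
      (fun a => x a - ((Finset.univ.filter fun s => I s < a ∧ a ≤ J s).card : ℤ))
      (fun a => y a - ((Finset.univ.filter fun s => I s ≤ a ∧ a ≤ J s).card : ℤ))
      1 ≤ partZ x y 1 := by
  have hIinj : Function.Injective I := StrictMono.injective fun a b => hI a b
  have hJinj : Function.Injective J := StrictAnti.injective fun a b => hJ a b
  have hxgap : ∀ a b : Fin n, a ≤ b → x b + ((b : ℤ) - a) ≤ x a := fun a b hab => by
    have := add_sub_le_of_strictMono (y := fun i => -x i)
      (fun a b h => neg_lt_neg (hx a b h)) hab
    omega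
  have hygap : ∀ a b : Fin n, a ≤ b → y a + ((b : ℤ) - a) ≤ y b := fun a b hab =>
    add_sub_le_of_strictMono (fun a b h => hy a b h) hab
  have hxlow : ∀ a : Fin n, (n : ℤ) - a ≤ x a := fun a => by
    have hn := a.isLt
    have h₁ := hxgap a ⟨n - 1, by omega⟩ (Fin.le_def.2 (by simp only; omega))
    have h₂ := hx1 ⟨n - 1, by omega⟩
    simp only at h₁
    omega
  have hylow : ∀ a : Fin n, (a : ℤ) + 1 ≤ y a := fun a => by
    have hn := a.isLt
    have h₁ := hygap ⟨0, by omega⟩ a (Fin.le_def.2 (by simp))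
    have h₂ := hy1 ⟨0, by omega⟩
    simp only at h₁
    omega
  have hπx : ∀ a b : Fin n, a ≤ b →
      x b + ((Finset.univ.filter fun s => I s < b ∧ b ≤ J s).card : ℤ) ≤
        x a + ((Finset.univ.filter fun s => I s < a ∧ a ≤ J s).card : ℤ) := fun a b hab => by
    have := card_filter_le_add_sub hIinj (fun s => I s < b ∧ b ≤ J s)
      (fun s => I s < a ∧ a ≤ J s) hab (fun s => by grind)
    linarith [hxgap a b hab]
  have hμx : ∀ a : Fin n,
      0 ≤ x a - ((Finset.univ.filter fun s => I s < a ∧ a ≤ J s).card : ℤ) := fun a => by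
    have := card_filter_le_add_sub hJinj (fun s => I s < a ∧ a ≤ J s) (fun _ => False)
      a.isLt.le (fun s => by grind)
    simp only [Finset.filter_false, Finset.card_empty] at this
    have := hxlow a
    omega
  refine ⟨hπx, fun a => ?_, fun a b hab => ?_, fun a => ?_, fun a b hab => ?_, hμx,
    fun a b hab => ?_, fun a => ?_, cornersCount_le _ _, cornersCount_le _ _, ?_, ?_⟩
  · have := hx1 a
    omega
  · have := card_filter_le_add_sub hJinj (fun s => I s ≤ a ∧ a ≤ J s)
      (fun s => I s ≤ b ∧ b ≤ J s) hab (fun s => by grind)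
    linarith [hygap a b hab]
  · have := hy1 a
    omega
  · have := card_filter_le_add_sub hJinj (fun s => I s < a ∧ a ≤ J s)
      (fun s => I s < b ∧ b ≤ J s) hab (fun s => by grind)
    linarith [hxgap a b hab]
  · have := card_filter_le_add_sub hIinj (fun s => I s ≤ b ∧ b ≤ J s)
      (fun s => I s ≤ a ∧ a ≤ J s) (Nat.succ_le_succ hab) (fun s => by grind)
    push_cast at this
    linarith [hygap a b hab]
  · have := card_filter_le_add_sub hIinj (fun s => I s ≤ a ∧ a ≤ J s) (fun _ => False)
      (Nat.zero_le (a + 1)) (fun s => by grind)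
    simp only [Finset.filter_false, Finset.card_empty] at this
    have := hylow a
    omega
  · have hnonneg : 0 ≤ partZ x y 1 := partZ_nonneg (fun i => by linarith [hx1 i]) 1
    apply le_antisymm
    · refine partZ_le hnonneg fun i _ => ?_
      have hn : 0 < n := i.pos
      refine (hπx ⟨0, hn⟩ i (Fin.le_def.2 (Nat.zero_le _))).trans ?_
      have : (Finset.univ.filter fun s => I s < ⟨0, hn⟩ ∧ ⟨0, hn⟩ ≤ J s) = ∅ := by
        simp [Fin.lt_def]
      rw [this, Finset.card_empty, Nat.cast_zero, add_zero]
      exact le_partZ (hy1 _)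
    · refine partZ_le (partZ_nonneg (fun i => ?_) 1) fun i hi => ?_
      · have := hx1 i
        omega
      · refine le_trans ?_ (le_partZ (i := i) ?_) <;> omega
  · refine partZ_le (partZ_nonneg (fun i => by linarith [hx1 i]) 1) fun i _ => ?_
    have := le_partZ (X := x) (hy1 i)
    omega
end
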